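/- arXiv:2310.18971 — 2 statements merged into one kernel-verified Lean document; each statement's English description precedes it below -/
import Mathlib

section
/- Let f : G → G be a graph map and let Y and Y′ be component-cyclic f-invariant closed sets contained in G − P(f). If Y ∩ Y′ ≠ ∅, then ω(f|Y) = ω(f|Y′), where ω(f|Y) = ⋃_{y ∈ Y} ω(y, f|Y). -/
open Set Function Filter Topology Metric

noncomputable section

/-- An open arc: a subspace homeomorphic to the open interval `(0,1)`. -/
def IsOpenArc {G : Type*} [TopologicalSpace G] (A : Set G) : Prop :=
  Nonempty (A ≃ₜ Set.Ioo (0 : ℝ) 1)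

/-- A circle: a subspace homeomorphic to the unit circle. -/
def IsCircle {G : Type*} [TopologicalSpace G] (C : Set G) : Prop :=
  Nonempty (C ≃ₜ Metric.sphere (0 : ℂ) 1)

/-- A (topological) graph: a non-degenerate compact connected metric space with a finite
vertex set `V` such that every connected component of the complement of `V` is an open arc,
and every circle contains at least three vertices. -/
structure IsTopGraph {G : Type*} [MetricSpace G] (V : Set G) : Prop where
  nontrivial : Nontrivial G
  compact : CompactSpace G
  connected : ConnectedSpace G
  finite_vertexSet : V.Finite
  component_openArc : ∀ x ∈ Vᶜ, IsOpenArc (connectedComponentIn Vᶜ x)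
  circle_vertices : ∀ C : Set G, IsCircle C → 3 ≤ (C ∩ V).ncard

/-- The set of eventually periodic points: points with finite orbit. -/
def evPeriodicPts {G : Type*} (f : G → G) : Set G :=
  {x | (Set.range fun n : ℕ => f^[n] x).Finite}

/-- `EP_n(f)`: points whose orbit contains at most `n` points. -/
def evPeriodicPtsLe {G : Type*} (f : G → G) (n : ℕ) : Set G :=
  {x | (Set.range fun i : ℕ => f^[i] x).encard ≤ n}

/-- The ω-limit set of a point `x` under `f`. -/
def omegaSet {G : Type*} [TopologicalSpace G] (f : G → G) (x : G) : Set G :=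
  ⋂ i : ℕ, closure (Set.range fun n : ℕ => f^[n + i] x)

/-- The ω-limit set of `f`. -/
def omegaLimitSet {G : Type*} [TopologicalSpace G] (f : G → G) : Set G :=
  ⋃ x : G, omegaSet f x

/-- The set of recurrent points of `f`. -/
def recurrentPts {G : Type*} [TopologicalSpace G] (f : G → G) : Set G :=
  {x | x ∈ omegaSet f x}

/-- The set of non-wandering points of `f`. -/
def nonwanderingPts {G : Type*} [TopologicalSpace G] (f : G → G) : Set G :=
  {x | ∀ U : Set G, IsOpen U → x ∈ U → ∃ n : ℕ, 0 < n ∧ (f^[n] '' U ∩ U).Nonempty}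

/-- The set of almost periodic points of `f`. -/
def almostPeriodicPts {G : Type*} [TopologicalSpace G] (f : G → G) : Set G :=
  {x | ∀ U : Set G, IsOpen U → x ∈ U →
    ∃ m : ℕ, 0 < m ∧ ∀ n : ℕ, ∃ i : ℕ, 1 ≤ i ∧ i ≤ m ∧ f^[n + i] x ∈ U}

/-- The ω-limit set of `x` under the restriction `f|K` (closures taken in the subspace `K`). -/
def omegaSetIn {G : Type*} [TopologicalSpace G] (f : G → G) (K : Set G) (x : G) : Set G :=
  ⋂ i : ℕ, (closure (Set.range fun n : ℕ => f^[n + i] x) ∩ K)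

/-- The ω-limit set `ω(f|K)` of the restriction of `f` to `K`. -/
def omegaLimitSetIn {G : Type*} [TopologicalSpace G] (f : G → G) (K : Set G) : Set G :=
  ⋃ x ∈ K, omegaSetIn f K x

/-- The non-wandering set `Ω(f|K)` of the restriction of `f` to `K`. -/
def nonwanderingPtsIn {G : Type*} [TopologicalSpace G] (f : G → G) (K : Set G) : Set G :=
  {x | x ∈ K ∧ ∀ U : Set G, IsOpen U → x ∈ U →
    ∃ n : ℕ, 0 < n ∧ (f^[n] '' (U ∩ K) ∩ (U ∩ K)).Nonempty}

/-- The almost periodic set `AP(f|K)` of the restriction of `f` to `K`. -/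
def almostPeriodicPtsIn {G : Type*} [TopologicalSpace G] (f : G → G) (K : Set G) : Set G :=
  {x | x ∈ K ∧ ∀ U : Set G, IsOpen U → x ∈ U →
    ∃ m : ℕ, 0 < m ∧ ∀ n : ℕ, ∃ i : ℕ, 1 ≤ i ∧ i ≤ m ∧ f^[n + i] x ∈ U}

/-- The orbit `O(K,f)` of a set `K` under `f`. -/
def setOrbit {G : Type*} (f : G → G) (K : Set G) : Set G := ⋃ i : ℕ, f^[i] '' K

/-- The orbit segment `O_n(K,f)`. -/
def setOrbitSeg {G : Type*} (f : G → G) (K : Set G) (n : ℕ) : Set G :=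
  ⋃ i ≤ n, f^[i] '' K

/-- The inverse orbit (absorbed set) `O₋(K,f)`. -/
def invOrbit {G : Type*} (f : G → G) (K : Set G) : Set G := ⋃ i : ℕ, f^[i] ⁻¹' K

/-- The main absorbed set `Ab(K,f)`: the union of the connected components of `O₋(K,f)`
that meet `K`. -/
def mainAbsorbed {G : Type*} [TopologicalSpace G] (f : G → G) (K : Set G) : Set G :=
  ⋃ x ∈ K, connectedComponentIn (invOrbit f K) x

/-- A minimal set of `f`: nonempty, closed, invariant, with no proper such subset. -/
def IsMinimalSet {G : Type*} [TopologicalSpace G] (f : G → G) (M : Set G) : Prop :=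
  M.Nonempty ∧ IsClosed M ∧ f '' M ⊆ M ∧
    ∀ N : Set G, N ⊆ M → N.Nonempty → IsClosed N → f '' N ⊆ N → N = M

open Classical in
/-- The valence of a point `x` in a metric space: the limit, as `r → 0⁺`, of the number of
boundary points of the ball `B(x,r)` (defined as the eventual value, if it exists). -/
def valence {G : Type*} [MetricSpace G] (x : G) : ℕ :=
  if h : ∃ n : ℕ, ∀ᶠ r in nhdsWithin (0 : ℝ) (Set.Ioi 0),
      (frontier (Metric.ball x r)).ncard = n
  then h.choose else 0

/-- The set of branching points. -/
def branchPts (G : Type*) [MetricSpace G] : Set G := {x | 2 < valence x}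

/-- The total branching number `ξ(U)` of a subset `U` of `G`. -/
def totalBranch {G : Type*} [MetricSpace G] (U : Set G) : ℕ :=
  ∑ᶠ v ∈ U ∩ branchPts G, (valence v - 2)

/-- Cyclic successor on `Fin k`. -/
def finSucc {k : ℕ} (i : Fin k) : Fin k := ⟨(i.1 + 1) % k, Nat.mod_lt _ i.pos⟩

/-- `C : Fin k → Set G` enumerates the connected components of `X`, and `f` maps each
component into the (cyclically) next one. -/
def IsCyclicDecomp {G : Type*} [TopologicalSpace G] (f : G → G) (X : Set G)
    {k : ℕ} (C : Fin k → Set G) : Prop :=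
  (⋃ i, C i) = X ∧ (∀ i, (C i).Nonempty) ∧
  (∀ i, ∀ x ∈ C i, connectedComponentIn X x = C i) ∧
  Function.Injective C ∧ ∀ i, f '' C i ⊆ C (finSucc i)

/-- A component-cyclic `f`-invariant set. -/
def ComponentCyclic {G : Type*} [TopologicalSpace G] (f : G → G) (X : Set G) : Prop :=
  ∃ (k : ℕ) (C : Fin k → Set G), 0 < k ∧ IsCyclicDecomp f X C

/-- `A` is a connected component of `S`. -/
def IsCompOf {G : Type*} [TopologicalSpace G] (A S : Set G) : Prop :=
  ∃ x ∈ S, connectedComponentIn S x = A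

/-- The distance between two sets. -/
def setDist {G : Type*} [MetricSpace G] (A B : Set G) : ℝ :=
  sInf {r : ℝ | ∃ a ∈ A, ∃ b ∈ B, dist a b = r}

end


theorem isCircle_image_Icc {G : Type*} [TopologicalSpace G] [T2Space G] {δ : ℝ → G} {T : ℝ}
    (hT : 0 < T) (hδ : ContinuousOn δ (Icc 0 T)) (h0 : δ 0 = δ T) (hinj : InjOn δ (Ico 0 T)) :
    IsCircle (δ '' Icc 0 T) := by
  have : Fact (0 < T) := ⟨hT⟩
  have hc : Continuous (AddCircle.liftIco T 0 δ) := AddCircle.liftIco_zero_continuous h0 hδ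
  have hrep : ∀ x : AddCircle T, ∃ t ∈ Ico 0 T, (t : AddCircle T) = x := by
    intro x
    have := (AddCircle.equivIco T 0 x).2
    refine ⟨(AddCircle.equivIco T 0 x : ℝ), by simpa using this, ?_⟩
    exact (AddCircle.equivIco T 0).symm_apply_apply x
  have hi : Injective (AddCircle.liftIco T 0 δ) := by
    intro x y hxy
    obtain ⟨s, hs, rfl⟩ := hrep x
    obtain ⟨t, ht, rfl⟩ := hrep y
    rw [AddCircle.liftIco_zero_coe_apply hs, AddCircle.liftIco_zero_coe_apply ht] at hxy
    rw [hinj hs ht hxy]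
  have hr : range (AddCircle.liftIco T 0 δ) = δ '' Icc 0 T := by
    ext z
    constructor
    · rintro ⟨x, rfl⟩
      obtain ⟨s, hs, rfl⟩ := hrep x
      rw [AddCircle.liftIco_zero_coe_apply hs]
      exact ⟨s, Ico_subset_Icc_self hs, rfl⟩
    · rintro ⟨t, ht, rfl⟩
      rcases ht.2.lt_or_eq with h | rfl
      · exact ⟨t, AddCircle.liftIco_zero_coe_apply ⟨ht.1, h⟩⟩
      · exact ⟨(0 : ℝ), by rw [AddCircle.liftIco_zero_coe_apply ⟨le_rfl, hT⟩, h0]⟩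
  have e := (hc.isClosedEmbedding hi).isEmbedding.toHomeomorph
  rw [hr] at e
  exact ⟨e.symm.trans (AddCircle.homeomorphCircle hT.ne')⟩

theorem exists_tendsto_of_mapClusterPt_mem_finite {G : Type*} [TopologicalSpace G] [T2Space G]
    [CompactSpace G] {V : Set G} (hV : V.Finite) {g : ℝ → G} (hg : ContinuousOn g (Ioo 0 1))
    (hcl : ∀ x, MapClusterPt x (𝓝[>] (0 : ℝ)) g → x ∈ V) :
    ∃ v ∈ V, Tendsto g (𝓝[>] 0) (𝓝 v) := by
  obtain ⟨v, hv⟩ := exists_clusterPt_of_compactSpace (map g (𝓝[>] (0 : ℝ)))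
  refine ⟨v, hcl v hv, le_nhds_of_unique_clusterPt fun w hw => ?_⟩
  by_contra hne
  have hsep : SeparatedNhds ({v} : Set G) (V \ {v}) :=
    SeparatedNhds.of_isCompact_isCompact isCompact_singleton hV.sdiff.isCompact
      disjoint_sdiff_right
  obtain ⟨A, B, hA, hB, hvA, hVB, hAB⟩ := hsep
  have hev : ∀ᶠ t in 𝓝[>] (0 : ℝ), g t ∈ A ∪ B := by
    by_contra hfr
    rw [not_eventually] at hfr
    obtain ⟨x, hx, hxc⟩ :=
      (hA.union hB).isClosed_compl.isCompact.exists_mapClusterPt_of_frequently hfr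
    by_cases hxv : x = v
    · exact hx (Or.inl (hvA hxv))
    · exact hx (Or.inr (hVB ⟨hcl x hxc, hxv⟩))
  obtain ⟨ε, hε, hsub⟩ := (mem_nhdsGT_iff_exists_Ioo_subset' (zero_lt_one' ℝ)).1
    (hev.and (Ioo_mem_nhdsGT (zero_lt_one' ℝ)))
  have hpre : IsPreconnected (g '' Ioo 0 ε) :=
    isPreconnected_Ioo.image g (hg.mono fun t ht => (hsub ht).2)
  have hmem : Ioo 0 ε ∈ 𝓝[>] (0 : ℝ) := Ioo_mem_nhdsGT hε
  have hvA' : ∃ᶠ t in 𝓝[>] (0 : ℝ), g t ∈ A :=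
    MapClusterPt.frequently hv (hA.mem_nhds (hvA rfl))
  have hwB : ∃ᶠ t in 𝓝[>] (0 : ℝ), g t ∈ B :=
    MapClusterPt.frequently hw (hB.mem_nhds (hVB ⟨hcl w hw, hne⟩))
  obtain ⟨s, hs, hsI⟩ := (hvA'.and_eventually hmem).exists
  obtain ⟨t, ht, htI⟩ := (hwB.and_eventually hmem).exists
  have := hpre.subset_left_of_subset_union hA hB hAB (image_subset_iff.2 fun t ht => (hsub ht).1)
    ⟨g s, mem_image_of_mem g hsI, hs⟩
  exact hAB.le_bot ⟨this (mem_image_of_mem g htI), ht⟩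

theorem closure_connectedComponentIn_subset {G : Type*} [TopologicalSpace G] (F : Set G) (x : G) :
    closure (connectedComponentIn F x) ⊆ connectedComponentIn F x ∪ Fᶜ := by
  intro y hy
  by_cases hyF : y ∈ F
  · left
    by_cases hx : x ∈ F
    · have hpre : IsPreconnected (insert y (connectedComponentIn F x)) :=
        isPreconnected_connectedComponentIn.subset_closure (subset_insert _ _)
          (insert_subset hy subset_closure)
      exact hpre.subset_connectedComponentIn
        (mem_insert_of_mem _ (mem_connectedComponentIn hx))
        (insert_subset hyF (connectedComponentIn_subset F x)) (mem_insert _ _)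
    · simp [connectedComponentIn_eq_empty hx] at hy
  · exact Or.inr hyF

/-- `g` parametrizes the edge `U` by `(0,1)` and extends continuously to `[0,1]` with endpoints
in the vertex set `V`. -/
structure IsEdgeParam {G : Type*} [TopologicalSpace G] (V U : Set G) (g : ℝ → G) : Prop where
  continuousOn : ContinuousOn g (Icc 0 1)
  injOn : InjOn g (Ioo 0 1)
  image_eq : g '' Ioo 0 1 = U
  left_mem : g 0 ∈ V
  right_mem : g 1 ∈ V

theorem exists_param_of_isOpenArc {G : Type*} [TopologicalSpace G] [T2Space G] [CompactSpace G]
    {V U : Set G} (hV : V.Finite) (hU : closure U ⊆ U ∪ V)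
    (hA : IsOpenArc U) :
    ∃ g : ℝ → G, IsEdgeParam V U g := by
  obtain ⟨h⟩ := hA
  have hhalf : (1 / 2 : ℝ) ∈ Ioo (0 : ℝ) 1 := by norm_num
  set k : ℝ → G := fun t => if ht : t ∈ Ioo (0 : ℝ) 1 then (h.symm ⟨t, ht⟩ : G)
    else h.symm ⟨1 / 2, hhalf⟩ with hk
  have hkv : ∀ t (ht : t ∈ Ioo (0 : ℝ) 1), k t = h.symm ⟨t, ht⟩ := fun t ht => dif_pos ht
  have hkU : ∀ t ∈ Ioo (0 : ℝ) 1, k t ∈ U := fun t ht => by rw [hkv t ht]; exact (h.symm _).2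
  have hkc : ContinuousOn k (Ioo 0 1) := by
    rw [continuousOn_iff_continuous_domRestrict]
    convert continuous_subtype_val.comp h.symm.continuous using 1
    ext t
    exact hkv t t.2
  have hki : InjOn k (Ioo 0 1) := by
    intro s hs t ht hst
    rw [hkv s hs, hkv t ht] at hst
    simpa using h.symm.injective (Subtype.ext hst)
  have hkim : k '' Ioo 0 1 = U := by
    refine Subset.antisymm (image_subset_iff.2 hkU) fun y hy => ?_
    exact ⟨h ⟨y, hy⟩, (h ⟨y, hy⟩).2, by rw [hkv _ (h ⟨y, hy⟩).2]; simp⟩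
  have hcl : ∀ {l : Filter ℝ} {a : ℝ}, l ≤ 𝓝 a → a ∉ Ioo (0 : ℝ) 1 → Ioo (0 : ℝ) 1 ∈ l →
      ∀ x, MapClusterPt x l k → x ∈ V := by
    intro l a hla ha hl x hx
    have hxc : x ∈ closure U := mem_closure_iff_nhds.2 fun W hW => by
      obtain ⟨t, ht, htI⟩ := ((mapClusterPt_iff_frequently.1 hx W hW).and_eventually hl).exists
      exact ⟨k t, ht, hkU t htI⟩
    refine (hU hxc).resolve_left fun hxU => ?_
    have hne : ((h ⟨x, hxU⟩ : Ioo (0 : ℝ) 1) : ℝ) ≠ a := fun hc => ha (hc ▸ (h ⟨x, hxU⟩).2)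
    obtain ⟨A, B, hA, hB, hxA, haB, hAB⟩ := t2_separation hne
    have hopen : IsOpen {y : U | ((h y : Ioo (0 : ℝ) 1) : ℝ) ∈ A} :=
      hA.preimage (continuous_subtype_val.comp h.continuous)
    obtain ⟨W, hW, hWe⟩ := isOpen_induced_iff.1 hopen
    have hxW : x ∈ W := by
      have : (⟨x, hxU⟩ : U) ∈ Subtype.val ⁻¹' W := by rw [hWe]; exact hxA
      exact this
    obtain ⟨t, ⟨htW, htI⟩, htB⟩ := (((mapClusterPt_iff_frequently.1 hx W
      (hW.mem_nhds hxW)).and_eventually hl).and_eventually (hla (hB.mem_nhds haB))).exists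
    have htA : (h.symm ⟨t, htI⟩) ∈ Subtype.val ⁻¹' W := by
      rw [hkv t htI] at htW; exact htW
    rw [hWe] at htA
    exact hAB.le_bot ⟨by simpa using htA, htB⟩
  have h0 := exists_tendsto_of_mapClusterPt_mem_finite hV hkc
    (hcl nhdsWithin_le_nhds (by simp) (Ioo_mem_nhdsGT zero_lt_one))
  have h1 := exists_tendsto_of_mapClusterPt_mem_finite (g := fun t => k (1 - t)) hV
    (hkc.comp (by fun_prop) fun t ht => ⟨by linarith [ht.2], by linarith [ht.1]⟩) (by
      intro x hx
      have ht : Tendsto (fun t : ℝ => 1 - t) (𝓝[>] 0) (𝓝[<] 1) := by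
        refine tendsto_nhdsWithin_iff.2 ⟨?_, ?_⟩
        · exact (Continuous.tendsto' (by fun_prop) 0 1 (by simp)).mono_left nhdsWithin_le_nhds
        · filter_upwards [self_mem_nhdsWithin] with t ht
          simpa using ht
      exact hcl (l := 𝓝[<] 1) nhdsWithin_le_nhds (by simp) (Ioo_mem_nhdsLT zero_lt_one) x
        (hx.of_comp ht))
  obtain ⟨v, hv, hv0⟩ := h0
  obtain ⟨w, hw, hw0⟩ := h1
  have hw1 : Tendsto k (𝓝[<] 1) (𝓝 w) := by
    have ht : Tendsto (fun t : ℝ => 1 - t) (𝓝[<] 1) (𝓝[>] 0) := by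
      refine tendsto_nhdsWithin_iff.2 ⟨?_, ?_⟩
      · exact (Continuous.tendsto' (by fun_prop) 1 0 (by simp)).mono_left nhdsWithin_le_nhds
      · filter_upwards [self_mem_nhdsWithin] with t ht
        simpa using ht
    simpa [Function.comp_def] using hw0.comp ht
  have heq : EqOn (extendFrom (Ioo 0 1) k) k (Ioo 0 1) := fun t ht =>
    extendFrom_extends hkc t ht
  refine ⟨extendFrom (Ioo 0 1) k, continuousOn_Icc_extendFrom_Ioo hkc hv0 hw1,
    hki.congr heq.symm, by rw [heq.image_eq, hkim], ?_, ?_⟩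
  · rwa [eq_lim_at_left_extendFrom_Ioo zero_lt_one hv0]
  · rwa [eq_lim_at_right_extendFrom_Ioo zero_lt_one hw1]

namespace IsEdgeParam

variable {G : Type*} [TopologicalSpace G] {V U : Set G} {g : ℝ → G}

theorem apply_mem (hg : IsEdgeParam V U g) {t : ℝ} (ht : t ∈ Ioo (0 : ℝ) 1) : g t ∈ U :=
  hg.image_eq ▸ mem_image_of_mem g ht

theorem injOn_Icc (hg : IsEdgeParam V U g) (hUV : Disjoint U V) (hne : g 0 ≠ g 1) :
    InjOn g (Icc 0 1) := by
  have hend : ∀ s t : ℝ, s = 0 ∨ s = 1 → t ∈ Ioo (0 : ℝ) 1 → g s ≠ g t := by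
    rintro s t (rfl | rfl) ht h
    · exact hUV.le_bot ⟨hg.apply_mem ht, h ▸ hg.left_mem⟩
    · exact hUV.le_bot ⟨hg.apply_mem ht, h ▸ hg.right_mem⟩
  have hcases : ∀ t ∈ Icc (0 : ℝ) 1, (t = 0 ∨ t = 1) ∨ t ∈ Ioo (0 : ℝ) 1 := by
    intro t ht
    by_cases h0 : t = 0
    · exact Or.inl (Or.inl h0)
    by_cases h1 : t = 1
    · exact Or.inl (Or.inr h1)
    exact Or.inr ⟨lt_of_le_of_ne ht.1 (Ne.symm h0), lt_of_le_of_ne ht.2 h1⟩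
  intro s hs t ht hst
  rcases hcases s hs with hs' | hs' <;> rcases hcases t ht with ht' | ht'
  · rcases hs' with rfl | rfl <;> rcases ht' with rfl | rfl
    · rfl
    · exact absurd hst hne
    · exact absurd hst.symm hne
    · rfl
  · exact absurd hst (hend s t hs' ht')
  · exact absurd hst.symm (hend t s ht' hs')
  · exact hg.injOn hs' ht' hst

theorem image_Icc_inter_subset (hg : IsEdgeParam V U g) (hUV : Disjoint U V) :
    g '' Icc 0 1 ∩ V ⊆ {g 0, g 1} := by
  rintro _ ⟨⟨t, ht, rfl⟩, hV⟩
  by_cases h0 : t = 0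
  · simp [h0]
  by_cases h1 : t = 1
  · simp [h1]
  exact (hUV.le_bot ⟨hg.apply_mem
    ⟨lt_of_le_of_ne ht.1 (Ne.symm h0), lt_of_le_of_ne ht.2 h1⟩, hV⟩).elim

theorem left_ne_right [T2Space G] (hg : IsEdgeParam V U g) (hUV : Disjoint U V)
    (hcirc : ∀ C : Set G, IsCircle C → 3 ≤ (C ∩ V).ncard) : g 0 ≠ g 1 := by
  intro h
  have hinj : InjOn g (Ico 0 1) := by
    intro s hs t ht hst
    rcases hs.1.eq_or_lt with rfl | hs0 <;> rcases ht.1.eq_or_lt with rfl | ht0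
    · rfl
    · exact (hUV.le_bot ⟨hg.apply_mem ⟨ht0, ht.2⟩, hst ▸ hg.left_mem⟩).elim
    · exact (hUV.le_bot ⟨hg.apply_mem ⟨hs0, hs.2⟩, hst ▸ hg.left_mem⟩).elim
    · exact hg.injOn ⟨hs0, hs.2⟩ ⟨ht0, ht.2⟩ hst
  have h3 := hcirc _ (isCircle_image_Icc one_pos hg.continuousOn h hinj)
  have h2 := (ncard_le_ncard (hg.image_Icc_inter_subset hUV) (by simp)).trans
    ((ncard_insert_le _ _).trans_eq (congrArg (· + 1) (ncard_singleton (g 1))))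
  omega

theorem not_parallel [T2Space G] {U' : Set G} {g' : ℝ → G} (hg : IsEdgeParam V U g)
    (hg' : IsEdgeParam V U' g') (hUV : Disjoint U V) (hUV' : Disjoint U' V)
    (hUU' : Disjoint U U') (hcirc : ∀ C : Set G, IsCircle C → 3 ≤ (C ∩ V).ncard)
    (h0 : g 0 = g' 0) (h1 : g 1 = g' 1) : False := by
  have hinj := hg.injOn_Icc hUV (hg.left_ne_right hUV hcirc)
  have hinj' := hg'.injOn_Icc hUV' (hg'.left_ne_right hUV' hcirc)
  set δ : ℝ → G := fun t => if t ≤ 1 then g t else g' (2 - t) with hδ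
  have hδ1 : ∀ t, t ≤ 1 → δ t = g t := fun t ht => if_pos ht
  have hδ2 : ∀ t, 1 ≤ t → δ t = g' (2 - t) := by
    intro t ht
    rcases ht.eq_or_lt with rfl | ht
    · rw [hδ1 1 le_rfl, h1]; norm_num
    · exact if_neg ht.not_ge
  have hc : ContinuousOn δ (Icc 0 2) := by
    rw [← Icc_union_Icc_eq_Icc zero_le_one one_le_two]
    refine ContinuousOn.union_of_isClosed ?_ ?_ isClosed_Icc isClosed_Icc
    · exact hg.continuousOn.congr fun t ht => hδ1 t ht.2
    · refine ContinuousOn.congr (f := fun t => g' (2 - t)) ?_ fun t ht => hδ2 t ht.1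
      exact hg'.continuousOn.comp (by fun_prop)
        fun t ht => ⟨by linarith [ht.2], by linarith [ht.1]⟩
  have hcross : ∀ s t : ℝ, 0 ≤ s → s ≤ 1 → 1 < t → t < 2 → δ s ≠ δ t := by
    intro s t hs0 hs1 ht1 ht2 hst
    have hmem : δ t ∈ U' := by
      rw [hδ2 t ht1.le]; exact hg'.apply_mem ⟨by linarith, by linarith⟩
    rw [← hst, hδ1 s hs1] at hmem
    rcases hs0.eq_or_lt with rfl | hs0
    · exact hUV'.le_bot ⟨hmem, hg.left_mem⟩
    rcases hs1.eq_or_lt with rfl | hs1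
    · exact hUV'.le_bot ⟨hmem, hg.right_mem⟩
    exact hUU'.le_bot ⟨hg.apply_mem ⟨hs0, hs1⟩, hmem⟩
  have hδinj : InjOn δ (Ico 0 2) := by
    intro s hs t ht hst
    rcases le_or_gt s 1 with hs1 | hs1 <;> rcases le_or_gt t 1 with ht1 | ht1
    · rw [hδ1 s hs1, hδ1 t ht1] at hst
      exact hinj ⟨hs.1, hs1⟩ ⟨ht.1, ht1⟩ hst
    · exact absurd hst (hcross s t hs.1 hs1 ht1 ht.2)
    · exact absurd hst.symm (hcross t s ht.1 ht1 hs1 hs.2)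
    · rw [hδ2 s hs1.le, hδ2 t ht1.le] at hst
      have := hinj' ⟨by linarith [hs.2], by linarith⟩ ⟨by linarith [ht.2], by linarith⟩ hst
      linarith
  have h3 := hcirc _ (isCircle_image_Icc two_pos hc
    (by rw [hδ1 0 zero_le_one, hδ2 2 one_le_two, h0, sub_self]) hδinj)
  have hsub : δ '' Icc 0 2 ∩ V ⊆ {g 0, g 1} := by
    rintro _ ⟨⟨t, ht, rfl⟩, hV⟩
    rcases le_total t 1 with ht1 | ht1
    · rw [hδ1 t ht1] at hV ⊢
      exact hg.image_Icc_inter_subset hUV ⟨mem_image_of_mem g ⟨ht.1, ht1⟩, hV⟩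
    · rw [hδ2 t ht1] at hV ⊢
      rw [h0, h1]
      exact hg'.image_Icc_inter_subset hUV'
        ⟨mem_image_of_mem g' ⟨by linarith [ht.2], by linarith⟩, hV⟩
  have h2 := (ncard_le_ncard hsub (by simp)).trans ((ncard_insert_le _ _).trans_eq (congrArg (· + 1) (ncard_singleton (g 1))))
  omega

theorem isClosed_image_Icc [T2Space G] (hg : IsEdgeParam V U g) {a b : ℝ} (ha : 0 ≤ a)
    (hb : b ≤ 1) : IsClosed (g '' Icc a b) :=
  (isCompact_Icc.image_of_continuousOn (hg.continuousOn.mono (Icc_subset_Icc ha hb))).isClosed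

theorem isOpen_image_Ioo [T2Space G] (hg : IsEdgeParam V U g) (hUV : Disjoint U V)
    (hU : IsOpen U) {a b : ℝ} (ha : 0 ≤ a) (hb : b ≤ 1) : IsOpen (g '' Ioo a b) := by
  have heq : g '' Ioo a b = U \ (g '' (Icc 0 1 \ Ioo a b)) := by
    ext y
    constructor
    · rintro ⟨t, ht, rfl⟩
      have htI : t ∈ Ioo (0 : ℝ) 1 := ⟨ha.trans_lt ht.1, ht.2.trans_le hb⟩
      refine ⟨hg.apply_mem htI, ?_⟩
      rintro ⟨s, ⟨hs, hsn⟩, hst⟩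
      by_cases hsI : s ∈ Ioo (0 : ℝ) 1
      · exact hsn (hg.injOn hsI htI hst ▸ ht)
      · have hsV : g s ∈ V := by
          by_cases h0 : s = 0
          · exact h0 ▸ hg.left_mem
          by_cases h1 : s = 1
          · exact h1 ▸ hg.right_mem
          exact (hsI ⟨lt_of_le_of_ne hs.1 (Ne.symm h0), lt_of_le_of_ne hs.2 h1⟩).elim
        exact hUV.le_bot ⟨hg.apply_mem htI, hst ▸ hsV⟩
    · rintro ⟨hy, hyn⟩
      rw [← hg.image_eq] at hy
      obtain ⟨t, ht, rfl⟩ := hy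
      by_contra hcon
      exact hyn ⟨t, ⟨Ioo_subset_Icc_self ht, fun h => hcon ⟨t, h, rfl⟩⟩, rfl⟩
  rw [heq]
  exact hU.sdiff ((isCompact_Icc.diff isOpen_Ioo).image_of_continuousOn
    (hg.continuousOn.mono sdiff_subset)).isClosed

theorem finite_frontier_inter [T2Space G] (hg : IsEdgeParam V U g) (hUV : Disjoint U V)
    (hU : IsOpen U) {C : Set G} (hC : IsPreconnected C) : (frontier C ∩ U).Finite := by
  have hnear : ∀ a b t : ℝ, 0 ≤ a → b ≤ 1 → a < t → t < b → g t ∈ frontier C →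
      (∃ s ∈ Ioo a b, g s ∈ C) ∧ ∃ s ∈ Ioo a b, g s ∉ C := by
    intro a b t ha hb hat htb ht
    have ho := hg.isOpen_image_Ioo hUV hU ha hb
    rw [frontier_eq_closure_inter_closure] at ht
    obtain ⟨_, ⟨s, hs, rfl⟩, hsC⟩ := mem_closure_iff.1 ht.1 _ ho ⟨t, ⟨hat, htb⟩, rfl⟩
    obtain ⟨_, ⟨s', hs', rfl⟩, hsC'⟩ := mem_closure_iff.1 ht.2 _ ho ⟨t, ⟨hat, htb⟩, rfl⟩
    exact ⟨⟨s, hs, hsC⟩, s', hs', hsC'⟩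
  have hfin : {t | t ∈ Ioo (0 : ℝ) 1 ∧ g t ∈ frontier C}.Finite := by
    by_contra hinf
    obtain ⟨F, hF, hF3⟩ := Set.Infinite.exists_subset_card_eq hinf 3
    let e := F.orderEmbOfFin hF3
    have he : ∀ i, e i ∈ Ioo (0 : ℝ) 1 ∧ g (e i) ∈ frontier C :=
      fun i => hF (F.orderEmbOfFin_mem hF3 i)
    have hpq : e 0 < e 1 := e.strictMono (by decide)
    have hqr : e 1 < e 2 := e.strictMono (by decide)
    obtain ⟨⟨hp0, hp1⟩, hp⟩ := he 0
    obtain ⟨⟨hq0, hq1⟩, hq⟩ := he 1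
    obtain ⟨⟨hr0, hr1⟩, hr⟩ := he 2
    generalize e 0 = p at *
    generalize e 1 = q at *
    generalize e 2 = r at *
    obtain ⟨m, hpm, hmq⟩ := exists_between hpq
    obtain ⟨n, hqn, hnr⟩ := exists_between hqr
    obtain ⟨⟨s₁, hs₁, hs₁C⟩, a, ha, haC⟩ :=
      hnear 0 m p le_rfl (by linarith) hp0 hpm hp
    obtain ⟨⟨s, hs, hsC⟩, c, hc, hcC⟩ :=
      hnear m n q (by linarith) (by linarith) hmq hqn hq
    obtain ⟨⟨s₂, hs₂, hs₂C⟩, b, hb, hbC⟩ :=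
      hnear n 1 r (by linarith) le_rfl hnr hr1 hr
    have hCab : C ⊆ g '' Ioo a b := by
      refine hC.subset_left_of_subset_union
        (hg.isOpen_image_Ioo hUV hU ha.1.le hb.2.le)
        (hg.isClosed_image_Icc ha.1.le hb.2.le).isOpen_compl
        (disjoint_compl_right.mono_left (image_mono Ioo_subset_Icc_self)) ?_
        ⟨g s, hsC, s, ⟨by linarith [ha.2, hs.1], by linarith [hb.1, hs.2]⟩, rfl⟩
      intro y hy
      by_cases hyI : y ∈ g '' Icc a b
      · obtain ⟨t, ht, rfl⟩ := hyI
        refine Or.inl ⟨t, ⟨lt_of_le_of_ne ht.1 ?_, lt_of_le_of_ne ht.2 ?_⟩, rfl⟩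
        · rintro rfl; exact haC hy
        · rintro rfl; exact hbC hy
      · exact Or.inr hyI
    have hc0 : 0 < c := by linarith [hc.1]
    have hc1 : c < 1 := by linarith [hc.2]
    have hdis : Disjoint (g '' Ioo 0 c) (g '' Ioo c 1) := by
      rw [Set.disjoint_left]
      rintro _ ⟨t, ht, rfl⟩ ⟨u, hu, hut⟩
      have := hg.injOn ⟨hc0.trans hu.1, hu.2⟩ ⟨ht.1, ht.2.trans hc1⟩ hut
      linarith [ht.2, hu.1]
    have hCc : C ⊆ g '' Ioo 0 c := by
      refine hC.subset_left_of_subset_union (hg.isOpen_image_Ioo hUV hU le_rfl hc1.le)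
        (hg.isOpen_image_Ioo hUV hU hc0.le le_rfl) hdis ?_
        ⟨g s₁, hs₁C, s₁, ⟨hs₁.1, by linarith [hs₁.2, hc.1]⟩, rfl⟩
      intro y hy
      obtain ⟨t, ht, rfl⟩ := hCab hy
      rcases lt_trichotomy t c with h | rfl | h
      · exact Or.inl ⟨t, ⟨ha.1.trans ht.1, h⟩, rfl⟩
      · exact absurd hy hcC
      · exact Or.inr ⟨t, ⟨h, ht.2.trans hb.2⟩, rfl⟩
    exact hdis.le_bot ⟨hCc hs₂C, s₂, ⟨by linarith [hs₂.1, hc.2], hs₂.2⟩, rfl⟩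
  refine (hfin.image g).subset ?_
  rintro y ⟨hy, hyU⟩
  rw [← hg.image_eq] at hyU
  obtain ⟨t, ht, rfl⟩ := hyU
  exact ⟨t, ⟨ht, hy⟩, rfl⟩

end IsEdgeParam

/-- A compact Hausdorff space covered by finitely many sets, each contained in a path,
is locally connected. -/
theorem locallyConnectedSpace_of_finite_paths {G : Type*} [TopologicalSpace G] [T2Space G]
    {S : Set (Set G)} (hS : S.Finite) (hcov : ⋃₀ S = univ)
    (hpath : ∀ U ∈ S, ∃ g : ℝ → G, ContinuousOn g (Icc 0 1) ∧ U ⊆ g '' Icc 0 1) :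
    LocallyConnectedSpace G := by
  choose p hpc hpU using hpath
  let : TopologicalSpace S := ⊥
  have : DiscreteTopology S := ⟨rfl⟩
  have : Finite S := hS
  have : LocallyConnectedSpace unitInterval :=
    (isQuotientMap_projIcc (h := zero_le_one (α := ℝ))).isCoinducing.locallyConnectedSpace
  let Φ : S × unitInterval → G := fun x => p x.1 x.1.2 x.2
  have hΦ : Continuous Φ := continuous_prod_of_discrete_left.2 fun U =>
    continuousOn_iff_continuous_domRestrict.1 (hpc U U.2)
  have hsurj : Surjective Φ := by
    intro y
    obtain ⟨U, hU, hy⟩ := mem_sUnion.1 (hcov ▸ mem_univ y : y ∈ ⋃₀ S)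
    obtain ⟨t, ht, rfl⟩ := hpU U hU hy
    exact ⟨(⟨U, hU⟩, ⟨t, ht⟩), rfl⟩
  exact (hΦ.isClosedMap.isQuotientMap hΦ hsurj).isCoinducing.locallyConnectedSpace

namespace IsTopGraph

variable {G : Type*} [MetricSpace G] {V : Set G}

/-- The edges of a topological graph: the connected components of the complement of `V`. -/
def edges (V : Set G) : Set (Set G) := {U | ∃ x ∈ Vᶜ, connectedComponentIn Vᶜ x = U}

theorem disjoint_of_mem_edges {U : Set G} (hU : U ∈ edges V) : Disjoint U V := by
  obtain ⟨x, -, rfl⟩ := hU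
  exact disjoint_compl_left.mono_left (connectedComponentIn_subset _ _)

theorem closure_subset_of_mem_edges {U : Set G} (hU : U ∈ edges V) : closure U ⊆ U ∪ V := by
  obtain ⟨x, -, rfl⟩ := hU
  simpa using closure_connectedComponentIn_subset Vᶜ x

theorem disjoint_of_mem_edges_of_ne {U U' : Set G} (hU : U ∈ edges V) (hU' : U' ∈ edges V)
    (hne : U ≠ U') : Disjoint U U' := by
  obtain ⟨x, -, rfl⟩ := hU
  obtain ⟨y, -, rfl⟩ := hU'
  rw [Set.disjoint_left]
  intro z hz hz'
  exact hne ((connectedComponentIn_eq hz).trans (connectedComponentIn_eq hz').symm)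

theorem mem_edge_or_mem (x : G) : (∃ U ∈ edges V, x ∈ U) ∨ x ∈ V := by
  by_cases hx : x ∈ V
  · exact Or.inr hx
  · exact Or.inl ⟨_, ⟨x, hx, rfl⟩, mem_connectedComponentIn hx⟩

theorem exists_isEdgeParam (hG : IsTopGraph V) {U : Set G} (hU : U ∈ edges V) :
    ∃ g : ℝ → G, IsEdgeParam V U g := by
  have := hG.compact
  refine exists_param_of_isOpenArc hG.finite_vertexSet (closure_subset_of_mem_edges hU) ?_
  obtain ⟨x, hx, rfl⟩ := hU
  exact hG.component_openArc x hx

theorem finite_edges (hG : IsTopGraph V) : (edges V).Finite := by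
  have := hG.nontrivial
  choose! g hg using fun U (hU : U ∈ edges V) => hG.exists_isEdgeParam hU
  refine Set.Finite.of_injOn (f := fun U => (g U 0, g U 1)) (t := V ×ˢ V)
    (fun U hU => ⟨(hg U hU).left_mem, (hg U hU).right_mem⟩) ?_
    (hG.finite_vertexSet.prod hG.finite_vertexSet)
  intro U hU U' hU' h
  by_contra hne
  exact (hg U hU).not_parallel (hg U' hU') (disjoint_of_mem_edges hU)
    (disjoint_of_mem_edges hU') (disjoint_of_mem_edges_of_ne hU hU' hne) hG.circle_vertices
    (congrArg Prod.fst h) (congrArg Prod.snd h)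

theorem isOpen_edge (hG : IsTopGraph V) {U : Set G} (hU : U ∈ edges V) : IsOpen U := by
  have hcl : IsClosed (V ∪ ⋃ U' ∈ edges V \ {U}, closure U') :=
    hG.finite_vertexSet.isClosed.union
      (hG.finite_edges.sdiff.isClosed_biUnion fun _ _ => isClosed_closure)
  convert hcl.isOpen_compl using 1
  ext y
  constructor
  · rintro hy (hyV | hy')
    · exact (disjoint_of_mem_edges hU).le_bot ⟨hy, hyV⟩
    · simp only [mem_iUnion] at hy'
      obtain ⟨U', ⟨hU', hne⟩, hyU'⟩ := hy'
      rcases closure_subset_of_mem_edges hU' hyU' with h | h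
      · exact (disjoint_of_mem_edges_of_ne hU' hU hne).le_bot ⟨h, hy⟩
      · exact (disjoint_of_mem_edges hU).le_bot ⟨hy, h⟩
  · intro hy
    by_contra hyU
    rcases mem_edge_or_mem (V := V) y with ⟨U', hU', h⟩ | h
    · refine hy (Or.inr (mem_biUnion ⟨hU', ?_⟩ (subset_closure h)))
      rintro rfl
      exact hyU h
    · exact hy (Or.inl h)

theorem locallyConnectedSpace (hG : IsTopGraph V) : LocallyConnectedSpace G := by
  refine locallyConnectedSpace_of_finite_paths
    (S := edges V ∪ (fun v => {v}) '' V) (hG.finite_edges.union (hG.finite_vertexSet.image _))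
    ?_ ?_
  · refine eq_univ_of_forall fun x => ?_
    rcases mem_edge_or_mem (V := V) x with ⟨U, hU, h⟩ | h
    · exact ⟨U, Or.inl hU, h⟩
    · exact ⟨{x}, Or.inr ⟨x, h, rfl⟩, rfl⟩
  · rintro U (hU | ⟨v, -, rfl⟩)
    · obtain ⟨g, hg⟩ := hG.exists_isEdgeParam hU
      exact ⟨g, hg.continuousOn, hg.image_eq ▸ image_mono Ioo_subset_Icc_self⟩
    · exact ⟨fun _ => v, continuousOn_const, by simp⟩

theorem finite_frontier (hG : IsTopGraph V) {C : Set G} (hC : IsPreconnected C) :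
    (frontier C).Finite := by
  refine (hG.finite_vertexSet.union (hG.finite_edges.biUnion
    (t := fun U => frontier C ∩ U) fun U hU => ?_)).subset fun y hy => ?_
  · obtain ⟨g, hg⟩ := hG.exists_isEdgeParam hU
    exact hg.finite_frontier_inter (disjoint_of_mem_edges hU) (hG.isOpen_edge hU) hC
  · rcases mem_edge_or_mem (V := V) y with ⟨U, hU, h⟩ | h
    · exact Or.inr (mem_biUnion hU ⟨hy, h⟩)
    · exact Or.inl h

end IsTopGraph

theorem frontier_iUnion_subset_of_finite {X ι : Type*} [TopologicalSpace X] [Finite ι]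
    (s : ι → Set X) : frontier (⋃ i, s i) ⊆ ⋃ i, frontier (s i) := by
  rintro x ⟨hx, hxi⟩
  rw [closure_iUnion_of_finite] at hx
  obtain ⟨i, hi⟩ := mem_iUnion.1 hx
  exact mem_iUnion.2 ⟨i, hi, fun h => hxi (interior_mono (subset_iUnion s i) h)⟩

theorem IsTopGraph.finite_frontier_iUnion {G ι : Type*} [MetricSpace G] [Finite ι] {V : Set G}
    (hG : IsTopGraph V) {C : ι → Set G} (hC : ∀ i, IsPreconnected (C i)) :
    (frontier (⋃ i, C i)).Finite :=
  (finite_iUnion fun i => hG.finite_frontier (hC i)).subset (frontier_iUnion_subset_of_finite C)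

theorem exists_mem_periodicPts_of_finite {X : Type*} {f : X → X} {S : Set X} (hS : S.Finite)
    (hf : MapsTo f S S) (hne : S.Nonempty) : ∃ x ∈ S, x ∈ periodicPts f := by
  obtain ⟨x, hx⟩ := hne
  obtain ⟨m, n, hmn, h⟩ := hS.exists_lt_map_eq_of_forall_mem (f := fun n : ℕ => f^[n] x)
    fun n => hf.iterate n hx
  refine ⟨f^[m] x, hf.iterate m hx, n - m, by omega, ?_⟩
  change f^[n - m] (f^[m] x) = f^[m] x
  rw [← iterate_add_apply, Nat.sub_add_cancel hmn.le]
  exact h.symm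

theorem exists_iterate_mem_interior {X : Type*} [TopologicalSpace X] {f : X → X} {Y : Set X}
    (hf : MapsTo f Y Y) (hfr : (frontier Y).Finite) (hP : Y ⊆ (periodicPts f)ᶜ) {x : X}
    (hx : x ∈ Y) : ∃ n : ℕ, f^[n] x ∈ interior Y := by
  by_contra! hcon
  have hsub : range (fun n : ℕ => f^[n] x) ⊆ frontier Y := by
    rintro _ ⟨n, rfl⟩
    exact ⟨subset_closure (hf.iterate n hx), hcon n⟩
  obtain ⟨_, ⟨n, rfl⟩, hp⟩ := exists_mem_periodicPts_of_finite (f := f) (hfr.subset hsub)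
    (by rintro _ ⟨n, rfl⟩; exact ⟨n + 1, iterate_succ_apply' f n x⟩) ⟨x, 0, rfl⟩
  exact hP (hf.iterate n hx) hp

theorem ComponentCyclic.mapsTo {X : Type*} [TopologicalSpace X] {f : X → X} {Y : Set X}
    (hY : ComponentCyclic f Y) : MapsTo f Y Y := by
  obtain ⟨k, C, -, rfl, -, -, -, hf⟩ := hY
  intro x hx
  obtain ⟨i, hi⟩ := mem_iUnion.1 hx
  exact mem_iUnion.2 ⟨_, hf i (mem_image_of_mem f hi)⟩

theorem IsCyclicDecomp.isPreconnected {X : Type*} [TopologicalSpace X] {f : X → X} {Y : Set X}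
    {k : ℕ} {C : Fin k → Set X} (hC : IsCyclicDecomp f Y C) (i : Fin k) :
    IsPreconnected (C i) := by
  obtain ⟨x, hx⟩ := hC.2.1 i
  exact hC.2.2.1 i x hx ▸ isPreconnected_connectedComponentIn

theorem IsCyclicDecomp.exists_iterate_mem {X : Type*} [TopologicalSpace X] {f : X → X}
    {Y : Set X} {k : ℕ} {C : Fin k → Set X} (hC : IsCyclicDecomp f Y C) {z : X} (hz : z ∈ Y)
    (j : Fin k) : ∃ n : ℕ, f^[n] z ∈ C j := by
  rw [← hC.1] at hz
  obtain ⟨i, hi⟩ := mem_iUnion.1 hz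
  have key : ∀ n : ℕ, ∃ l : Fin k, l.1 = (i.1 + n) % k ∧ f^[n] z ∈ C l := by
    intro n
    induction n with
    | zero => exact ⟨i, by simp [Nat.mod_eq_of_lt i.2], hi⟩
    | succ n ih =>
      obtain ⟨l, hl, hln⟩ := ih
      refine ⟨finSucc l, ?_, ?_⟩
      · simp [finSucc, hl, add_assoc]
      · rw [iterate_succ_apply']
        exact hC.2.2.2.2 l (mem_image_of_mem f hln)
  obtain ⟨l, hl, hln⟩ := key (k - i.1 + j.1)
  have hlj : l = j := by
    apply Fin.ext
    rw [hl, show i.1 + (k - i.1 + j.1) = j.1 + k by have := i.2; omega, Nat.add_mod_right,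
      Nat.mod_eq_of_lt j.2]
  exact ⟨_, hlj ▸ hln⟩

theorem exists_iterate_mem_of_componentCyclic_meet {G : Type*} [MetricSpace G] {V : Set G}
    (hG : IsTopGraph V) {f : G → G} (hf : Continuous f) {Y Y' : Set G}
    (hY : ComponentCyclic f Y) (hY' : ComponentCyclic f Y')
    (hYP : Y ⊆ (periodicPts f)ᶜ) (hY'P : Y' ⊆ (periodicPts f)ᶜ)
    (hmeet : (Y ∩ Y').Nonempty) {y : G} (hy : y ∈ Y) : ∃ n : ℕ, f^[n] y ∈ Y' := by
  have := hG.locallyConnectedSpace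
  have hfY := hY.mapsTo
  have hfY' := hY'.mapsTo
  obtain ⟨k, C, -, hC⟩ := hY
  obtain ⟨k', C', -, hC'⟩ := hY'
  have hfrY' : (frontier Y').Finite := hC'.1 ▸ hG.finite_frontier_iUnion hC'.isPreconnected
  set O : Set G := ⋃ n : ℕ, f^[n] ⁻¹' interior Y' with hO
  have hmemO : ∀ {x}, x ∈ O ↔ ∃ n : ℕ, f^[n] x ∈ interior Y' := by simp [hO]
  have hOo : IsOpen O :=
    isOpen_iUnion fun n => isOpen_interior.preimage (hf.iterate n)
  have hY'O : Y' ⊆ O := fun x hx => hmemO.2 (exists_iterate_mem_interior hfY' hfrY' hY'P hx)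
  have hOf : ∀ {x}, f x ∈ O → x ∈ O := by
    intro x hx
    obtain ⟨n, hn⟩ := hmemO.1 hx
    exact hmemO.2 ⟨n + 1, hn⟩
  have hfO : MapsTo f O O := by
    intro x hx
    obtain ⟨n, hn⟩ := hmemO.1 hx
    obtain ⟨m, hm⟩ := hmemO.1 (hY'O (hfY' (interior_subset hn)))
    refine hmemO.2 ⟨m + n, ?_⟩
    rwa [iterate_add_apply, ← iterate_succ_apply, iterate_succ_apply']
  set A : Set G := ⋃ x ∈ Y', connectedComponentIn O x with hA
  have hAo : IsOpen A := isOpen_biUnion fun x _ => hOo.connectedComponentIn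
  have hAO : A ⊆ O := iUnion₂_subset fun x _ => connectedComponentIn_subset O x
  have hY'A : Y' ⊆ A := fun x hx => mem_biUnion hx (mem_connectedComponentIn (hY'O hx))
  have hfA : MapsTo f A A := by
    intro p hp
    obtain ⟨x, hx, hp⟩ := mem_iUnion₂.1 hp
    refine mem_biUnion (hfY' hx) ?_
    exact (isPreconnected_connectedComponentIn.image f hf.continuousOn).subset_connectedComponentIn
      (mem_image_of_mem f (mem_connectedComponentIn (hY'O hx)))
      (hfO.mono_left (connectedComponentIn_subset O x)).image_subset
      (mem_image_of_mem f hp)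
  have hfrO : ∀ p ∈ frontier A, p ∉ O := by
    intro p hp hpO
    rw [hAo.frontier_eq] at hp
    obtain ⟨q, hqp, hqA⟩ := mem_closure_iff.1 hp.1 _ hOo.connectedComponentIn
      (mem_connectedComponentIn hpO)
    obtain ⟨x, hx, hqx⟩ := mem_iUnion₂.1 hqA
    refine hp.2 (mem_biUnion hx ?_)
    rw [connectedComponentIn_eq hqx, ← connectedComponentIn_eq hqp]
    exact mem_connectedComponentIn hpO
  have hffr : MapsTo f (frontier A) (frontier A) := by
    intro p hp
    rw [hAo.frontier_eq]
    exact ⟨hfA.closure hf (frontier_subset_closure hp), fun h => hfrO p hp (hOf (hAO h))⟩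
  have hfrA : (frontier A).Finite := by
    choose c hc using hC'.2.1
    have hAeq : A = ⋃ i, connectedComponentIn O (c i) := by
      refine Subset.antisymm (iUnion₂_subset fun x hx => ?_) (iUnion_subset fun i => ?_)
      · rw [← hC'.1] at hx
        obtain ⟨i, hi⟩ := mem_iUnion.1 hx
        have hiO : C' i ⊆ O := (hC'.1 ▸ subset_iUnion C' i : C' i ⊆ Y').trans hY'O
        rw [← connectedComponentIn_eq
          ((hC'.isPreconnected i).subset_connectedComponentIn (hc i) hiO hi)]
        exact subset_iUnion (fun i => connectedComponentIn O (c i)) i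
      · exact subset_biUnion_of_mem (u := fun x => connectedComponentIn O x)
          (hC'.1 ▸ mem_iUnion.2 ⟨i, hc i⟩ : c i ∈ Y')
    rw [hAeq]
    exact hG.finite_frontier_iUnion fun i => isPreconnected_connectedComponentIn
  have hdisj : ∀ p ∈ Y, p ∉ frontier A := by
    intro p hpY hpA
    obtain ⟨q, hq, hqP⟩ := exists_mem_periodicPts_of_finite (f := f) (S := Y ∩ frontier A)
      (hfrA.subset inter_subset_right) (hfY.inter_inter hffr) ⟨p, hpY, hpA⟩
    exact hYP hq.1 hqP
  obtain ⟨z, hzY, hzY'⟩ := hmeet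
  obtain ⟨j, hj⟩ := mem_iUnion.1 (hC.1 ▸ hy : y ∈ ⋃ i, C i)
  obtain ⟨n, hn⟩ := hC.exists_iterate_mem hzY j
  have hjY : C j ⊆ Y := hC.1 ▸ subset_iUnion C j
  have hjA : C j ⊆ A := by
    refine (hC.isPreconnected j).subset_left_of_subset_union hAo isClosed_closure.isOpen_compl
      (disjoint_compl_right.mono_left subset_closure) (fun p hp => ?_)
      ⟨f^[n] z, hn, hY'A (hfY'.iterate n hzY')⟩
    by_cases hpA : p ∈ A
    · exact Or.inl hpA
    · exact Or.inr fun hcl => hdisj p (hjY hp) (hAo.frontier_eq ▸ ⟨hcl, hpA⟩)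
  obtain ⟨m, hm⟩ := hmemO.1 (hAO (hjA hj))
  exact ⟨m, interior_subset hm⟩

theorem omegaLimitSetIn_subset_of_forall_exists_iterate_mem {X : Type*} [TopologicalSpace X]
    {f : X → X} {Y Y' : Set X} (hf : MapsTo f Y' Y') (hY' : IsClosed Y')
    (h : ∀ y ∈ Y, ∃ n : ℕ, f^[n] y ∈ Y') : omegaLimitSetIn f Y ⊆ omegaLimitSetIn f Y' := by
  intro p hp
  obtain ⟨y, hy, hp⟩ := mem_iUnion₂.1 hp
  obtain ⟨N, hN⟩ := h y hy
  refine mem_biUnion hN (mem_iInter.2 fun i => ?_)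
  have hcl : p ∈ closure (range fun n : ℕ => f^[n + i] (f^[N] y)) := by
    simpa only [← iterate_add_apply, add_assoc] using (mem_iInter.1 hp (i + N)).1
  refine ⟨hcl, closure_minimal ?_ hY' hcl⟩
  rintro _ ⟨n, rfl⟩
  exact hf.iterate (n + i) hN

/-- two component-cyclic `f`-invariant closed sets in `G − P(f)` that meet
have the same ω-limit set for the restricted maps. -/
theorem omega_eq_of_componentCyclic_meet {G : Type*} [MetricSpace G] (V : Set G)
    (hG : IsTopGraph V) (f : G → G) (hf : Continuous f) (Y Y' : Set G)
    (hY : ComponentCyclic f Y) (hY' : ComponentCyclic f Y')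
    (hYc : IsClosed Y) (hY'c : IsClosed Y')
    (hYP : Y ⊆ (Function.periodicPts f)ᶜ) (hY'P : Y' ⊆ (Function.periodicPts f)ᶜ)
    (hmeet : (Y ∩ Y').Nonempty) :
    omegaLimitSetIn f Y = omegaLimitSetIn f Y' := by
  exact Subset.antisymm
    (omegaLimitSetIn_subset_of_forall_exists_iterate_mem hY'.mapsTo hY'c fun _ =>
      exists_iterate_mem_of_componentCyclic_meet hG hf hY hY' hYP hY'P hmeet)
    (omegaLimitSetIn_subset_of_forall_exists_iterate_mem hY.mapsTo hYc fun _ =>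
      exists_iterate_mem_of_componentCyclic_meet hG hf hY' hY hY'P hYP (inter_comm Y Y' ▸ hmeet))
end

section
/- Let f : G → G be a graph map and let m be the greatest number of pairwise disjoint circles in G. Then there exist minimal sets M₁,…,M_n of f contained in G − cl(EP(f)), with 0 ≤ n ≤ m, such that cl(R(f)) = cl(P(f)) ∪ (⋃_{i=1}^{n} M_i). -/
open Set Function Filter Topology Metric

section Dynamics

variable {G : Type*} [MetricSpace G] {f : G → G}

theorem mem_omegaSet_iff {x y : G} :
    y ∈ omegaSet f x ↔ ∀ U ∈ 𝓝 y, ∀ N : ℕ, ∃ n ≥ N, f^[n] x ∈ U := by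
  simp only [omegaSet, mem_iInter, mem_closure_iff_nhds]
  constructor
  · intro h U hU N
    obtain ⟨z, hz, n, rfl⟩ := h N U hU
    exact ⟨n + N, by omega, hz⟩
  · intro h N U hU
    obtain ⟨n, hn, hz⟩ := h U hU N
    exact ⟨_, hz, n - N, by simp only [Nat.sub_add_cancel hn]⟩

theorem isClosed_omegaSet {x : G} : IsClosed (omegaSet f x) :=
  isClosed_iInter fun _ => isClosed_closure

theorem omegaSet_iterate_apply (i : ℕ) (x : G) : omegaSet f (f^[i] x) = omegaSet f x := by
  ext y
  simp only [mem_omegaSet_iff, ← iterate_add_apply]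
  constructor
  · intro h U hU N
    obtain ⟨n, hn, hz⟩ := h U hU N
    exact ⟨n + i, by omega, hz⟩
  · intro h U hU N
    obtain ⟨n, hn, hz⟩ := h U hU (N + i)
    exact ⟨n - i, by omega, by rwa [Nat.sub_add_cancel (by omega)]⟩

omit [MetricSpace G] in
theorem iterate_mem_of_image_subset {N : Set G} (h : f '' N ⊆ N) {x : G} (hx : x ∈ N) (n : ℕ) :
    f^[n] x ∈ N := by
  induction n with
  | zero => exact hx
  | succ n ih => rw [iterate_succ_apply']; exact h ⟨_, ih, rfl⟩

theorem omegaSet_subset_of_closed {N : Set G} (hN : IsClosed N) (h : f '' N ⊆ N) {x : G}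
    (hx : x ∈ N) : omegaSet f x ⊆ N := by
  intro y hy
  rw [← hN.closure_eq, mem_closure_iff_nhds]
  intro U hU
  obtain ⟨n, -, hn⟩ := mem_omegaSet_iff.1 hy U hU 0
  exact ⟨_, hn, iterate_mem_of_image_subset h hx n⟩

theorem image_omegaSet_subset (hf : Continuous f) (x : G) :
    f '' omegaSet f x ⊆ omegaSet f x := by
  rintro _ ⟨y, hy, rfl⟩
  rw [mem_omegaSet_iff] at hy ⊢
  intro U hU N
  obtain ⟨n, hn, hz⟩ := hy _ (hf.continuousAt.preimage_mem_nhds hU) N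
  exact ⟨n + 1, by omega, by rw [iterate_succ_apply']; exact hz⟩

theorem omegaSet_subset_of_mem (hf : Continuous f) {x y : G} (h : y ∈ omegaSet f x) :
    omegaSet f y ⊆ omegaSet f x :=
  omegaSet_subset_of_closed isClosed_omegaSet (image_omegaSet_subset hf x) h

theorem omegaSet_nonempty [CompactSpace G] (x : G) : (omegaSet f x).Nonempty := by
  obtain ⟨y, -, hy⟩ := isCompact_univ.exists_mapClusterPt (f := atTop) (u := fun n : ℕ => f^[n] x)
    (by simp)
  refine ⟨y, mem_omegaSet_iff.2 fun U hU N => ?_⟩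
  exact (mapClusterPt_iff_frequently.1 hy U hU).forall_exists_of_atTop N

theorem iterate_mem_omegaSet_self (hf : Continuous f) {x : G} (h : x ∈ omegaSet f x) (n : ℕ) :
    f^[n] x ∈ omegaSet f x :=
  iterate_mem_of_image_subset (image_omegaSet_subset hf x) h n

theorem recurrent_iterate (hf : Continuous f) {x : G} (h : x ∈ omegaSet f x) (n : ℕ) :
    f^[n] x ∈ omegaSet f (f^[n] x) := by
  rw [omegaSet_iterate_apply]; exact iterate_mem_omegaSet_self hf h n

theorem closure_image_subset {N : Set G} (hf : Continuous f) (h : f '' N ⊆ N) :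
    f '' closure N ⊆ closure N :=
  (image_closure_subset_closure_image hf).trans (closure_mono h)

theorem mem_omegaSet_iterate {x y : G} {k : ℕ} (hk : 0 < k)
    (h : y ∈ omegaSet f x) : ∃ i < k, y ∈ omegaSet f^[k] (f^[i] x) := by
  by_contra hcon
  push Not at hcon
  simp only [mem_omegaSet_iff, not_forall, not_exists, not_and] at hcon
  choose! U hU N hN using hcon
  obtain ⟨n, hn, hz⟩ := mem_omegaSet_iff.1 h (⋂ i ∈ Finset.range k, U i)
    ((Filter.biInter_finset_mem _).2 fun i hi => hU i (Finset.mem_range.1 hi))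
    (k * ((Finset.range k).sup N + 1))
  have hi : n % k < k := Nat.mod_lt _ hk
  refine hN (n % k) hi (n / k) ?_ ?_
  · have : (Finset.range k).sup N + 1 ≤ n / k := (Nat.le_div_iff_mul_le hk).2 (by linarith)
    have h2 : N (n % k) ≤ (Finset.range k).sup N := Finset.le_sup (Finset.mem_range.2 hi)
    omega
  · rw [← iterate_mul, ← iterate_add_apply]
    have : k * (n / k) + n % k = n := Nat.div_add_mod n k
    rw [this]
    exact mem_iInter₂.1 hz _ (Finset.mem_range.2 hi)

theorem iterate_mem_omegaSet_iterate {k i : ℕ} (hf : Continuous f) {x y : G}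
    (h : y ∈ omegaSet f^[k] x) : f^[i] y ∈ omegaSet f^[k] (f^[i] x) := by
  rw [mem_omegaSet_iff] at h ⊢
  intro U hU N
  obtain ⟨n, hn, hz⟩ := h _ ((hf.iterate i).continuousAt.preimage_mem_nhds hU) N
  refine ⟨n, hn, ?_⟩
  rw [mem_preimage] at hz
  rwa [← iterate_mul, ← iterate_add_apply, add_comm, iterate_add_apply, iterate_mul]

theorem recurrent_of_iterate (hf : Continuous f) {x : G} {k : ℕ} (hk : 0 < k)
    (h : x ∈ omegaSet f x) : x ∈ omegaSet f^[k] x := by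
  obtain ⟨i, -, hi⟩ := mem_omegaSet_iterate hk h
  have key : ∀ j : ℕ, x ∈ omegaSet f^[k] (f^[(j + 1) * i] x) := by
    intro j
    induction j with
    | zero => simpa using hi
    | succ j ih =>
      have h1 := iterate_mem_omegaSet_iterate (i := i) hf ih
      rw [← iterate_add_apply] at h1
      have h2 := omegaSet_subset_of_mem (hf.iterate k) h1 hi
      rwa [show (j + 1 + 1) * i = i + (j + 1) * i by ring]
  have := key (k - 1)
  rwa [Nat.sub_add_cancel hk, iterate_mul, omegaSet_iterate_apply] at this

/-- A recurrent point that hits its own orbit twice is periodic. -/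
theorem periodic_of_recurrent_of_eq {x : G} (h : x ∈ omegaSet f x) {a b : ℕ} (hab : a < b)
    (he : f^[a] x = f^[b] x) : x ∈ periodicPts f := by
  have hfin : (range fun n : ℕ => f^[n] x).Finite := by
    refine (((Finset.range b).finite_toSet).image fun n => f^[n] x).subset ?_
    have : ∀ n, f^[n] x ∈ (fun n => f^[n] x) '' (Finset.range b : Set ℕ) := by
      intro n
      induction n using Nat.strong_induction_on with
      | _ n ih =>
        by_cases hn : n < b
        · exact ⟨n, by simpa using hn, rfl⟩
        · have := ih (n - b + a) (by omega)
          rwa [iterate_add_apply, he, ← iterate_add_apply, Nat.sub_add_cancel (by omega)] at this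
    rintro _ ⟨n, rfl⟩
    exact this n
  by_contra hp
  have hne : ∀ n, 0 < n → f^[n] x ≠ x := fun n hn he => hp ⟨n, hn, he⟩
  have hfin2 : (range (fun n : ℕ => f^[n] x) \ {x}).Finite := hfin.subset sdiff_subset
  obtain ⟨n, hn, hz⟩ := mem_omegaSet_iff.1 h _
    (hfin2.isClosed.isOpen_compl.mem_nhds (by simp)) 1
  exact hz ⟨⟨n, rfl⟩, hne n (by omega)⟩

omit [MetricSpace G] in
theorem exists_iterate_eq_of_finite {x : G} (h : x ∈ evPeriodicPts f) :
    ∃ a b, a < b ∧ f^[a] x = f^[b] x := by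
  by_contra hcon
  push Not at hcon
  refine (infinite_range_of_injective (f := fun n : ℕ => f^[n] x) fun a b hab => ?_) h
  rcases lt_trichotomy a b with h1 | h1 | h1
  · exact absurd hab (hcon a b h1)
  · exact h1
  · exact absurd hab.symm (hcon b a h1)

theorem periodic_of_recurrent_of_mem_omegaSet_evPeriodic {x y : G} (hy : y ∈ omegaSet f y)
    (hx : x ∈ evPeriodicPts f) (h : y ∈ omegaSet f x) : y ∈ periodicPts f := by
  have h1 : y ∈ range fun n : ℕ => f^[n] x := by
    have := (mem_iInter.1 h 0)
    have h2 : IsClosed (range fun n : ℕ => f^[n] x) := Set.Finite.isClosed hx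
    simpa [h2.closure_eq] using this
  obtain ⟨n, rfl⟩ := h1
  obtain ⟨a, b, hab, he⟩ := exists_iterate_eq_of_finite hx
  refine periodic_of_recurrent_of_eq hy hab ?_
  simp only [← iterate_add_apply]
  rw [add_comm a, add_comm b, iterate_add_apply, iterate_add_apply, he]

theorem iterate_injective_of_recurrent {x : G} (h : x ∈ omegaSet f x) (hp : x ∉ periodicPts f) :
    Injective fun n : ℕ => f^[n] x := by
  intro a b hab
  rcases lt_trichotomy a b with h1 | h1 | h1
  · exact absurd (periodic_of_recurrent_of_eq h h1 hab) hp
  · exact h1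
  · exact absurd (periodic_of_recurrent_of_eq h h1 hab.symm) hp

omit [MetricSpace G] in
theorem image_periodicPts_subset : f '' periodicPts f ⊆ periodicPts f := by
  rintro _ ⟨x, ⟨n, hn, hx⟩, rfl⟩
  exact ⟨n, hn, hx.apply⟩

omit [MetricSpace G] in
theorem periodicPts_subset_evPeriodicPts : periodicPts f ⊆ evPeriodicPts f := by
  rintro x ⟨n, hn, hx⟩
  refine (((Finset.range n).finite_toSet).image fun n => f^[n] x).subset ?_
  rintro _ ⟨k, rfl⟩
  exact ⟨k % n, by simpa using Nat.mod_lt _ hn, hx.iterate_mod_apply k⟩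

omit [MetricSpace G] in
theorem image_evPeriodicPts_subset : f '' evPeriodicPts f ⊆ evPeriodicPts f := by
  rintro _ ⟨x, hx, rfl⟩
  refine Set.Finite.subset (s := range fun n : ℕ => f^[n] x) hx ?_
  rintro _ ⟨k, rfl⟩
  exact ⟨k + 1, iterate_succ_apply f k x⟩

theorem periodicPts_subset_recurrentPts : periodicPts f ⊆ recurrentPts f := by
  rintro x ⟨n, hn, hx⟩
  refine mem_omegaSet_iff.2 fun U hU N => ⟨n * N, Nat.le_mul_of_pos_left N hn, ?_⟩
  rw [(hx.mul_const N).eq]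
  exact mem_of_mem_nhds hU

omit [MetricSpace G] in
theorem exists_periodic_of_finite {N : Set G} (hN : N.Finite) (hne : N.Nonempty)
    (h : f '' N ⊆ N) : ∃ p ∈ N, p ∈ periodicPts f := by
  obtain ⟨x, hx⟩ := hne
  have : x ∈ evPeriodicPts f := hN.subset (by
    rintro _ ⟨n, rfl⟩; exact iterate_mem_of_image_subset h hx n)
  obtain ⟨a, b, hab, he⟩ := exists_iterate_eq_of_finite this
  refine ⟨f^[a] x, iterate_mem_of_image_subset h hx a, b - a, by omega, ?_⟩
  rw [IsPeriodicPt, IsFixedPt, ← iterate_add_apply, Nat.sub_add_cancel hab.le, he]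

end Dynamics

/-- A parametrized closed arc whose interior is open in the ambient space. -/
structure FreeArc {G : Type*} [TopologicalSpace G] (j : ℝ → G) : Prop where
  continuousOn : ContinuousOn j (Icc 0 1)
  injOn : InjOn j (Icc 0 1)
  isOpen : IsOpen (j '' Ioo 0 1)

namespace FreeArc

variable {G : Type*} [MetricSpace G] {j : ℝ → G} {F : G → G}

theorem isOpen_image (hj : FreeArc j) {U : Set ℝ} (hU : IsOpen U) (hs : U ⊆ Ioo 0 1) :
    IsOpen (j '' U) := by
  have : j '' U = j '' Ioo 0 1 \ j '' (Icc 0 1 \ U) := by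
    ext x
    constructor
    · rintro ⟨t, ht, rfl⟩
      refine ⟨⟨t, hs ht, rfl⟩, ?_⟩
      rintro ⟨s, ⟨hs1, hs2⟩, he⟩
      exact hs2 (hj.injOn hs1 (Ioo_subset_Icc_self (hs ht)) he ▸ ht)
    · rintro ⟨⟨t, ht, rfl⟩, h⟩
      by_contra hc
      exact h ⟨t, ⟨Ioo_subset_Icc_self ht, fun h' => hc ⟨t, h', rfl⟩⟩, rfl⟩
  rw [this]
  have hc : IsCompact (Icc (0 : ℝ) 1 \ U) := isCompact_Icc.diff hU
  exact hj.isOpen.sdiff (hc.image_of_continuousOn (hj.continuousOn.mono sdiff_subset)).isClosed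

theorem image_mem_nhds (hj : FreeArc j) {t : ℝ} (ht : t ∈ Ioo (0 : ℝ) 1) {W : Set ℝ}
    (hW : W ∈ 𝓝 t) : j '' (W ∩ Ioo 0 1) ∈ 𝓝 (j t) := by
  obtain ⟨U, hUW, hU, htU⟩ := _root_.mem_nhds_iff.1 hW
  exact mem_of_superset ((hj.isOpen_image (hU.inter isOpen_Ioo) inter_subset_right).mem_nhds
    ⟨t, ⟨htU, ht⟩, rfl⟩) (image_mono (inter_subset_inter_left _ hUW))

theorem continuousAt (hj : FreeArc j) {t : ℝ} (ht : t ∈ Ioo (0 : ℝ) 1) : ContinuousAt j t :=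
  hj.continuousOn.continuousAt (Icc_mem_nhds ht.1 ht.2)

theorem inj (hj : FreeArc j) {s t : ℝ} (hs : s ∈ Ioo (0 : ℝ) 1) (ht : t ∈ Ioo (0 : ℝ) 1)
    (h : j s = j t) : s = t :=
  hj.injOn (Ioo_subset_Icc_self hs) (Ioo_subset_Icc_self ht) h

theorem reverse (hj : FreeArc j) : FreeArc fun t => j (1 - t) where
  continuousOn := hj.continuousOn.comp (by fun_prop) fun t ht => ⟨by linarith [ht.2], by linarith [ht.1]⟩
  injOn := fun s hs t ht h => by
    have := hj.injOn (x₁ := 1 - s) (x₂ := 1 - t) ⟨by linarith [hs.2], by linarith [hs.1]⟩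
      ⟨by linarith [ht.2], by linarith [ht.1]⟩ h
    linarith
  isOpen := by
    convert hj.isOpen using 1
    ext x
    constructor
    · rintro ⟨t, ht, rfl⟩
      exact ⟨1 - t, ⟨by linarith [ht.2], by linarith [ht.1]⟩, rfl⟩
    · rintro ⟨t, ht, rfl⟩
      exact ⟨1 - t, ⟨by linarith [ht.2], by linarith [ht.1]⟩, by simp⟩

omit [MetricSpace G] in
theorem image_affine_Ioo (j : ℝ → G) {a b : ℝ} (hab : a < b) :
    (fun t => j (a + (b - a) * t)) '' Ioo 0 1 = j '' Ioo a b := by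
  ext x
  constructor
  · rintro ⟨t, ht, rfl⟩
    exact ⟨_, ⟨by nlinarith [ht.1], by nlinarith [ht.2]⟩, rfl⟩
  · rintro ⟨t, ht, rfl⟩
    refine ⟨(t - a) / (b - a), ⟨div_pos (by linarith [ht.1]) (by linarith),
      (div_lt_one (by linarith)).2 (by linarith [ht.2])⟩, ?_⟩
    have : b - a ≠ 0 := by linarith
    dsimp only
    congr 1
    field_simp
    ring

theorem affine (hj : FreeArc j) {a b : ℝ} (ha : 0 ≤ a) (hab : a < b) (hb : b ≤ 1) :
    FreeArc fun t => j (a + (b - a) * t) where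
  continuousOn := hj.continuousOn.comp (by fun_prop) fun t ht =>
    ⟨by nlinarith [ht.1], by nlinarith [ht.2]⟩
  injOn := fun s hs t ht h => by
    have := hj.injOn (x₁ := a + (b - a) * s) (x₂ := a + (b - a) * t)
      ⟨by nlinarith [hs.1], by nlinarith [hs.2]⟩ ⟨by nlinarith [ht.1], by nlinarith [ht.2]⟩ h
    have h2 : (b - a) * s = (b - a) * t := by linarith
    exact mul_left_cancel₀ (by linarith : b - a ≠ 0) h2
  isOpen := by
    rw [image_affine_Ioo j hab]
    exact hj.isOpen_image isOpen_Ioo (Ioo_subset_Ioo ha hb)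

end FreeArc

open Classical in
/-- Lift of the displacement of `F` along the arc `j`, normalized to take values in
`(t, t + 1)`; points leaving the arc are sent to `1`. -/
noncomputable def disp {G : Type*} (j : ℝ → G) (F : G → G) (t : ℝ) : ℝ :=
  if F (j t) ∈ j '' Ioo 0 1 then
    if t < invFunOn j (Ioo 0 1) (F (j t)) then invFunOn j (Ioo 0 1) (F (j t))
    else invFunOn j (Ioo 0 1) (F (j t)) + 1
  else 1

namespace FreeArc

variable {G : Type*} [MetricSpace G] {j : ℝ → G} {F : G → G}

theorem coord_eq (hj : FreeArc j) {s : ℝ} (hs : s ∈ Ioo (0 : ℝ) 1) :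
    invFunOn j (Ioo 0 1) (j s) = s :=
  hj.inj (invFunOn_mem ⟨s, hs, rfl⟩) hs (invFunOn_eq ⟨s, hs, rfl⟩)

theorem disp_of_lt (hj : FreeArc j) {s t : ℝ} (hs : s ∈ Ioo (0 : ℝ) 1) (h : F (j t) = j s)
    (hst : t < s) : disp j F t = s := by
  rw [disp, if_pos (h ▸ ⟨s, hs, rfl⟩), h, hj.coord_eq hs, if_pos hst]

theorem disp_of_gt (hj : FreeArc j) {s t : ℝ} (hs : s ∈ Ioo (0 : ℝ) 1) (h : F (j t) = j s)
    (hst : s ≤ t) : disp j F t = s + 1 := by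
  rw [disp, if_pos (h ▸ ⟨s, hs, rfl⟩), h, hj.coord_eq hs, if_neg hst.not_gt]

omit [MetricSpace G] in
theorem disp_of_notMem {t : ℝ} (h : F (j t) ∉ j '' Ioo 0 1) : disp j F t = 1 := by
  rw [disp, if_neg h]

/-- The three possibilities for the displacement. -/
theorem disp_cases (hj : FreeArc j) {t : ℝ} (hne : F (j t) ≠ j t) :
    (disp j F t = 1 ∧ F (j t) ∉ j '' Ioo 0 1) ∨
    (t < disp j F t ∧ disp j F t < 1 ∧ F (j t) = j (disp j F t)) ∨
    (1 < disp j F t ∧ disp j F t < t + 1 ∧ F (j t) = j (disp j F t - 1)) := by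
  by_cases h : F (j t) ∈ j '' Ioo 0 1
  · obtain ⟨s, hs, he⟩ := h
    rcases lt_trichotomy s t with hst | hst | hst
    · right; right
      rw [hj.disp_of_gt hs he.symm hst.le]
      exact ⟨by linarith [hs.1], by linarith, by simp [he]⟩
    · exact absurd (he.symm.trans (by rw [hst])) hne
    · right; left
      rw [hj.disp_of_lt hs he.symm hst]
      exact ⟨hst, hs.2, he.symm⟩
  · exact Or.inl ⟨disp_of_notMem h, h⟩

theorem lt_disp (hj : FreeArc j) {t : ℝ} (ht : t ∈ Ioo (0 : ℝ) 1) (hne : F (j t) ≠ j t) :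
    t < disp j F t := by
  rcases hj.disp_cases hne with h | h | h
  · rw [h.1]; exact ht.2
  · exact h.1
  · linarith [ht.2, h.1]

theorem disp_lt (hj : FreeArc j) {t : ℝ} (ht : t ∈ Ioo (0 : ℝ) 1) (hne : F (j t) ≠ j t) :
    disp j F t < t + 1 := by
  rcases hj.disp_cases hne with h | h | h
  · rw [h.1]; linarith [ht.1]
  · linarith [ht.1, h.2.1]
  · exact h.2.1

theorem apply_eq_of_disp_lt (hj : FreeArc j) {t : ℝ}
    (hne : F (j t) ≠ j t) (h1 : disp j F t < 1) : F (j t) = j (disp j F t) := by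
  rcases hj.disp_cases hne with h | h | h
  · linarith [h.1]
  · exact h.2.2
  · linarith [h.1]

theorem apply_eq_of_lt_disp (hj : FreeArc j) {t : ℝ}
    (hne : F (j t) ≠ j t) (h1 : 1 < disp j F t) : F (j t) = j (disp j F t - 1) := by
  rcases hj.disp_cases hne with h | h | h
  · linarith [h.1]
  · linarith [h.2.1]
  · exact h.2.2

theorem notMem_of_disp_eq (hj : FreeArc j) {t : ℝ}
    (hne : F (j t) ≠ j t) (h1 : disp j F t = 1) : F (j t) ∉ j '' Ioo 0 1 := by
  rcases hj.disp_cases hne with h | h | h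
  · exact h.2
  · linarith [h.2.1]
  · linarith [h.1]

theorem continuousAt_disp (hj : FreeArc j) (hF : Continuous F) {t : ℝ}
    (ht : t ∈ Ioo (0 : ℝ) 1) (hne : F (j t) ≠ j t) : ContinuousAt (disp j F) t := by
  have hc : ContinuousAt (fun t => F (j t)) t :=
    hF.continuousAt.comp (hj.continuousAt ht)
  rw [ContinuousAt, tendsto_def]
  by_cases h : F (j t) ∈ j '' Ioo 0 1
  · obtain ⟨s, hs, he⟩ := h
    have key : ∀ W ∈ 𝓝 s, ∀ᶠ t' in 𝓝 t, ∃ s' ∈ W ∩ Ioo (0 : ℝ) 1, F (j t') = j s' := by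
      intro W hW
      filter_upwards [hc.eventually_mem (he ▸ hj.image_mem_nhds hs hW)] with t' ht'
      obtain ⟨s', hs', he'⟩ := ht'
      exact ⟨s', hs', he'.symm⟩
    rcases lt_trichotomy s t with hst | hst | hst
    · rw [hj.disp_of_gt hs he.symm hst.le]
      intro U hU
      have hU' : (fun x => x + 1) ⁻¹' U ∈ 𝓝 s :=
        (continuous_id.add continuous_const).continuousAt.preimage_mem_nhds hU
      obtain ⟨c, hc1, hc2⟩ := exists_between hst
      filter_upwards [key _ (inter_mem hU' (Iio_mem_nhds hc1)), Ioi_mem_nhds hc2] with t' h1 h2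
      obtain ⟨s', ⟨⟨h3, h4⟩, h5⟩, h6⟩ := h1
      rw [mem_preimage, hj.disp_of_gt h5 h6 (h4.trans h2).le]
      exact h3
    · exact absurd (he.symm.trans (by rw [hst])) hne
    · rw [hj.disp_of_lt hs he.symm hst]
      intro U hU
      obtain ⟨c, hc1, hc2⟩ := exists_between hst
      filter_upwards [key _ (inter_mem hU (Ioi_mem_nhds hc2)), Iio_mem_nhds hc1] with t' h1 h2
      obtain ⟨s', ⟨⟨h3, h4⟩, h5⟩, h6⟩ := h1
      rw [mem_preimage, hj.disp_of_lt h5 h6 (lt_trans h2 h4)]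
      exact h3
  · rw [disp_of_notMem h]
    intro U hU
    obtain ⟨ε, hε, hU⟩ := Metric.mem_nhds_iff.1 hU
    set δ := min ε (min (t / 2) ((1 - t) / 2)) with hδ
    have hδ0 : 0 < δ := lt_min hε (lt_min (by linarith [ht.1]) (by linarith [ht.2]))
    have hδ1 : δ ≤ ε := min_le_left _ _
    have hδ2 : δ ≤ t / 2 := (min_le_right _ _).trans (min_le_left _ _)
    have hδ3 : δ ≤ (1 - t) / 2 := (min_le_right _ _).trans (min_le_right _ _)
    have hcl : IsClosed (j '' Icc δ (1 - δ)) :=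
      (isCompact_Icc.image_of_continuousOn (hj.continuousOn.mono
        (Icc_subset_Icc hδ0.le (by linarith)))).isClosed
    have hnot : F (j t) ∉ j '' Icc δ (1 - δ) := fun h' => h
      (image_mono (Icc_subset_Ioo hδ0 (by linarith)) h')
    filter_upwards [hc.eventually_mem (hcl.isOpen_compl.mem_nhds hnot),
      Ioi_mem_nhds (show δ < t by linarith [ht.1]),
      Iio_mem_nhds (show t < 1 - δ by linarith [ht.2])] with t' h1 h2 h3
    simp only [mem_Ioi, mem_Iio] at h2 h3
    apply hU
    rw [Metric.mem_ball, Real.dist_eq, abs_lt]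
    by_cases h4 : F (j t') ∈ j '' Ioo 0 1
    · obtain ⟨s, hs, he⟩ := h4
      by_cases h5 : s < δ
      · rw [hj.disp_of_gt hs he.symm (by linarith)]
        constructor <;> linarith [hs.1]
      · have h6 : 1 - δ < s := by
          by_contra h6
          exact h1 ⟨s, ⟨not_lt.1 h5, not_lt.1 h6⟩, he⟩
        rw [hj.disp_of_lt hs he.symm (by linarith)]
        constructor <;> linarith [hs.2]
    · rw [disp_of_notMem h4]
      constructor <;> linarith

end FreeArc

/-- The open arc `j (0,1)` contains no periodic point of `f`. -/
def PFree {G : Type*} (j : ℝ → G) (f : G → G) : Prop :=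
  ∀ t ∈ Ioo (0 : ℝ) 1, ∀ m : ℕ, 1 ≤ m → f^[m] (j t) ≠ j t

/-- The lifted image of `[p, q]` under the displacement of `f^[m]` covers a translate of `[a, b]`. -/
def Cross {G : Type*} (j : ℝ → G) (f : G → G) (m : ℕ) (p q a b : ℝ) : Prop :=
  ∃ t₁ ∈ Icc p q, ∃ t₂ ∈ Icc p q, ∃ r : ℝ, (r = 0 ∨ r = 1) ∧
    disp j f^[m] t₁ ≤ a + r ∧ b + r ≤ disp j f^[m] t₂

/-- A point `x` of the arc, an iterate `x'` of it, such that the orbit of `x` under that iterate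
visits the interval between `x` and `x'` infinitely often. -/
structure GoodPair {G : Type*} (j : ℝ → G) (f : G → G) (x : ℝ) (k : ℕ) (x' : ℝ) : Prop where
  left_mem : x ∈ Ioo (0 : ℝ) 1
  right_mem : x' ∈ Ioo (0 : ℝ) 1
  ne : x ≠ x'
  pos : 1 ≤ k
  apply_eq : f^[k] (j x) = j x'
  visits : ∀ N : ℕ, ∃ i ≥ N, ∃ y ∈ Ioo (min x x') (max x x'), f^[i * k] (j x) = j y

theorem exists_subinterval_aux {g : ℝ → ℝ} {s₁ s₂ p q : ℝ} (hs : s₁ ≤ s₂)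
    (hg : ContinuousOn g (Icc s₁ s₂)) (h1 : g s₁ ≤ p) (h2 : q ≤ g s₂) (hpq : p ≤ q) :
    ∃ c d, c ∈ Icc s₁ s₂ ∧ d ∈ Icc s₁ s₂ ∧ c ≤ d ∧ g c = p ∧ g d = q ∧
      ∀ x ∈ Icc c d, g x ∈ Icc p q := by
  have hA : IsCompact (Icc s₁ s₂ ∩ g ⁻¹' Ici q) :=
    isCompact_Icc.of_isClosed_subset (hg.preimage_isClosed_of_isClosed isClosed_Icc isClosed_Ici)
      inter_subset_left
  obtain ⟨d, ⟨hd1, hd2⟩, hd3⟩ := hA.exists_isLeast ⟨s₂, ⟨hs, le_rfl⟩, h2⟩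
  have hgd : ContinuousOn g (Icc s₁ d) := hg.mono (Icc_subset_Icc_right hd1.2)
  have hle : ∀ x ∈ Icc s₁ d, g x ≤ q := by
    intro x hx
    by_contra hc
    push Not at hc
    obtain ⟨z, hz, hz2⟩ := intermediate_value_Icc hx.1 (hgd.mono (Icc_subset_Icc_right hx.2))
      ⟨h1.trans hpq, hc.le⟩
    have h3 : d ≤ z := hd3 ⟨⟨hz.1, hz.2.trans (hx.2.trans hd1.2)⟩, hz2.ge⟩
    have : z = x := le_antisymm hz.2 (hx.2.trans h3)
    rw [this] at hz2
    exact hc.ne' hz2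
  have hB : IsCompact (Icc s₁ d ∩ g ⁻¹' Iic p) :=
    isCompact_Icc.of_isClosed_subset (hgd.preimage_isClosed_of_isClosed isClosed_Icc isClosed_Iic)
      inter_subset_left
  obtain ⟨c, ⟨hc1, hc2⟩, hc3⟩ := hB.exists_isGreatest ⟨s₁, ⟨le_rfl, hd1.1⟩, h1⟩
  have hge : ∀ x ∈ Icc c d, p ≤ g x := by
    intro x hx
    by_contra hc
    push Not at hc
    obtain ⟨z, hz, hz2⟩ := intermediate_value_Icc hx.2
      (hgd.mono (Icc_subset_Icc_left (hc1.1.trans hx.1)))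
      ⟨hc.le, hpq.trans hd2⟩
    have h3 : z ≤ c := hc3 ⟨⟨hc1.1.trans (hx.1.trans hz.1), hz.2⟩, hz2.le⟩
    have : z = x := le_antisymm (h3.trans hx.1) hz.1
    rw [this] at hz2
    exact hc.ne hz2
  have hdq : g d = q := le_antisymm (hle d ⟨hd1.1, le_rfl⟩) hd2
  exact ⟨c, d, ⟨hc1.1, hc1.2.trans hd1.2⟩, hd1, hc1.2,
    le_antisymm hc2 (hge c ⟨le_rfl, hc1.2⟩), hdq,
    fun x hx => ⟨hge x hx, hle x ⟨hc1.1.trans hx.1, hx.2⟩⟩⟩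

theorem exists_subinterval {g : ℝ → ℝ} {s₁ s₂ p q : ℝ}
    (hg : ContinuousOn g (uIcc s₁ s₂)) (h1 : g s₁ ≤ p) (h2 : q ≤ g s₂) (hpq : p ≤ q) :
    ∃ c d, uIcc c d ⊆ uIcc s₁ s₂ ∧ g c = p ∧ g d = q ∧ ∀ x ∈ uIcc c d, g x ∈ Icc p q := by
  rcases le_total s₁ s₂ with h | h
  · rw [uIcc_of_le h] at hg ⊢
    obtain ⟨c, d, hc, hd, hcd, h3, h4, h5⟩ := exists_subinterval_aux h hg h1 h2 hpq
    refine ⟨c, d, ?_, h3, h4, ?_⟩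
    · rw [uIcc_of_le hcd]; exact Icc_subset_Icc hc.1 hd.2
    · rwa [uIcc_of_le hcd]
  · rw [uIcc_of_ge h] at hg ⊢
    have hg' : ContinuousOn (fun x => g (-x)) (Icc (-s₁) (-s₂)) :=
      hg.comp (by fun_prop) fun x hx => ⟨by linarith [hx.2], by linarith [hx.1]⟩
    obtain ⟨c, d, hc, hd, hcd, h3, h4, h5⟩ := exists_subinterval_aux (neg_le_neg h) hg'
      (by simpa using h1) (by simpa using h2) hpq
    refine ⟨-c, -d, ?_, h3, h4, ?_⟩
    · rw [uIcc_of_ge (neg_le_neg hcd)]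
      exact Icc_subset_Icc (by linarith [hd.2]) (by linarith [hc.1])
    · rw [uIcc_of_ge (neg_le_neg hcd)]
      intro x hx
      have := h5 (-x) ⟨by linarith [hx.2], by linarith [hx.1]⟩
      simpa using this

namespace FreeArc

variable {G : Type*} [MetricSpace G] {j : ℝ → G} {f F : G → G}

theorem apply_eq_of_disp_eq (hj : FreeArc j) {t s r : ℝ} (hne : F (j t) ≠ j t)
    (hs : s ∈ Ioo (0 : ℝ) 1) (hr : r = 0 ∨ r = 1) (h : disp j F t = s + r) : F (j t) = j s := by
  rcases hr with rfl | rfl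
  · rw [add_zero] at h
    rw [← h]; exact hj.apply_eq_of_disp_lt hne (h ▸ hs.2)
  · rw [hj.apply_eq_of_lt_disp hne (by linarith [hs.1]), h]; simp

theorem exists_disp_eq (hj : FreeArc j) {t s : ℝ} (h : F (j t) = j s)
    (hs : s ∈ Ioo (0 : ℝ) 1) : ∃ r : ℝ, (r = 0 ∨ r = 1) ∧ disp j F t = s + r := by
  rcases lt_or_ge t s with h1 | h1
  · exact ⟨0, Or.inl rfl, by rw [hj.disp_of_lt hs h h1, add_zero]⟩
  · exact ⟨1, Or.inr rfl, hj.disp_of_gt hs h h1⟩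

theorem continuousOn_disp (hj : FreeArc j) (hf : Continuous f) (hP : PFree j f) {m : ℕ}
    (hm : 1 ≤ m) : ContinuousOn (disp j f^[m]) (Ioo 0 1) := fun t ht =>
  (hj.continuousAt_disp (hf.iterate m) ht (hP t ht m hm)).continuousWithinAt

/-- Two arcs cannot cross each other cyclically without producing a periodic point. -/
theorem not_cross_cycle (hj : FreeArc j) (hf : Continuous f) (hP : PFree j f) {m n : ℕ}
    (hm : 1 ≤ m) (hn : 1 ≤ n) {p q a b : ℝ} (hpq : Icc p q ⊆ Ioo 0 1) (hab : Icc a b ⊆ Ioo 0 1)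
    (h1 : Cross j f m p q a b) (h2 : Cross j f n a b p q) : False := by
  obtain ⟨t₁, ht₁, t₂, ht₂, r, hr, h3, h4⟩ := h1
  obtain ⟨s₁, hs₁, s₂, hs₂, r', hr', h5, h6⟩ := h2
  have hsub : uIcc s₁ s₂ ⊆ Icc a b := uIcc_subset_Icc hs₁ hs₂
  have htsub : uIcc t₁ t₂ ⊆ Icc p q := uIcc_subset_Icc ht₁ ht₂
  set g : ℝ → ℝ := fun τ => disp j f^[n] τ - r' with hg
  have hgc : ContinuousOn g (uIcc s₁ s₂) :=
    ((hj.continuousOn_disp hf hP hn).mono (hsub.trans hab)).sub continuousOn_const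
  obtain ⟨c, d, hcd, hgc1, hgd, hK⟩ := exists_subinterval hgc
    (p := min t₁ t₂) (q := max t₁ t₂) (by
      have : p ≤ min t₁ t₂ := le_min ht₁.1 ht₂.1
      simp only [hg]; linarith)
    (by
      have : max t₁ t₂ ≤ q := max_le ht₁.2 ht₂.2
      simp only [hg]; linarith) min_le_max
  have hK' : MapsTo g (uIcc c d) (Ioo 0 1) := fun x hx => hpq (htsub (hK x hx))
  set φ : ℝ → ℝ := fun τ => disp j f^[m] (g τ) - r - τ with hφ
  have hφc : ContinuousOn φ (uIcc c d) :=
    (((hj.continuousOn_disp hf hP hm).comp (hgc.mono hcd) hK').sub continuousOn_const).sub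
      continuousOn_id
  have hmem : ∀ x ∈ uIcc c d, x ∈ Icc a b := fun x hx => hsub (hcd hx)
  have key : ∃ x ∈ uIcc c d, ∃ y ∈ uIcc c d, φ x ≤ 0 ∧ 0 ≤ φ y := by
    have e1 : ∀ x ∈ uIcc c d, g x = t₁ → φ x ≤ 0 := fun x hx he => by
      simp only [hφ, he]; linarith [(hmem x hx).1]
    have e2 : ∀ x ∈ uIcc c d, g x = t₂ → 0 ≤ φ x := fun x hx he => by
      simp only [hφ, he]; linarith [(hmem x hx).2]
    rcases le_total t₁ t₂ with h | h
    · rw [min_eq_left h] at hgc1; rw [max_eq_right h] at hgd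
      exact ⟨c, left_mem_uIcc, d, right_mem_uIcc, e1 _ left_mem_uIcc hgc1,
        e2 _ right_mem_uIcc hgd⟩
    · rw [min_eq_right h] at hgc1; rw [max_eq_left h] at hgd
      exact ⟨d, right_mem_uIcc, c, left_mem_uIcc, e1 _ right_mem_uIcc hgd,
        e2 _ left_mem_uIcc hgc1⟩
  obtain ⟨x, hx, y, hy, h7, h8⟩ := key
  obtain ⟨τ, hτ, hτ0⟩ := isPreconnected_uIcc.intermediate_value hx hy hφc ⟨h7, h8⟩
  have hτm := hab (hmem τ hτ)
  have hgτ := hK' hτ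
  have e1 : f^[n] (j τ) = j (g τ) :=
    hj.apply_eq_of_disp_eq (hP τ hτm n hn) hgτ hr' (by simp [hg])
  have e2 : f^[m] (j (g τ)) = j τ :=
    hj.apply_eq_of_disp_eq (hP _ hgτ m hm) hτm hr (by simp only [hφ] at hτ0; linarith)
  exact hP τ hτm (m + n) (by omega) (by rw [iterate_add_apply, e1, e2])

/-- If the image of `[a, b]` crosses neither of two flanking intervals, it stays between them. -/
theorem exists_apply_eq_of_not_cross (hj : FreeArc j) (hP : PFree j f) {n : ℕ} (hn : 1 ≤ n)
    {a b p₁ q₁ p₃ q₃ l t s : ℝ} (hab : Icc a b ⊆ Ioo 0 1) (ht : t ∈ Icc a b) (hs : s ∈ Icc a b)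
    (h0 : 0 < p₁) (h1 : p₁ ≤ q₁) (h2 : q₁ ≤ l) (h3 : l ≤ p₃) (h4 : p₃ ≤ q₃) (h5 : q₃ < 1)
    (he : f^[n] (j t) = j l) (hc1 : ¬ Cross j f n a b p₁ q₁) (hc3 : ¬ Cross j f n a b p₃ q₃) :
    ∃ σ ∈ Ioo p₁ q₃, f^[n] (j s) = j σ := by
  obtain ⟨r, hr, hd⟩ := hj.exists_disp_eq he ⟨by linarith, by linarith⟩
  have e1 : disp j f^[n] s < q₃ + r := by
    by_contra hc
    exact hc3 ⟨t, ht, s, hs, r, hr, by linarith, not_lt.1 hc⟩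
  have e2 : p₁ + r < disp j f^[n] s := by
    by_contra hc
    exact hc1 ⟨s, hs, t, ht, r, hr, not_lt.1 hc, by linarith⟩
  refine ⟨disp j f^[n] s - r, ⟨by linarith, by linarith⟩, ?_⟩
  exact hj.apply_eq_of_disp_eq (hP s (hab hs) n hn) ⟨by linarith, by linarith⟩ hr (by ring)

end FreeArc

theorem exists_straddle_of_decrements {α β : ℕ → ℝ} {v : ℝ} (hv : v ≤ 1) (hα : ∀ i ≥ 1, 0 < α i)
    (hstep : ∀ i ≥ 1, α (i + 1) = β i ∨ α (i + 1) = β i - 1)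
    (hdec : ∀ N : ℕ, ∃ i ≥ N, α (i + 1) = β i - 1) (h1 : α 1 ≤ v + 1) :
    ∃ i ≥ 1, ∃ r : ℝ, (r = 0 ∨ r = 1) ∧ α i ≤ v + r ∧ v + r < β i := by
  by_contra hcon
  push Not at hcon
  have hle1 : ∀ i ≥ 1, α i ≤ v + 1 := by
    intro i hi
    induction i, hi using Nat.le_induction with
    | base => exact h1
    | succ i hi ih =>
      have := hcon i hi 1 (Or.inr rfl) ih
      rcases hstep i hi with h | h <;> linarith
  obtain ⟨i, hi, hd⟩ := hdec 1
  have hle0 : ∀ n ≥ i + 1, α n ≤ v := by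
    intro n hn
    induction n, hn using Nat.le_induction with
    | base => linarith [hcon i hi 1 (Or.inr rfl) (hle1 i hi)]
    | succ n hn ih =>
      have := hcon n (by omega) 0 (Or.inl rfl) (by linarith)
      rcases hstep n (by omega) with h | h <;> linarith
  obtain ⟨n, hn, hd'⟩ := hdec (i + 1)
  have := hcon n (by omega) 0 (Or.inl rfl) (by linarith [hle0 n hn])
  linarith [hα (n + 1) (by omega)]

namespace GoodPair

variable {G : Type*} [MetricSpace G] {j : ℝ → G} {f : G → G} {x x' : ℝ} {k : ℕ}

omit [MetricSpace G] in
theorem iterate_right (h : GoodPair j f x k x') (n : ℕ) :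
    f^[n] (j x') = f^[n + k] (j x) := by
  rw [iterate_add_apply, h.apply_eq]

/-- Off the visits, the displacement at `x'` and the next one at `x` agree; at a visit they differ
by one full turn. -/
theorem disp_step (h : GoodPair j f x k x') (hj : FreeArc j) (hP : PFree j f) {i : ℕ}
    (hi : 1 ≤ i) :
    (disp j f^[(i + 1) * k] x = disp j f^[i * k] x' ∧
      ¬ ∃ y ∈ Ioo (min x x') (max x x'), f^[(i + 1) * k] (j x) = j y) ∨
    ((∃ y ∈ Ioo (min x x') (max x x'), f^[(i + 1) * k] (j x) = j y) ∧
      (x < x' → disp j f^[(i + 1) * k] x = disp j f^[i * k] x' - 1) ∧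
      (x' < x → disp j f^[(i + 1) * k] x = disp j f^[i * k] x' + 1)) := by
  have e : f^[i * k] (j x') = f^[(i + 1) * k] (j x) := by rw [h.iterate_right]; congr 2; ring
  have hik : 1 ≤ i * k := Nat.mul_pos hi h.pos
  have hik' : 1 ≤ (i + 1) * k := Nat.mul_pos (by omega) h.pos
  by_cases hm : f^[(i + 1) * k] (j x) ∈ j '' Ioo 0 1
  · obtain ⟨y, hy, hy2⟩ := hm
    have n1 : y ≠ x := fun he => hP x h.left_mem _ hik' (by rw [← hy2, he])
    have n2 : y ≠ x' := fun he => hP x' h.right_mem _ hik (by rw [e, ← hy2, he])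
    have hpos : ∀ z ∈ Ioo (min x x') (max x x'), f^[(i + 1) * k] (j x) = j z → z = y := by
      intro z hz hz2
      refine hj.inj ⟨lt_trans (lt_min h.left_mem.1 h.right_mem.1) hz.1,
        lt_trans hz.2 (max_lt h.left_mem.2 h.right_mem.2)⟩ hy (hz2.symm.trans hy2.symm)
    rcases lt_or_gt_of_ne h.ne with hlt | hlt
    · simp only [min_eq_left hlt.le, max_eq_right hlt.le] at hpos ⊢
      rcases lt_or_gt_of_ne n1 with c1 | c1
      · left
        refine ⟨?_, fun ⟨z, hz, hz2⟩ => ?_⟩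
        · rw [hj.disp_of_gt hy hy2.symm c1.le, hj.disp_of_gt hy (e.trans hy2.symm) (by linarith)]
        · rw [hpos z hz hz2] at hz; linarith [hz.1]
      · rcases lt_or_gt_of_ne n2 with c2 | c2
        · right
          refine ⟨⟨y, ⟨c1, c2⟩, hy2.symm⟩, fun _ => ?_, fun h' => by linarith⟩
          rw [hj.disp_of_lt hy hy2.symm c1, hj.disp_of_gt hy (e.trans hy2.symm) c2.le]; ring
        · left
          refine ⟨?_, fun ⟨z, hz, hz2⟩ => ?_⟩
          · rw [hj.disp_of_lt hy hy2.symm c1, hj.disp_of_lt hy (e.trans hy2.symm) c2]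
          · rw [hpos z hz hz2] at hz; linarith [hz.2]
    · simp only [min_eq_right hlt.le, max_eq_left hlt.le] at hpos ⊢
      rcases lt_or_gt_of_ne n2 with c1 | c1
      · left
        refine ⟨?_, fun ⟨z, hz, hz2⟩ => ?_⟩
        · rw [hj.disp_of_gt hy hy2.symm (by linarith), hj.disp_of_gt hy (e.trans hy2.symm) c1.le]
        · rw [hpos z hz hz2] at hz; linarith [hz.1]
      · rcases lt_or_gt_of_ne n1 with c2 | c2
        · right
          refine ⟨⟨y, ⟨c1, c2⟩, hy2.symm⟩, fun h' => by linarith, fun _ => ?_⟩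
          rw [hj.disp_of_gt hy hy2.symm c2.le, hj.disp_of_lt hy (e.trans hy2.symm) c1]
        · left
          refine ⟨?_, fun ⟨z, hz, hz2⟩ => ?_⟩
          · rw [hj.disp_of_lt hy hy2.symm c2, hj.disp_of_lt hy (e.trans hy2.symm) (by linarith)]
          · rw [hpos z hz hz2] at hz; linarith [hz.2]
  · left
    refine ⟨by rw [FreeArc.disp_of_notMem hm, FreeArc.disp_of_notMem (e ▸ hm)], ?_⟩
    rintro ⟨z, hz, hz2⟩
    exact hm ⟨z, ⟨lt_trans (lt_min h.left_mem.1 h.right_mem.1) hz.1,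
        lt_trans hz.2 (max_lt h.left_mem.2 h.right_mem.2)⟩, hz2.symm⟩

theorem exists_straddle (h : GoodPair j f x k x') (hj : FreeArc j) (hP : PFree j f) {v : ℝ}
    (hv : v ∈ Icc (0 : ℝ) 1) : ∃ m ≥ 1, ∃ r : ℝ, (r = 0 ∨ r = 1) ∧
      ((x < x' ∧ disp j f^[m] x ≤ v + r ∧ v + r < disp j f^[m] x') ∨
       (x' < x ∧ disp j f^[m] x' < v + r ∧ v + r ≤ disp j f^[m] x)) := by
  have hik : ∀ i ≥ 1, 1 ≤ i * k := fun i hi => Nat.mul_pos hi h.pos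
  have hdec : ∀ N : ℕ, ∃ i ≥ N, 1 ≤ i ∧
      ∃ y ∈ Ioo (min x x') (max x x'), f^[(i + 1) * k] (j x) = j y := by
    intro N
    obtain ⟨i, hi, hy⟩ := h.visits (N + 2)
    exact ⟨i - 1, by omega, by omega, by rwa [Nat.sub_add_cancel (by omega)]⟩
  have e1 : f^[k] (j x) = j x' := h.apply_eq
  rcases lt_or_gt_of_ne h.ne with hlt | hlt
  · obtain ⟨i, hi, r, hr, h1, h2⟩ := exists_straddle_of_decrements
      (α := fun i => disp j f^[i * k] x) (β := fun i => disp j f^[i * k] x') (v := v) hv.2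
      (fun i hi => h.left_mem.1.trans (hj.lt_disp h.left_mem (hP x h.left_mem _ (hik i hi))))
      (fun i hi => by
        rcases h.disp_step hj hP hi with h | h
        · exact Or.inl h.1
        · exact Or.inr (h.2.1 hlt))
      (fun N => by
        obtain ⟨i, hi, hi1, hy⟩ := hdec N
        rcases h.disp_step hj hP hi1 with h | h
        · exact absurd hy h.2
        · exact ⟨i, hi, h.2.1 hlt⟩)
      (by
        simp only [one_mul]
        rw [hj.disp_of_lt h.right_mem e1 hlt]; linarith [h.right_mem.2, hv.1])
    exact ⟨i * k, hik i hi, r, hr, Or.inl ⟨hlt, h1, h2⟩⟩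
  · obtain ⟨i, hi, r, hr, h1, h2⟩ := exists_straddle_of_decrements
      (α := fun i => 2 - disp j f^[i * k] x) (β := fun i => 2 - disp j f^[i * k] x') (v := 1 - v)
      (by linarith [hv.1])
      (fun i hi => by linarith [h.left_mem.2, hj.disp_lt h.left_mem (hP x h.left_mem _ (hik i hi))])
      (fun i hi => by
        rcases h.disp_step hj hP hi with h | h
        · left; rw [h.1]
        · right; rw [h.2.2 hlt]; ring)
      (fun N => by
        obtain ⟨i, hi, hi1, hy⟩ := hdec N
        rcases h.disp_step hj hP hi1 with h | h
        · exact absurd hy h.2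
        · exact ⟨i, hi, by rw [h.2.2 hlt]; ring⟩)
      (by
        simp only [one_mul]
        rw [hj.disp_of_gt h.right_mem e1 hlt.le]; linarith [h.right_mem.1, hv.2])
    refine ⟨i * k, hik i hi, 1 - r, by rcases hr with rfl | rfl <;> simp,
      Or.inr ⟨hlt, by linarith, by linarith⟩⟩

theorem cross_gap (h : GoodPair j f x k x') (hj : FreeArc j) (hP : PFree j f) {u s : ℝ}
    (hu : u ∈ Ioo (0 : ℝ) 1) (hs : s ∈ Ioo (0 : ℝ) 1)
    (hgap : ∀ n : ℕ, ∀ σ ∈ Ioo u s, f^[n] (j x) ≠ j σ) :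
    ∃ m ≥ 1, Cross j f m (min x x') (max x x') u s := by
  have hx : x ∈ Icc (min x x') (max x x') := ⟨min_le_left _ _, le_max_left _ _⟩
  have hx' : x' ∈ Icc (min x x') (max x x') := ⟨min_le_right _ _, le_max_right _ _⟩
  have key : ∀ m ≥ 1, ∀ r : ℝ, (r = 0 ∨ r = 1) → disp j f^[m] x' ∉ Ioo (u + r) (s + r) := by
    intro m hm r hr hd
    refine hgap (m + k) (disp j f^[m] x' - r) ⟨by linarith [hd.1], by linarith [hd.2]⟩ ?_
    rw [← h.iterate_right]
    exact hj.apply_eq_of_disp_eq (hP x' h.right_mem m hm)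
      ⟨by linarith [hu.1, hd.1], by linarith [hs.2, hd.2]⟩ hr (by ring)
  by_cases hlt : x < x'
  · obtain ⟨m, hm, r, hr, h1 | h1⟩ := h.exists_straddle hj hP (Ioo_subset_Icc_self hu)
    · exact ⟨m, hm, x, hx, x', hx', r, hr, h1.2.1, by
        by_contra hc; exact key m hm r hr ⟨h1.2.2, not_le.1 hc⟩⟩
    · linarith [h1.1]
  · obtain ⟨m, hm, r, hr, h1 | h1⟩ := h.exists_straddle hj hP (Ioo_subset_Icc_self hs)
    · exact absurd h1.1 hlt
    · exact ⟨m, hm, x', hx', x, hx, r, hr, by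
        by_contra hc; exact key m hm r hr ⟨not_le.1 hc, h1.2.1⟩, h1.2.2⟩

theorem cross_around (h : GoodPair j f x k x') (hj : FreeArc j) (hP : PFree j f) {s : ℝ}
    (hs : s ∈ Ioo (0 : ℝ) 1) (hgap : ∀ n : ℕ, f^[n] (j x) ≠ j s) :
    ∃ m ≥ 1, ∃ a b, 0 < a ∧ a < s ∧ s < b ∧ b < 1 ∧
      Cross j f m (min x x') (max x x') a b := by
  have hx : x ∈ Icc (min x x') (max x x') := ⟨min_le_left _ _, le_max_left _ _⟩
  have hx' : x' ∈ Icc (min x x') (max x x') := ⟨min_le_right _ _, le_max_right _ _⟩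
  have key : ∀ m ≥ 1, ∀ r : ℝ, (r = 0 ∨ r = 1) → ∀ z ∈ Icc (min x x') (max x x'),
      ∀ w ∈ Icc (min x x') (max x x'), disp j f^[m] z < s + r → s + r < disp j f^[m] w →
      ∃ m ≥ 1, ∃ a b, 0 < a ∧ a < s ∧ s < b ∧ b < 1 ∧
      Cross j f m (min x x') (max x x') a b := by
    intro m hm r hr z hz w hw h1 h2
    obtain ⟨a, ha1, ha2⟩ := exists_between (max_lt hs.1 (show disp j f^[m] z - r < s by linarith))
    obtain ⟨b, hb1, hb2⟩ := exists_between (lt_min hs.2 (show s < disp j f^[m] w - r by linarith))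
    have := le_max_right 0 (disp j f^[m] z - r)
    have := min_le_right 1 (disp j f^[m] w - r)
    exact ⟨m, hm, a, b, lt_of_le_of_lt (le_max_left _ _) ha1, ha2, hb1,
      lt_of_lt_of_le hb2 (min_le_left _ _), z, hz, w, hw, r, hr, by linarith, by linarith⟩
  obtain ⟨m, hm, r, hr, h1 | h1⟩ := h.exists_straddle hj hP (Ioo_subset_Icc_self hs)
  · refine key m hm r hr x hx x' hx' (lt_of_le_of_ne h1.2.1 fun he => ?_) h1.2.2
    exact hgap m (hj.apply_eq_of_disp_eq (hP x h.left_mem m hm) hs hr he)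
  · refine key m hm r hr x' hx' x hx h1.2.1 (lt_of_le_of_ne h1.2.2 fun he => ?_)
    exact hgap m (hj.apply_eq_of_disp_eq (hP x h.left_mem m hm) hs hr he.symm)

omit [MetricSpace G] in
theorem Icc_subset (h : GoodPair j f x k x') : Icc (min x x') (max x x') ⊆ Ioo 0 1 :=
  fun _ hz => ⟨lt_of_lt_of_le (lt_min h.left_mem.1 h.right_mem.1) hz.1,
    lt_of_le_of_lt hz.2 (max_lt h.left_mem.2 h.right_mem.2)⟩

end GoodPair

theorem Cross.mono {G : Type*} {j : ℝ → G} {f : G → G} {m : ℕ} {p q a b a' b' : ℝ}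
    (h : Cross j f m p q a b) (ha : a ≤ a') (hb : b' ≤ b) : Cross j f m p q a' b' := by
  obtain ⟨t₁, h1, t₂, h2, r, hr, h3, h4⟩ := h
  exact ⟨t₁, h1, t₂, h2, r, hr, by linarith, by linarith⟩

namespace FreeArc

variable {G : Type*} [MetricSpace G] {j : ℝ → G} {f : G → G}

/-- A recurrent point of a free arc returns to any neighbourhood, in coordinates. -/
theorem exists_return (hj : FreeArc j) {x : ℝ} (hx : x ∈ Ioo (0 : ℝ) 1) {w : G}
    (hr : j x ∈ omegaSet f w) {W : Set ℝ} (hW : W ∈ 𝓝 x) (N : ℕ) :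
    ∃ n ≥ N, ∃ y ∈ W ∩ Ioo 0 1, f^[n] w = j y := by
  obtain ⟨n, hn, y, hy, he⟩ := mem_omegaSet_iff.1 hr _ (hj.image_mem_nhds hx hW) N
  exact ⟨n, hn, y, hy, he.symm⟩

theorem exists_goodPair (hj : FreeArc j) (hf : Continuous f) (hP : PFree j f) {x : ℝ}
    (hx : x ∈ Ioo (0 : ℝ) 1) (hr : j x ∈ omegaSet f (j x)) {L : Set ℝ} (hL : L ∈ 𝓝 x) :
    ∃ k x', GoodPair j f x k x' ∧ x' ∈ L := by
  obtain ⟨k₀, hk₀, x₁, ⟨hx₁L, hx₁⟩, he₁⟩ := hj.exists_return hx hr hL 1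
  have hne₁ : x ≠ x₁ := fun h => hP x hx k₀ hk₀ (by rw [he₁, ← h])
  by_cases hv : ∀ N : ℕ, ∃ i ≥ N, ∃ y ∈ Ioo (min x x₁) (max x x₁), f^[i * k₀] (j x) = j y
  · exact ⟨k₀, x₁, ⟨hx, hx₁, hne₁, hk₀, he₁, hv⟩, hx₁L⟩
  push Not at hv
  obtain ⟨N, hN⟩ := hv
  have hrk : j x ∈ omegaSet f^[k₀] (j x) := recurrent_of_iterate hf hk₀ hr
  have hWn : ∀ y, x ≠ y → ball x (dist y x) ∈ 𝓝 x := fun y hy =>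
    ball_mem_nhds _ (dist_pos.2 hy.symm)
  obtain ⟨r, hrN, y, ⟨⟨hyL, hyb⟩, hy⟩, hey⟩ :=
    hj.exists_return hx hrk (inter_mem hL (hWn x₁ hne₁)) (N + 1)
  rw [← iterate_mul, mul_comm] at hey
  have hr1 : 1 ≤ r * k₀ := Nat.mul_pos (by omega) hk₀
  have hney : x ≠ y := fun h => hP x hx _ hr1 (by rw [hey, ← h])
  have hyout := fun h => hN r (by omega) y h hey
  refine ⟨r * k₀, y, ⟨hx, hy, hney, hr1, hey, fun M => ?_⟩, hyL⟩
  have hrk' : j x ∈ omegaSet f^[r * k₀] (j x) := recurrent_of_iterate hf hr1 hr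
  obtain ⟨i, hi, z, ⟨hzb, hz⟩, hez⟩ := hj.exists_return hx hrk' (hWn y hney) (max M (N + 1))
  rw [← iterate_mul, mul_comm] at hez
  have hi1 : 1 ≤ i := by have := le_max_right M (N + 1); omega
  have hnez : x ≠ z := fun h => hP x hx _ (Nat.mul_pos hi1 hr1) (by rw [hez, ← h])
  have hzout := fun h => hN (i * r)
    (by have := le_max_right M (N + 1); nlinarith [Nat.mul_le_mul_left i (show 1 ≤ r by omega)])
    z h (by rw [mul_assoc]; exact hez)
  refine ⟨i, (le_max_left _ _).trans hi, z, ?_, hez⟩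
  rw [mem_ball, Real.dist_eq, Real.dist_eq] at hzb hyb
  rcases lt_or_gt_of_ne hne₁ with c1 | c1
  · rw [min_eq_left c1.le, max_eq_right c1.le] at hyout hzout
    rw [abs_of_pos (sub_pos.2 c1), abs_lt] at hyb
    have hyx : y < x := by
      rcases lt_or_gt_of_ne hney with c2 | c2
      · exact absurd ⟨c2, by linarith⟩ hyout
      · exact c2
    rw [abs_of_neg (sub_neg.2 hyx), abs_lt] at hzb
    have hzx : z < x := by
      rcases lt_or_gt_of_ne hnez with c2 | c2
      · exact absurd ⟨c2, by linarith⟩ hzout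
      · exact c2
    rw [min_eq_right hyx.le, max_eq_left hyx.le]
    exact ⟨by linarith, hzx⟩
  · rw [min_eq_right c1.le, max_eq_left c1.le] at hyout hzout
    rw [abs_of_neg (sub_neg.2 c1), abs_lt] at hyb
    have hyx : x < y := by
      rcases lt_or_gt_of_ne hney with c2 | c2
      · exact c2
      · exact absurd ⟨by linarith, c2⟩ hyout
    rw [abs_of_pos (sub_pos.2 hyx), abs_lt] at hzb
    have hzx : x < z := by
      rcases lt_or_gt_of_ne hnez with c2 | c2
      · exact c2
      · exact absurd ⟨by linarith, c2⟩ hzout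
    rw [min_eq_left hyx.le, max_eq_right hyx.le]
    exact ⟨hzx, by linarith⟩

end FreeArc

theorem exists_sorted_of_three {S : Set ℝ} {a b c : ℝ} (ha : a ∈ S) (hb : b ∈ S) (hc : c ∈ S)
    (hab : a ≠ b) (hac : a ≠ c) (hbc : b ≠ c) : ∃ x ∈ S, ∃ y ∈ S, ∃ z ∈ S, x < y ∧ y < z := by
  rcases lt_or_gt_of_ne hab with h1 | h1 <;> rcases lt_or_gt_of_ne hac with h2 | h2 <;>
    rcases lt_or_gt_of_ne hbc with h3 | h3
  · exact ⟨a, ha, b, hb, c, hc, h1, h3⟩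
  · exact ⟨a, ha, c, hc, b, hb, h2, h3⟩
  · linarith
  · exact ⟨c, hc, a, ha, b, hb, h2, h1⟩
  · exact ⟨b, hb, a, ha, c, hc, h1, h2⟩
  · linarith
  · exact ⟨b, hb, c, hc, a, ha, h3, h2⟩
  · exact ⟨c, hc, b, hb, a, ha, h3, h1⟩

namespace FreeArc

variable {G : Type*} [MetricSpace G] {j : ℝ → G} {f : G → G}

/-- Near a recurrent point there are two good pairs on its orbit, with an orbit point between. -/
theorem exists_flanks (hj : FreeArc j) (hf : Continuous f) (hP : PFree j f) {t₀ : ℝ}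
    (ht₀ : t₀ ∈ Ioo (0 : ℝ) 1) (hr : j t₀ ∈ omegaSet f (j t₀)) {l₁ l₂ : ℝ} (hl : t₀ ∈ Ioo l₁ l₂) :
    ∃ x₁ k₁ x₁' x₃ k₃ x₃' y₂, GoodPair j f x₁ k₁ x₁' ∧ GoodPair j f x₃ k₃ x₃' ∧
      (∃ n, f^[n] (j t₀) = j x₁) ∧ (∃ n, f^[n] (j t₀) = j x₃) ∧ (∃ n, f^[n] (j t₀) = j y₂) ∧
      l₁ < min x₁ x₁' ∧ max x₁ x₁' < y₂ ∧ y₂ < min x₃ x₃' ∧ max x₃ x₃' < l₂ := by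
  have hLn : Ioo l₁ l₂ ∈ 𝓝 t₀ := Ioo_mem_nhds hl.1 hl.2
  obtain ⟨n, hn, b, ⟨hbL, hb⟩, hbe⟩ := hj.exists_return ht₀ hr hLn 1
  have hnb : t₀ ≠ b := fun h => hP t₀ ht₀ _ hn (by rw [hbe, ← h])
  obtain ⟨m, hm, c, ⟨⟨hcL, hcb⟩, hc⟩, hce⟩ := hj.exists_return ht₀ hr
    (inter_mem hLn (isOpen_ne.mem_nhds hnb)) 1
  have hnc : t₀ ≠ c := fun h => hP t₀ ht₀ _ hm (by rw [hce, ← h])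
  obtain ⟨y₁, ⟨hy₁, hy₁L, n₁, e₁⟩, y₂, ⟨hy₂, hy₂L, n₂, e₂⟩, y₃, ⟨hy₃, hy₃L, n₃, e₃⟩, h12, h23⟩ :=
    exists_sorted_of_three
      (S := {z | z ∈ Ioo (0 : ℝ) 1 ∧ z ∈ Ioo l₁ l₂ ∧ ∃ n, f^[n] (j t₀) = j z})
      ⟨ht₀, hl, 0, rfl⟩ ⟨hb, hbL, n, hbe⟩ ⟨hc, hcL, m, hce⟩ hnb hnc (fun h => hcb h.symm)
  obtain ⟨k₁, x₁', g₁, h₁⟩ := hj.exists_goodPair hf hP hy₁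
    (e₁ ▸ recurrent_iterate hf hr n₁) (Ioo_mem_nhds hy₁L.1 h12)
  obtain ⟨k₃, x₃', g₃, h₃⟩ := hj.exists_goodPair hf hP hy₃
    (e₃ ▸ recurrent_iterate hf hr n₃) (Ioo_mem_nhds h23 hy₃L.2)
  exact ⟨y₁, k₁, x₁', y₃, k₃, x₃', y₂, g₁, g₃, ⟨n₁, e₁⟩, ⟨n₃, e₃⟩, ⟨n₂, e₂⟩,
    lt_min hy₁L.1 h₁.1, max_lt h12 h₁.2, lt_min h23 h₃.1, max_lt hy₃L.2 h₃.2⟩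

/-- Transfer of accumulation at a recurrent point along non-crossing intervals. -/
theorem mem_omegaSet_transfer (hj : FreeArc j) (hf : Continuous f) (hP : PFree j f) {t₀ s : ℝ}
    (ht₀ : t₀ ∈ Ioo (0 : ℝ) 1) (hr : j t₀ ∈ omegaSet f (j t₀))
    (H : ∀ x₁ k₁ x₁' x₃ k₃ x₃', GoodPair j f x₁ k₁ x₁' → GoodPair j f x₃ k₃ x₃' →
      (∃ n, f^[n] (j t₀) = j x₁) → (∃ n, f^[n] (j t₀) = j x₃) →
      ∃ a b t, Icc a b ⊆ Ioo 0 1 ∧ t ∈ Icc a b ∧ s ∈ Icc a b ∧ j t₀ ∈ omegaSet f (j t) ∧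
        ∀ n ≥ 1, ¬ Cross j f n a b (min x₁ x₁') (max x₁ x₁') ∧
          ¬ Cross j f n a b (min x₃ x₃') (max x₃ x₃')) :
    j t₀ ∈ omegaSet f (j s) := by
  rw [mem_omegaSet_iff]
  intro U hU N
  obtain ⟨l₁, l₂, hl, hlU⟩ := mem_nhds_iff_exists_Ioo_subset.1
    ((hj.continuousAt ht₀).preimage_mem_nhds hU)
  obtain ⟨x₁, k₁, x₁', x₃, k₃, x₃', y₂, g₁, g₃, o₁, o₃, ⟨n₂, o₂⟩, h1, h2, h3, h4⟩ :=
    hj.exists_flanks hf hP ht₀ hr hl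
  obtain ⟨a, b, t, hab, ht, hs, hω, hc⟩ := H x₁ k₁ x₁' x₃ k₃ x₃' g₁ g₃ o₁ o₃
  have hy₂ : y₂ ∈ Ioo (0 : ℝ) 1 :=
    ⟨lt_of_le_of_lt (g₁.left_mem.1.le.trans (le_max_left _ _)) h2,
      lt_of_lt_of_le h3 ((min_le_left _ _).trans g₃.left_mem.2.le)⟩
  have hy₂ω : j y₂ ∈ omegaSet f (j t) := by
    rw [← o₂]; exact iterate_mem_of_image_subset (image_omegaSet_subset hf _) hω n₂
  obtain ⟨n, hn, l, ⟨hl', -⟩, he⟩ := hj.exists_return hy₂ hy₂ω (Ioo_mem_nhds h2 h3) (N + 1)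
  obtain ⟨σ, hσ, heσ⟩ := hj.exists_apply_eq_of_not_cross hP (show 1 ≤ n by omega) hab ht hs
    (lt_min g₁.left_mem.1 g₁.right_mem.1) min_le_max hl'.1.le hl'.2.le min_le_max
    (max_lt g₃.left_mem.2 g₃.right_mem.2) he (hc n (by omega)).1 (hc n (by omega)).2
  refine ⟨n, by omega, heσ ▸ hlU ⟨h1.trans hσ.1, hσ.2.trans h4⟩⟩

theorem mem_omegaSet_of_mem_omegaSet (hj : FreeArc j) (hf : Continuous f) (hP : PFree j f)
    {t₀ s : ℝ} (ht₀ : t₀ ∈ Ioo (0 : ℝ) 1) (hr : j t₀ ∈ omegaSet f (j t₀))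
    (hs : s ∈ Ioo (0 : ℝ) 1) (hω : j s ∈ omegaSet f (j t₀)) : j t₀ ∈ omegaSet f (j s) := by
  by_cases ho : ∃ n, f^[n] (j t₀) = j s
  · obtain ⟨n, hn⟩ := ho
    rw [← hn, omegaSet_iterate_apply]; exact hr
  push Not at ho
  refine hj.mem_omegaSet_transfer hf hP ht₀ hr fun x₁ k₁ x₁' x₃ k₃ x₃' g₁ g₃ o₁ o₃ => ?_
  have hoff : ∀ x, (∃ n, f^[n] (j t₀) = j x) → ∀ n, f^[n] (j x) ≠ j s := by
    rintro x ⟨m, hm⟩ n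
    rw [← hm, ← iterate_add_apply]; exact ho _
  obtain ⟨m₁, hm₁, a₁, b₁, ha₁, has₁, hbs₁, hb₁, c₁⟩ := g₁.cross_around hj hP hs (hoff _ o₁)
  obtain ⟨m₃, hm₃, a₃, b₃, ha₃, has₃, hbs₃, hb₃, c₃⟩ := g₃.cross_around hj hP hs (hoff _ o₃)
  have hsub : Icc (max a₁ a₃) (min b₁ b₃) ⊆ Ioo 0 1 := fun z hz =>
    ⟨ha₁.trans_le ((le_max_left _ _).trans hz.1), (hz.2.trans (min_le_left _ _)).trans_lt hb₁⟩
  obtain ⟨n, -, t, ⟨ht, -⟩, he⟩ := hj.exists_return hs hω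
    (Ioo_mem_nhds (max_lt has₁ has₃) (lt_min hbs₁ hbs₃)) 0
  refine ⟨_, _, t, hsub, Ioo_subset_Icc_self ht, ⟨(max_lt has₁ has₃).le, (lt_min hbs₁ hbs₃).le⟩,
    ?_, fun n hn => ⟨fun h => ?_, fun h => ?_⟩⟩
  · rw [← he, omegaSet_iterate_apply]; exact hr
  · exact hj.not_cross_cycle hf hP hm₁ hn g₁.Icc_subset hsub
      (c₁.mono (le_max_left _ _) (min_le_left _ _)) h
  · exact hj.not_cross_cycle hf hP hm₃ hn g₃.Icc_subset hsub
      (c₃.mono (le_max_right _ _) (min_le_right _ _)) h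

theorem mem_omegaSet_of_gap (hj : FreeArc j) (hf : Continuous f) (hP : PFree j f)
    {t₀ a b t s : ℝ} (ht₀ : t₀ ∈ Ioo (0 : ℝ) 1) (hr : j t₀ ∈ omegaSet f (j t₀))
    (hab : Icc a b ⊆ Ioo 0 1) (hs : s ∈ Icc a b) (ht : t ∈ Icc a b)
    (hω : j t₀ ∈ omegaSet f (j t)) (hgap : ∀ σ ∈ Ioo a b, j σ ∉ omegaSet f (j t₀)) :
    j t₀ ∈ omegaSet f (j s) := by
  have hle : a ≤ b := hs.1.trans hs.2
  refine hj.mem_omegaSet_transfer hf hP ht₀ hr fun x₁ k₁ x₁' x₃ k₃ x₃' g₁ g₃ o₁ o₃ =>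
    ⟨a, b, t, hab, ht, hs, hω, fun n hn => ?_⟩
  have hoff : ∀ x, (∃ n, f^[n] (j t₀) = j x) → ∀ n, ∀ σ ∈ Ioo a b, f^[n] (j x) ≠ j σ := by
    rintro x ⟨m, hm⟩ n σ hσ he
    refine hgap σ hσ ?_
    rw [← he, ← hm, ← iterate_add_apply]; exact iterate_mem_omegaSet_self hf hr _
  obtain ⟨m₁, hm₁, c₁⟩ := g₁.cross_gap hj hP (hab ⟨le_rfl, hle⟩) (hab ⟨hle, le_rfl⟩) (hoff _ o₁)
  obtain ⟨m₃, hm₃, c₃⟩ := g₃.cross_gap hj hP (hab ⟨le_rfl, hle⟩) (hab ⟨hle, le_rfl⟩) (hoff _ o₃)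
  exact ⟨fun h => hj.not_cross_cycle hf hP hm₁ hn g₁.Icc_subset hab c₁ h,
    fun h => hj.not_cross_cycle hf hP hm₃ hn g₃.Icc_subset hab c₃ h⟩

/-- Every point of a periodic-point-free arc accumulates at each recurrent point of the arc. -/
theorem mem_omegaSet_of_recurrent (hj : FreeArc j) (hf : Continuous f) (hP : PFree j f)
    {t₀ s : ℝ} (ht₀ : t₀ ∈ Ioo (0 : ℝ) 1) (hr : j t₀ ∈ omegaSet f (j t₀))
    (hs : s ∈ Ioo (0 : ℝ) 1) : j t₀ ∈ omegaSet f (j s) := by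
  have hpre : ∀ a b, Icc a b ⊆ Ioo 0 1 → IsCompact (Icc a b ∩ j ⁻¹' omegaSet f (j t₀)) :=
    fun a b hab => isCompact_Icc.of_isClosed_subset
      ((hj.continuousOn.mono (hab.trans Ioo_subset_Icc_self)).preimage_isClosed_of_isClosed
        isClosed_Icc isClosed_omegaSet) inter_subset_left
  rcases le_total t₀ s with h | h
  · have hsub : Icc t₀ s ⊆ Ioo 0 1 := Icc_subset_Ioo ht₀.1 hs.2
    obtain ⟨u, ⟨hu1, hu2⟩, hu3⟩ := (hpre t₀ s hsub).exists_isGreatest ⟨t₀, ⟨le_rfl, h⟩, hr⟩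
    refine hj.mem_omegaSet_of_gap hf hP ht₀ hr ((Icc_subset_Icc_left hu1.1).trans hsub)
      ⟨hu1.2, le_rfl⟩ ⟨le_rfl, hu1.2⟩
      (hj.mem_omegaSet_of_mem_omegaSet hf hP ht₀ hr (hsub hu1) hu2) fun σ hσ hc => ?_
    exact absurd (hu3 ⟨⟨hu1.1.trans hσ.1.le, hσ.2.le⟩, hc⟩) hσ.1.not_ge
  · have hsub : Icc s t₀ ⊆ Ioo 0 1 := Icc_subset_Ioo hs.1 ht₀.2
    obtain ⟨u, ⟨hu1, hu2⟩, hu3⟩ := (hpre s t₀ hsub).exists_isLeast ⟨t₀, ⟨h, le_rfl⟩, hr⟩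
    refine hj.mem_omegaSet_of_gap hf hP ht₀ hr ((Icc_subset_Icc_right hu1.2).trans hsub)
      ⟨le_rfl, hu1.1⟩ ⟨hu1.1, le_rfl⟩
      (hj.mem_omegaSet_of_mem_omegaSet hf hP ht₀ hr (hsub hu1) hu2) fun σ hσ hc => ?_
    exact absurd (hu3 ⟨⟨hσ.1.le, hσ.2.le.trans hu1.2⟩, hc⟩) hσ.2.not_ge

end FreeArc

theorem IsPreconnected.iff_of_eventually {X : Type*} [TopologicalSpace X] {s : Set X}
    (hs : IsPreconnected s) {p : X → Prop} (h : ∀ x ∈ s, ∀ᶠ y in 𝓝 x, (p y ↔ p x)) {x y : X}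
    (hx : x ∈ s) (hy : y ∈ s) : p x ↔ p y := by
  classical
  have hc : ContinuousOn (fun z => decide (p z)) s := fun z hz => by
    refine ContinuousAt.continuousWithinAt ?_
    refine (continuousAt_const (y := decide (p z))).congr ?_
    filter_upwards [h z hz] with w hw
    simp [hw]
  simpa using hs.constant hc hx hy

namespace FreeArc

variable {G : Type*} [MetricSpace G] {j : ℝ → G} {f : G → G}

theorem goodPair_chain (hj : FreeArc j) (hP : PFree j f) {x x' : ℝ} {k : ℕ}
    (h : GoodPair j f x k x') {K : ℕ → ℝ → Prop}
    (h1 : ∀ m ≥ 1, ∀ t ∈ Ioo (0 : ℝ) 1, disp j f^[m] t < 1 → K m t)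
    (h2 : ∀ m ≥ 1, ∀ t ∈ Ioo (0 : ℝ) 1, 1 < disp j f^[m] t → ¬ K m t)
    (h3 : ∀ m ≥ 1, ∀ m' ≥ 1, ∀ t ∈ Ioo (0 : ℝ) 1, ∀ t' ∈ Ioo (0 : ℝ) 1,
      disp j f^[m] t = 1 → disp j f^[m'] t' = 1 → f^[m] (j t) = f^[m'] (j t') → (K m t ↔ K m' t'))
    (h4 : ∀ m ≥ 1, (K m x ↔ K m x')) : False := by
  have hik : ∀ i ≥ 1, 1 ≤ i * k := fun i hi => Nat.mul_pos hi h.pos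
  have hstep : ∀ i ≥ 1, disp j f^[(i + 1) * k] x = disp j f^[i * k] x' →
      (K ((i + 1) * k) x ↔ K (i * k) x') := by
    intro i hi he
    rcases lt_trichotomy (disp j f^[i * k] x') 1 with c | c | c
    · exact iff_of_true (h1 _ (hik _ (by omega)) _ h.left_mem (he ▸ c))
        (h1 _ (hik _ hi) _ h.right_mem c)
    · refine h3 _ (hik _ (by omega)) _ (hik _ hi) _ h.left_mem _ h.right_mem (he ▸ c) c ?_
      rw [h.iterate_right]; congr 2; ring
    · exact iff_of_false (h2 _ (hik _ (by omega)) _ h.left_mem (he ▸ c))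
        (h2 _ (hik _ hi) _ h.right_mem c)
  have hev : ∃ i ≥ 1, ∃ y ∈ Ioo (min x x') (max x x'), f^[(i + 1) * k] (j x) = j y := by
    obtain ⟨i, hi, hy⟩ := h.visits 2
    exact ⟨i - 1, by omega, by rwa [Nat.sub_add_cancel (by omega)]⟩
  rcases lt_or_gt_of_ne h.ne with hlt | hlt
  · have hK : ∀ i ≥ 1, K (i * k) x := by
      intro i hi
      induction i, hi using Nat.le_induction with
      | base =>
        rw [one_mul]
        refine h1 k h.pos x h.left_mem ?_
        rw [hj.disp_of_lt h.right_mem h.apply_eq hlt]; exact h.right_mem.2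
      | succ i hi ih =>
        have hx' := (h4 _ (hik i hi)).1 ih
        rcases h.disp_step hj hP hi with c | c
        · exact (hstep i hi c.1).2 hx'
        · refine absurd hx' (h2 _ (hik i hi) _ h.right_mem ?_)
          have := c.2.1 hlt
          have := hj.lt_disp h.left_mem (hP x h.left_mem _ (hik (i + 1) (by omega)))
          linarith [h.left_mem.1]
    obtain ⟨i, hi, hy⟩ := hev
    rcases h.disp_step hj hP hi with c | c
    · exact c.2 hy
    · refine absurd ((h4 _ (hik i hi)).1 (hK i hi)) (h2 _ (hik i hi) _ h.right_mem ?_)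
      have := c.2.1 hlt
      have := hj.lt_disp h.left_mem (hP x h.left_mem _ (hik (i + 1) (by omega)))
      linarith [h.left_mem.1]
  · have hK : ∀ i ≥ 1, ¬ K (i * k) x := by
      intro i hi
      induction i, hi using Nat.le_induction with
      | base =>
        rw [one_mul]
        refine h2 k h.pos x h.left_mem ?_
        rw [hj.disp_of_gt h.right_mem h.apply_eq hlt.le]; linarith [h.right_mem.1]
      | succ i hi ih =>
        have hx' := fun hc => ih ((h4 _ (hik i hi)).2 hc)
        rcases h.disp_step hj hP hi with c | c
        · exact fun hc => hx' ((hstep i hi c.1).1 hc)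
        · refine absurd (h1 _ (hik i hi) _ h.right_mem ?_) hx'
          have := c.2.2 hlt
          have := hj.disp_lt h.left_mem (hP x h.left_mem _ (hik (i + 1) (by omega)))
          linarith [h.left_mem.2]
    obtain ⟨i, hi, hy⟩ := hev
    rcases h.disp_step hj hP hi with c | c
    · exact c.2 hy
    · refine hK i hi ((h4 _ (hik i hi)).2 (h1 _ (hik i hi) _ h.right_mem ?_))
      have := c.2.2 hlt
      have := hj.disp_lt h.left_mem (hP x h.left_mem _ (hik (i + 1) (by omega)))
      linarith [h.left_mem.2]

/-- The left endpoint of a periodic-point-free arc containing a recurrent point is covered by an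
iterate of the open arc. -/
theorem left_mem_image (hj : FreeArc j) (hf : Continuous f) (hP : PFree j f) {t₀ : ℝ}
    (ht₀ : t₀ ∈ Ioo (0 : ℝ) 1) (hr : j t₀ ∈ omegaSet f (j t₀)) :
    ∃ m ≥ 1, j 0 ∈ f^[m] '' (j '' Ioo 0 1) := by
  by_contra hcon
  push Not at hcon
  obtain ⟨k, x', h, -⟩ := hj.exists_goodPair hf hP ht₀ hr univ_mem
  refine hj.goodPair_chain hP h (K := fun m t => disp j f^[m] t ≤ 1) (fun m _ t _ h => h.le)
    (fun m _ t _ h => h.not_ge) (fun m _ m' _ t _ t' _ h h' _ => by simp [h, h']) fun m hm => ?_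
  refine (isPreconnected_uIcc (a := t₀) (b := x')).iff_of_eventually
    (p := fun t => disp j f^[m] t ≤ 1) (fun t ht => ?_) left_mem_uIcc right_mem_uIcc
  have ht' : t ∈ Ioo (0 : ℝ) 1 := h.Icc_subset ht
  have hc := hj.continuousAt_disp (hf.iterate m) ht' (hP t ht' m hm)
  rcases lt_trichotomy (disp j f^[m] t) 1 with c | c | c
  · filter_upwards [hc.eventually_lt continuousAt_const c] with s hs
    exact iff_of_true hs.le c.le
  · have hcl : IsClosed (j '' Icc 0 (1 / 2)) := (isCompact_Icc.image_of_continuousOn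
      (hj.continuousOn.mono (Icc_subset_Icc_right (by norm_num)))).isClosed
    have hnot : f^[m] (j t) ∉ j '' Icc 0 (1 / 2) := by
      rintro ⟨s, hs, he⟩
      rcases hs.1.eq_or_lt with h0 | h0
      · exact hcon m hm ⟨j t, ⟨t, ht', rfl⟩, by rw [← he, ← h0]⟩
      · exact hj.notMem_of_disp_eq (hP t ht' m hm) c ⟨s, ⟨h0, by linarith [hs.2]⟩, he⟩
    have hc2 : ContinuousAt (fun t => f^[m] (j t)) t :=
      (hf.iterate m).continuousAt.comp (hj.continuousAt ht')
    filter_upwards [hc.eventually_lt (continuousAt_const (y := 3 / 2)) (by rw [c]; norm_num),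
      hc2.eventually_mem (hcl.isOpen_compl.mem_nhds hnot), Ioo_mem_nhds ht'.1 ht'.2] with s h1 h2 h3
    refine iff_of_true ?_ c.le
    by_contra h4
    push Not at h4
    refine h2 ⟨_, ⟨?_, ?_⟩, (hj.apply_eq_of_lt_disp (hP s h3 m hm) h4).symm⟩ <;> linarith
  · filter_upwards [continuousAt_const.eventually_lt hc c] with s hs
    exact iff_of_false hs.not_ge c.not_ge

open Classical in
/-- In the saturation of the arc with the open arc removed, the two endpoints are joined. -/
theorem joinedIn_saturation (hj : FreeArc j) (hf : Continuous f) (hP : PFree j f) {t₀ : ℝ}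
    (ht₀ : t₀ ∈ Ioo (0 : ℝ) 1) (hr : j t₀ ∈ omegaSet f (j t₀)) :
    JoinedIn (((⋃ n : ℕ, f^[n] '' (j '' Ioo 0 1)) \ j '' Ioo 0 1) ∪ {j 0, j 1}) (j 1) (j 0) := by
  set S := ((⋃ n : ℕ, f^[n] '' (j '' Ioo 0 1)) \ j '' Ioo 0 1) ∪ {j 0, j 1} with hS
  by_contra hcon
  obtain ⟨k, x', h, -⟩ := hj.exists_goodPair hf hP ht₀ hr univ_mem
  set ρ : ℕ → ℝ → G := fun m t => if disp j f^[m] t < 1 then j 1 else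
    if 1 < disp j f^[m] t then j 0 else f^[m] (j t) with hρ
  have r1 : ∀ m t, disp j f^[m] t < 1 → ρ m t = j 1 := fun m t h => by simp only [hρ, if_pos h]
  have r2 : ∀ m t, 1 < disp j f^[m] t → ρ m t = j 0 := fun m t h => by
    simp only [hρ, if_neg h.not_gt, if_pos h]
  have r3 : ∀ m t, disp j f^[m] t = 1 → ρ m t = f^[m] (j t) := fun m t h => by simp [hρ, h]
  have m1 : j 1 ∈ S := Or.inr (by simp)
  have m0 : j 0 ∈ S := Or.inr (by simp)
  refine hj.goodPair_chain hP h (K := fun m t => JoinedIn S (j 1) (ρ m t))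
    (fun m _ t _ h => by rw [r1 m t h]; exact JoinedIn.refl m1)
    (fun m _ t _ h => by rw [r2 m t h]; exact hcon)
    (fun m _ m' _ t _ t' _ h h' he => by rw [r3 m t h, r3 m' t' h', he]) fun m hm => ?_
  have hEsub : uIcc t₀ x' ⊆ Ioo 0 1 := h.Icc_subset
  have hmaps : ∀ t ∈ uIcc t₀ x', ρ m t ∈ S := by
    intro t ht
    rcases lt_trichotomy (disp j f^[m] t) 1 with c | c | c
    · rw [r1 m t c]; exact m1
    · rw [r3 m t c]
      exact Or.inl ⟨mem_iUnion.2 ⟨m, j t, ⟨t, hEsub ht, rfl⟩, rfl⟩,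
        hj.notMem_of_disp_eq (hP t (hEsub ht) m hm) c⟩
    · rw [r2 m t c]; exact m0
  have hcont : ContinuousOn (ρ m) (uIcc t₀ x') := by
    intro t ht
    have ht' : t ∈ Ioo (0 : ℝ) 1 := hEsub ht
    have hc := hj.continuousAt_disp (hf.iterate m) ht' (hP t ht' m hm)
    refine ContinuousAt.continuousWithinAt ?_
    rcases lt_trichotomy (disp j f^[m] t) 1 with c | c | c
    · refine (continuousAt_const (y := j 1)).congr ?_
      filter_upwards [hc.eventually_lt continuousAt_const c] with s hs
      rw [r1 m s hs]
    · have hc2 : ContinuousAt (fun t => f^[m] (j t)) t :=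
        (hf.iterate m).continuousAt.comp (hj.continuousAt ht')
      rw [Metric.continuousAt_iff']
      intro ε hε
      obtain ⟨δ₀, hδ₀, h0⟩ := Metric.continuousWithinAt_iff.1
        (hj.continuousOn 0 ⟨le_rfl, zero_le_one⟩) (ε / 2) (half_pos hε)
      obtain ⟨δ₁, hδ₁, h1⟩ := Metric.continuousWithinAt_iff.1
        (hj.continuousOn 1 ⟨zero_le_one, le_rfl⟩) (ε / 2) (half_pos hε)
      have hδ : 0 < min 1 (min δ₀ δ₁) := lt_min one_pos (lt_min hδ₀ hδ₁)
      filter_upwards [Metric.continuousAt_iff'.1 hc2 (ε / 2) (half_pos hε),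
        Metric.continuousAt_iff'.1 hc _ hδ, Ioo_mem_nhds ht'.1 ht'.2] with s h2 h3 h4
      rw [c, Real.dist_eq, lt_min_iff, lt_min_iff] at h3
      rw [r3 m t c]
      rcases lt_trichotomy (disp j f^[m] s) 1 with d | d | d
      · rw [r1 m s d]
        have e := hj.apply_eq_of_disp_lt (hP s h4 m hm) d
        have h5 := h1 (x := disp j f^[m] s)
          ⟨by linarith [hj.lt_disp h4 (hP s h4 m hm), h4.1], d.le⟩ h3.2.2
        rw [← e] at h5
        calc dist (j 1) (f^[m] (j t)) ≤ dist (j 1) (f^[m] (j s)) + dist (f^[m] (j s)) (f^[m] (j t)) :=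
              dist_triangle _ _ _
          _ < ε := by rw [dist_comm (j 1)]; linarith
      · rw [r3 m s d]; linarith
      · rw [r2 m s d]
        have e := hj.apply_eq_of_lt_disp (hP s h4 m hm) d
        have h5 := h0 (x := disp j f^[m] s - 1)
          ⟨by linarith, by linarith [hj.disp_lt h4 (hP s h4 m hm), h4.2]⟩
          (by rw [Real.dist_eq, sub_zero]; exact h3.2.1)
        rw [← e] at h5
        calc dist (j 0) (f^[m] (j t)) ≤ dist (j 0) (f^[m] (j s)) + dist (f^[m] (j s)) (f^[m] (j t)) :=
              dist_triangle _ _ _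
          _ < ε := by rw [dist_comm (j 0)]; linarith
    · refine (continuousAt_const (y := j 0)).congr ?_
      filter_upwards [continuousAt_const.eventually_lt hc c] with s hs
      rw [r2 m s hs]
  have hpc : IsPathConnected (ρ m '' uIcc t₀ x') :=
    ((convex_uIcc t₀ x').isPathConnected nonempty_uIcc).image' hcont
  have hjoin : JoinedIn S (ρ m t₀) (ρ m x') :=
    (hpc.joinedIn _ ⟨t₀, left_mem_uIcc, rfl⟩ _ ⟨x', right_mem_uIcc, rfl⟩).mono
      (by rintro _ ⟨t, ht, rfl⟩; exact hmaps t ht)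
  exact ⟨fun h => h.trans hjoin, fun h => h.trans hjoin.symm⟩

end FreeArc

section Circles

variable {G : Type*} [MetricSpace G]

theorem isCircle_of_loop {γ : ℝ → G} (hγ : ContinuousOn γ (Icc 0 1)) (h01 : γ 0 = γ 1)
    (hinj : InjOn γ (Ico 0 1)) : IsCircle (γ '' Icc 0 1) := by
  have : Fact ((0 : ℝ) < 1) := ⟨one_pos⟩
  have hc : Continuous (AddCircle.liftIco (1 : ℝ) 0 γ) :=
    AddCircle.liftIco_continuous (by simpa using h01) (by simpa using hγ)
  have hrange : ∀ x, AddCircle.liftIco (1 : ℝ) 0 γ x ∈ γ '' Icc 0 1 := by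
    intro x
    obtain ⟨t, ht, rfl⟩ := (AddCircle.coe_image_Ico_eq (1 : ℝ) 0 ▸ mem_univ x :
      x ∈ ((↑) : ℝ → AddCircle (1 : ℝ)) '' Ico 0 (0 + 1))
    rw [AddCircle.liftIco_coe_apply ht]
    exact ⟨t, by simpa using Ico_subset_Icc_self ht, rfl⟩
  let F : AddCircle (1 : ℝ) → γ '' Icc 0 1 := fun x => ⟨_, hrange x⟩
  have hF : Continuous F := hc.subtype_mk _
  have hbij : Bijective F := by
    constructor
    · intro x y hxy
      obtain ⟨s, hs, rfl⟩ := (AddCircle.coe_image_Ico_eq (1 : ℝ) 0 ▸ mem_univ x :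
        x ∈ ((↑) : ℝ → AddCircle (1 : ℝ)) '' Ico 0 (0 + 1))
      obtain ⟨t, ht, rfl⟩ := (AddCircle.coe_image_Ico_eq (1 : ℝ) 0 ▸ mem_univ y :
        y ∈ ((↑) : ℝ → AddCircle (1 : ℝ)) '' Ico 0 (0 + 1))
      have := congrArg Subtype.val hxy
      simp only [F, AddCircle.liftIco_coe_apply ht, AddCircle.liftIco_coe_apply hs] at this
      rw [zero_add] at hs ht
      rw [hinj hs ht this]
    · rintro ⟨_, t, ht, rfl⟩
      rcases ht.2.eq_or_lt with h1 | h1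
      · refine ⟨((0 : ℝ) : AddCircle (1 : ℝ)), Subtype.ext ?_⟩
        simp only [F]
        rw [AddCircle.liftIco_coe_apply (by simp), h01, h1]
      · refine ⟨(t : AddCircle (1 : ℝ)), Subtype.ext ?_⟩
        simp only [F]
        rw [AddCircle.liftIco_coe_apply (by simpa using ⟨ht.1, h1⟩)]
  let e : AddCircle (1 : ℝ) ≃ₜ γ '' Icc 0 1 :=
    hF.homeoOfEquivCompactToT2 (f := Equiv.ofBijective F hbij)
  let e2 : Circle ≃ₜ Metric.sphere (0 : ℂ) 1 := Homeomorph.refl _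
  exact ⟨e.symm.trans ((AddCircle.homeomorphCircle one_ne_zero).trans e2)⟩

theorem isCircle_of_two_arcs {γ δ : ℝ → G} (hγ : ContinuousOn γ (Icc 0 1))
    (hδ : ContinuousOn δ (Icc 0 1)) (iγ : InjOn γ (Icc 0 1)) (iδ : InjOn δ (Icc 0 1))
    (h1 : γ 1 = δ 0) (h2 : δ 1 = γ 0)
    (hne : ∀ s ∈ Icc (0 : ℝ) 1, ∀ t ∈ Ioo (0 : ℝ) 1, γ s ≠ δ t) :
    IsCircle (γ '' Icc 0 1 ∪ δ '' Icc 0 1) := by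
  classical
  set η : ℝ → G := fun t => if t ≤ 1 / 2 then γ (2 * t) else δ (2 * t - 1) with hη
  have e1 : ∀ t, t ≤ 1 / 2 → η t = γ (2 * t) := fun t ht => if_pos ht
  have e2 : ∀ t, 1 / 2 ≤ t → η t = δ (2 * t - 1) := fun t ht => by
    rcases ht.eq_or_lt with h | h
    · rw [e1 t h.ge, ← h]; norm_num; exact h1
    · exact if_neg h.not_ge
  have himg : η '' Icc 0 1 = γ '' Icc 0 1 ∪ δ '' Icc 0 1 := by
    ext x
    constructor
    · rintro ⟨t, ht, rfl⟩
      rcases le_total t (1 / 2) with h | h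
      · rw [e1 t h]; exact Or.inl ⟨_, ⟨by linarith [ht.1], by linarith⟩, rfl⟩
      · rw [e2 t h]; exact Or.inr ⟨_, ⟨by linarith, by linarith [ht.2]⟩, rfl⟩
    · rintro (⟨t, ht, rfl⟩ | ⟨t, ht, rfl⟩)
      · exact ⟨t / 2, ⟨by linarith [ht.1], by linarith [ht.2]⟩, by
          rw [e1 _ (by linarith [ht.2])]; congr 1; ring⟩
      · exact ⟨(t + 1) / 2, ⟨by linarith [ht.1], by linarith [ht.2]⟩, by
          rw [e2 _ (by linarith [ht.1])]; congr 1; ring⟩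
  rw [← himg]
  refine isCircle_of_loop ?_ ?_ ?_
  · have hu : Icc (0 : ℝ) 1 = Icc 0 (1 / 2) ∪ Icc (1 / 2) 1 :=
      (Icc_union_Icc_eq_Icc (by norm_num) (by norm_num)).symm
    rw [hu]
    refine ContinuousOn.union_of_isClosed ?_ ?_ isClosed_Icc isClosed_Icc
    · refine (hγ.comp (f := fun t => 2 * t) (by fun_prop) fun t ht => ?_).congr
        fun t ht => e1 t ht.2
      exact ⟨by linarith [ht.1], by linarith [ht.2]⟩
    · refine (hδ.comp (f := fun t => 2 * t - 1) (by fun_prop) fun t ht => ?_).congr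
        fun t ht => e2 t ht.1
      exact ⟨by linarith [ht.1], by linarith [ht.2]⟩
  · rw [e1 0 (by norm_num), e2 1 (by norm_num)]; norm_num; exact h2.symm
  · have key : ∀ s ∈ Ico (0 : ℝ) 1, ∀ t ∈ Ico (0 : ℝ) 1, s ≤ t → η s = η t → s = t := by
      intro s hs t ht hst he
      rcases le_or_gt t (1 / 2) with h | h
      · rw [e1 s (hst.trans h), e1 t h] at he
        have := iγ (x₁ := 2 * s) (x₂ := 2 * t) ⟨by linarith [hs.1], by linarith⟩
          ⟨by linarith [ht.1], by linarith⟩ he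
        linarith
      · rcases le_or_gt s (1 / 2) with h' | h'
        · rw [e1 s h', e2 t h.le] at he
          exact absurd he (hne _ ⟨by linarith [hs.1], by linarith⟩ _
            ⟨by linarith, by linarith [ht.2]⟩)
        · rw [e2 s h'.le, e2 t h.le] at he
          have := iδ (x₁ := 2 * s - 1) (x₂ := 2 * t - 1) ⟨by linarith, by linarith [hs.2]⟩
            ⟨by linarith, by linarith [ht.2]⟩ he
          linarith
    intro s hs t ht he
    rcases le_total s t with h | h
    · exact key s hs t ht h he
    · exact (key t ht s hs h he.symm).symm

end Circles

/-- The points `a` and `b` are joined by a (possibly degenerate) arc inside `S`. -/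
def ArcIn {G : Type*} [TopologicalSpace G] (S : Set G) (a b : G) : Prop :=
  ∃ (p q : ℝ) (γ : ℝ → G), p ≤ q ∧ ContinuousOn γ (Icc p q) ∧ InjOn γ (Icc p q) ∧
    γ p = a ∧ γ q = b ∧ MapsTo γ (Icc p q) S

namespace ArcIn

variable {G : Type*} [MetricSpace G] {S : Set G} {a b c : G}

omit [MetricSpace G] in
theorem refl [TopologicalSpace G] (ha : a ∈ S) : ArcIn S a a :=
  ⟨0, 0, fun _ => a, le_rfl, continuousOn_const, by simp, rfl, rfl, fun _ _ => ha⟩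

omit [MetricSpace G] in
theorem symm [TopologicalSpace G] (h : ArcIn S a b) : ArcIn S b a := by
  obtain ⟨p, q, γ, hpq, hc, hi, h1, h2, hm⟩ := h
  have hmaps : MapsTo (fun t => p + q - t) (Icc p q) (Icc p q) :=
    fun t ht => ⟨by linarith [ht.2], by linarith [ht.1]⟩
  refine ⟨p, q, fun t => γ (p + q - t), hpq, hc.comp (by fun_prop) hmaps, ?_, by simpa using h2,
    by simpa using h1, fun t ht => hm (hmaps ht)⟩
  intro s hs t ht he
  have := hi (hmaps hs) (hmaps ht) he
  simp only at this
  linarith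

theorem trans (h : ArcIn S a b) (h' : ArcIn S b c) : ArcIn S a c := by
  classical
  obtain ⟨p, q, γ, hpq, hc, hi, h1, h2, hm⟩ := h
  obtain ⟨p', q', δ, hpq', hc', hi', h1', h2', hm'⟩ := h'
  have hcl : IsClosed (δ '' Icc p' q') := (isCompact_Icc.image_of_continuousOn hc').isClosed
  have hcomp : IsCompact (Icc p q ∩ γ ⁻¹' (δ '' Icc p' q')) :=
    isCompact_Icc.of_isClosed_subset (hc.preimage_isClosed_of_isClosed isClosed_Icc hcl)
      inter_subset_left
  obtain ⟨t, ⟨ht, s, hs, hst⟩, hmin⟩ := hcomp.exists_isLeast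
    ⟨q, ⟨hpq, le_rfl⟩, p', ⟨le_rfl, hpq'⟩, by rw [h1', h2]⟩
  set η : ℝ → G := fun u => if u ≤ t then γ u else δ (s + (u - t)) with hη
  have e1 : ∀ u, u ≤ t → η u = γ u := fun u hu => if_pos hu
  have e2 : ∀ u, t ≤ u → η u = δ (s + (u - t)) := fun u hu => by
    rcases hu.eq_or_lt with h | h
    · rw [e1 u h.ge, ← h, sub_self, add_zero, hst]
    · exact if_neg h.not_ge
  have m1 : ∀ u ∈ Icc p t, u ∈ Icc p q := fun u hu => ⟨hu.1, hu.2.trans ht.2⟩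
  have m2 : ∀ u ∈ Icc t (t + (q' - s)), s + (u - t) ∈ Icc p' q' := fun u hu =>
    ⟨by linarith [hs.1, hu.1], by linarith [hu.2]⟩
  have hle : t ≤ t + (q' - s) := by linarith [hs.2]
  refine ⟨p, t + (q' - s), η, ht.1.trans hle, ?_, ?_, ?_, ?_, ?_⟩
  · rw [← Icc_union_Icc_eq_Icc ht.1 hle]
    refine ContinuousOn.union_of_isClosed ?_ ?_ isClosed_Icc isClosed_Icc
    · exact (hc.mono m1).congr fun u hu => e1 u hu.2
    · exact (hc'.comp (f := fun u => s + (u - t)) (by fun_prop) m2).congr fun u hu => e2 u hu.1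
  · have key : ∀ u ∈ Icc p (t + (q' - s)), ∀ v ∈ Icc p (t + (q' - s)), u ≤ v → η u = η v →
        u = v := by
      intro u hu v hv huv he
      rcases le_or_gt v t with hv' | hv'
      · rw [e1 u (huv.trans hv'), e1 v hv'] at he
        exact hi (m1 u ⟨hu.1, huv.trans hv'⟩) (m1 v ⟨hv.1, hv'⟩) he
      · rcases lt_or_ge u t with hu' | hu'
        · rw [e1 u hu'.le, e2 v hv'.le] at he
          have := hmin ⟨m1 u ⟨hu.1, hu'.le⟩, _, m2 v ⟨hv'.le, hv.2⟩, he.symm⟩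
          linarith
        · rw [e2 u hu', e2 v hv'.le] at he
          have := hi' (m2 u ⟨hu', hu.2⟩) (m2 v ⟨hv'.le, hv.2⟩) he
          linarith
    intro u hu v hv he
    rcases le_total u v with h | h
    · exact key u hu v hv h he
    · exact (key v hv u hu h he.symm).symm
  · rw [e1 p ht.1, h1]
  · rw [e2 _ hle, ← h2']; congr 1; ring
  · intro u hu
    rcases le_total u t with h | h
    · rw [e1 u h]; exact hm (m1 u ⟨hu.1, h⟩)
    · rw [e2 u h]; exact hm' (m2 u ⟨h, hu.2⟩)

omit [MetricSpace G] in
theorem unitInterval [TopologicalSpace G] (h : ArcIn S a b) (hab : a ≠ b) :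
    ∃ γ : ℝ → G, ContinuousOn γ (Icc 0 1) ∧ InjOn γ (Icc 0 1) ∧ γ 0 = a ∧ γ 1 = b ∧
      MapsTo γ (Icc 0 1) S := by
  obtain ⟨p, q, γ, hpq, hc, hi, h1, h2, hm⟩ := h
  have hlt : p < q := lt_of_le_of_ne hpq fun h => hab (by rw [← h1, ← h2, h])
  have hmaps : MapsTo (fun t => p + (q - p) * t) (Icc 0 1) (Icc p q) :=
    fun t ht => ⟨by nlinarith [ht.1], by nlinarith [ht.2]⟩
  refine ⟨fun t => γ (p + (q - p) * t), hc.comp (by fun_prop) hmaps, fun s hs t ht he => ?_,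
    by simpa using h1, by simpa using h2, fun t ht => hm (hmaps ht)⟩
  have := hi (hmaps hs) (hmaps ht) he
  have h2 : (q - p) * s = (q - p) * t := by simp only at this; linarith
  exact mul_left_cancel₀ (by linarith : q - p ≠ 0) h2

/-- A path inside an arc yields a subarc joining its endpoints inside its image. -/
theorem of_path_in_arc {A H : ℝ → G} {p q : ℝ} (hpq : p ≤ q) (hA : ContinuousOn A (Icc p q))
    (hH : ContinuousOn H (Icc 0 1)) (hi : InjOn H (Icc 0 1))
    (hAH : MapsTo A (Icc p q) (H '' Icc 0 1)) (hS : MapsTo A (Icc p q) S) :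
    ArcIn S (A p) (A q) := by
  set c : ℝ → ℝ := fun t => invFunOn H (Icc 0 1) (A t) with hc
  have hcm : ∀ t ∈ Icc p q, c t ∈ Icc (0 : ℝ) 1 := fun t ht => invFunOn_mem (hAH ht)
  have hce : ∀ t ∈ Icc p q, H (c t) = A t := fun t ht => invFunOn_eq (hAH ht)
  have hcc : ContinuousOn c (Icc p q) := by
    rw [continuousOn_iff_isClosed]
    intro K hK
    have hKc : IsCompact (K ∩ Icc (0 : ℝ) 1) := isCompact_Icc.inter_left hK
    refine ⟨Icc p q ∩ A ⁻¹' (H '' (K ∩ Icc 0 1)), hA.preimage_isClosed_of_isClosed isClosed_Icc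
      (hKc.image_of_continuousOn (hH.mono inter_subset_right)).isClosed, ?_⟩
    ext t
    constructor
    · rintro ⟨h1, h2⟩
      exact ⟨⟨h2, c t, ⟨h1, hcm t h2⟩, hce t h2⟩, h2⟩
    · rintro ⟨⟨-, s, ⟨h1, h2⟩, h3⟩, h4⟩
      refine ⟨?_, h4⟩
      have : c t = s := hi (hcm t h4) h2 ((hce t h4).trans h3.symm)
      rw [mem_preimage, this]; exact h1
  have hsub : uIcc (c p) (c q) ⊆ c '' Icc p q := by
    have := intermediate_value_uIcc (f := c) (a := p) (b := q) (by rwa [uIcc_of_le hpq])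
    rwa [uIcc_of_le hpq] at this
  have hms : ∀ s ∈ uIcc (c p) (c q), H s ∈ S := fun s hs => by
    obtain ⟨t, ht, rfl⟩ := hsub hs
    rw [hce t ht]; exact hS ht
  have hss : uIcc (c p) (c q) ⊆ Icc 0 1 :=
    uIcc_subset_Icc (hcm p ⟨le_rfl, hpq⟩) (hcm q ⟨hpq, le_rfl⟩)
  have ep := hce p ⟨le_rfl, hpq⟩
  have eq := hce q ⟨hpq, le_rfl⟩
  rcases le_total (c p) (c q) with h | h
  · rw [uIcc_of_le h] at hms hss
    exact ⟨c p, c q, H, h, hH.mono hss, hi.mono hss, ep, eq, hms⟩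
  · rw [uIcc_of_ge h] at hms hss
    exact symm ⟨c q, c p, H, h, hH.mono hss, hi.mono hss, eq, ep, hms⟩

end ArcIn

section Edges

variable {G : Type*} [MetricSpace G]

theorem exists_tendsto_zero_of_mapClusterPt_mem_finite [CompactSpace G] {h : ℝ → G} {V : Set G}
    (hV : V.Finite) (hc : ContinuousOn h (Ioo 0 1))
    (hcl : ∀ z, MapClusterPt z (𝓝[>] 0) h → z ∈ V) :
    ∃ v ∈ V, Tendsto h (𝓝[>] 0) (𝓝 v) := by
  obtain ⟨z, -, hz⟩ := isCompact_univ.exists_mapClusterPt (f := 𝓝[>] (0 : ℝ)) (u := h) (by simp)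
  refine ⟨z, hcl z hz, tendsto_nhds_of_unique_mapClusterPt fun y hy => ?_⟩
  by_contra hne
  have hd : 0 < dist y z := dist_pos.2 hne
  obtain ⟨r, hr, hrV⟩ : ∃ r ∈ Ioo 0 (dist y z), r ∉ (fun v => dist v z) '' V :=
    ((Ioo_infinite hd).sdiff (hV.image _)).nonempty
  have hfr : ∃ᶠ t in 𝓝[>] (0 : ℝ), h t ∈ sphere z r := by
    rw [frequently_iff]
    intro U hU
    obtain ⟨ε, hε, hεU⟩ := mem_nhdsGT_iff_exists_Ioo_subset.1 hU
    have hm : Ioo (0 : ℝ) (min ε 1) ∈ 𝓝[>] (0 : ℝ) :=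
      Ioo_mem_nhdsGT (lt_min hε one_pos)
    obtain ⟨t₁, ht₁, hd₁⟩ := (((mapClusterPt_iff_frequently.1 hz) _
      (ball_mem_nhds z hr.1)).and_eventually hm).exists
    obtain ⟨t₂, ht₂, hd₂⟩ := (((mapClusterPt_iff_frequently.1 hy) _
      ((isOpen_lt continuous_const (continuous_id.dist continuous_const)).mem_nhds
        (show r < dist y z from hr.2))).and_eventually hm).exists
    have hsub : Ioo (0 : ℝ) (min ε 1) ⊆ Ioo 0 1 := Ioo_subset_Ioo_right (min_le_right _ _)
    have hcont : ContinuousOn (fun t => dist (h t) z) (Ioo 0 (min ε 1)) :=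
      (continuous_id.dist continuous_const).comp_continuousOn (hc.mono hsub)
    obtain ⟨t, ht, he⟩ := isPreconnected_Ioo.intermediate_value hd₁ hd₂ hcont
      ⟨le_of_lt ht₁, le_of_lt ht₂⟩
    exact ⟨t, hεU (Ioo_subset_Ioo_right (min_le_left _ _) ht), he⟩
  obtain ⟨a, ha, hac⟩ := (isCompact_sphere z r).exists_mapClusterPt_of_frequently hfr
  exact hrV ⟨a, hcl a hac, ha⟩

end Edges

/-- A parametrized edge of a graph with vertex set `V`. -/
structure IsEdge {G : Type*} [MetricSpace G] (V : Set G) (H : ℝ → G) : Prop where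
  continuousOn : ContinuousOn H (Icc 0 1)
  injOn : InjOn H (Icc 0 1)
  zero_mem : H 0 ∈ V
  one_mem : H 1 ∈ V
  notMem : ∀ t ∈ Ioo (0 : ℝ) 1, H t ∉ V
  subset_of_isPreconnected : ∀ T : Set G, IsPreconnected T → T ⊆ Vᶜ →
    (T ∩ H '' Ioo 0 1).Nonempty → T ⊆ H '' Ioo 0 1

section Graph

variable {G : Type*} [MetricSpace G] {V : Set G}

set_option maxHeartbeats 1000000 in
theorem IsTopGraph.exists_isEdge (hG : IsTopGraph V) {x : G} (hx : x ∉ V) :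
    ∃ H : ℝ → G, IsEdge V H ∧ x ∈ H '' Ioo 0 1 := by
  classical
  have := hG.compact
  set e := connectedComponentIn Vᶜ x with he
  obtain ⟨φ⟩ := hG.component_openArc x hx
  have hxe : x ∈ e := mem_connectedComponentIn hx
  have heV : e ⊆ Vᶜ := connectedComponentIn_subset _ _
  have hpre : IsPreconnected e := isPreconnected_connectedComponentIn
  have hclos : closure e ∩ Vᶜ ⊆ e := fun z hz =>
    (hpre.subset_closure (subset_inter subset_closure heV) inter_subset_left).subset_connectedComponentIn
      ⟨subset_closure hxe, hx⟩ inter_subset_right hz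
  set h : ℝ → G := fun t => if ht : t ∈ Ioo (0 : ℝ) 1 then (φ.symm ⟨t, ht⟩ : G) else x with hh
  have hval : ∀ t (ht : t ∈ Ioo (0 : ℝ) 1), h t = (φ.symm ⟨t, ht⟩ : G) := fun t ht => dif_pos ht
  have hmem : ∀ t ∈ Ioo (0 : ℝ) 1, h t ∈ e := fun t ht => by rw [hval t ht]; exact Subtype.prop _
  have hcont : ContinuousOn h (Ioo 0 1) := by
    rw [continuousOn_iff_continuous_domRestrict]
    have : (Ioo (0 : ℝ) 1).domRestrict h = fun t => (φ.symm t : G) := by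
      ext t; exact hval t.1 t.2
    rw [this]
    exact continuous_subtype_val.comp φ.symm.continuous
  have himg : h '' Ioo 0 1 = e := by
    apply Subset.antisymm
    · rintro _ ⟨t, ht, rfl⟩; exact hmem t ht
    · intro z hz
      refine ⟨φ ⟨z, hz⟩, (φ ⟨z, hz⟩).2, ?_⟩
      rw [hval _ (φ ⟨z, hz⟩).2]
      simp
  have hinj : InjOn h (Ioo 0 1) := by
    intro s hs t ht hst
    rw [hval s hs, hval t ht] at hst
    simpa using φ.symm.injective (Subtype.ext hst)
  have hcoord : ∀ s ∈ Ioo (0 : ℝ) 1, ∀ W ∈ 𝓝 s, ∃ U ∈ 𝓝 (h s), ∀ t ∈ Ioo (0 : ℝ) 1, h t ∈ U → t ∈ W := by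
    intro s hs W hW
    have hpre : (fun z : e => (φ z : ℝ)) ⁻¹' W ∈ 𝓝 (φ.symm ⟨s, hs⟩) := by
      refine (continuous_subtype_val.comp φ.continuous).continuousAt.preimage_mem_nhds ?_
      simpa using hW
    rw [mem_nhds_subtype] at hpre
    obtain ⟨U, hU, hUW⟩ := hpre
    refine ⟨U, by rwa [hval s hs], fun t ht htU => ?_⟩
    have : φ.symm ⟨t, ht⟩ ∈ (Subtype.val ⁻¹' U : Set e) := by
      rw [hval t ht] at htU; exact htU
    simpa using hUW this
  have hclust : ∀ a ∈ ({0, 1} : Set ℝ), ∀ z, MapClusterPt z (𝓝 a ⊓ 𝓟 (Ioo 0 1)) h → z ∈ V := by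
    intro a ha z hz
    by_contra hzV
    have hze : z ∈ e := by
      refine hclos ⟨mem_closure_iff_nhds.2 fun U hU => ?_, hzV⟩
      obtain ⟨t, htU, ht⟩ := ((mapClusterPt_iff_frequently.1 hz U hU).and_eventually
        (mem_inf_of_right (mem_principal_self _))).exists
      exact ⟨_, htU, hmem t ht⟩
    rw [← himg] at hze
    obtain ⟨s, hs, rfl⟩ := hze
    have hsa : s ≠ a := by
      rintro rfl
      rcases ha with rfl | rfl <;> simp at hs
    obtain ⟨W, W', hWo, hWo', hsW, haW', hdis⟩ := t2_separation hsa
    obtain ⟨U, hU, hUW⟩ := hcoord s hs W (hWo.mem_nhds hsW)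
    obtain ⟨t, htU, ht, ht'⟩ := ((mapClusterPt_iff_frequently.1 hz U hU).and_eventually
        ((show ∀ᶠ t in 𝓝 a ⊓ 𝓟 (Ioo (0 : ℝ) 1), t ∈ Ioo (0 : ℝ) 1 from
          mem_inf_of_right (mem_principal_self _)).and
          (mem_inf_of_left (hWo'.mem_nhds haW')))).exists
    exact disjoint_left.1 hdis (hUW t ht htU) ht'
  have e0 : 𝓝 (0 : ℝ) ⊓ 𝓟 (Ioo 0 1) = 𝓝[>] 0 := nhdsWithin_Ioo_eq_nhdsGT one_pos
  have e1 : 𝓝 (1 : ℝ) ⊓ 𝓟 (Ioo 0 1) = 𝓝[<] 1 := nhdsWithin_Ioo_eq_nhdsLT one_pos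
  have hmap : MapsTo (fun t : ℝ => 1 - t) (Ioo 0 1) (Ioo 0 1) := fun t ht =>
    ⟨by linarith [ht.2], by linarith [ht.1]⟩
  have htt : Tendsto (fun t : ℝ => 1 - t) (𝓝[>] 0) (𝓝[<] 1) := by
    rw [← e0, ← e1]
    refine tendsto_inf.2 ⟨?_, ?_⟩
    · refine Tendsto.mono_left ?_ inf_le_left
      have : Continuous fun t : ℝ => 1 - t := by fun_prop
      simpa using this.tendsto 0
    · exact tendsto_inf_right (tendsto_principal_principal.2 hmap)
  have htt' : Tendsto (fun t : ℝ => 1 - t) (𝓝[<] 1) (𝓝[>] 0) := by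
    rw [← e0, ← e1]
    refine tendsto_inf.2 ⟨?_, ?_⟩
    · refine Tendsto.mono_left ?_ inf_le_left
      have : Continuous fun t : ℝ => 1 - t := by fun_prop
      simpa using this.tendsto 1
    · exact tendsto_inf_right (tendsto_principal_principal.2 hmap)
  obtain ⟨v, hv, hlim⟩ := exists_tendsto_zero_of_mapClusterPt_mem_finite hG.finite_vertexSet hcont
    (fun z hz => hclust 0 (by simp) z (by rwa [e0]))
  obtain ⟨w, hw, hlim'⟩ := exists_tendsto_zero_of_mapClusterPt_mem_finite (h := fun t => h (1 - t))
    hG.finite_vertexSet (hcont.comp (by fun_prop) hmap) (fun z hz => hclust 1 (by simp) z (by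
      rw [e1]; exact MapClusterPt.of_comp htt hz))
  have hlim1 : Tendsto h (𝓝[<] 1) (𝓝 w) := by
    simpa [comp_def] using hlim'.comp htt'
  set H := extendFrom (Ioo (0 : ℝ) 1) h with hH
  have hHc : ContinuousOn H (Icc 0 1) :=
    continuousOn_Icc_extendFrom_Ioo hcont hlim hlim1
  have hH0 : H 0 = v := eq_lim_at_left_extendFrom_Ioo one_pos hlim
  have hH1 : H 1 = w := eq_lim_at_right_extendFrom_Ioo one_pos hlim1
  have hHe : ∀ t ∈ Ioo (0 : ℝ) 1, H t = h t := fun t ht =>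
    extendFrom_extends hcont t ht
  have hHimg : H '' Ioo 0 1 = e := by rw [← himg]; exact image_congr hHe
  have hnV : ∀ t ∈ Ioo (0 : ℝ) 1, H t ∉ V := fun t ht => by
    rw [hHe t ht]; exact heV (hmem t ht)
  have hIco : InjOn H (Ico 0 1) := by
    intro s hs t ht hst
    rcases hs.1.eq_or_lt with rfl | hs0 <;> rcases ht.1.eq_or_lt with rfl | ht0
    · rfl
    · exact absurd (hst ▸ hH0 ▸ hv) (hnV t ⟨ht0, ht.2⟩)
    · exact absurd (hst.symm ▸ hH0 ▸ hv) (hnV s ⟨hs0, hs.2⟩)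
    · rw [hHe s ⟨hs0, hs.2⟩, hHe t ⟨ht0, ht.2⟩] at hst
      exact hinj ⟨hs0, hs.2⟩ ⟨ht0, ht.2⟩ hst
  have h01 : H 0 ≠ H 1 := by
    intro h01
    have hcirc := hG.circle_vertices _ (isCircle_of_loop hHc h01 hIco)
    have hsub : H '' Icc 0 1 ∩ V ⊆ {H 0} := by
      rintro _ ⟨⟨t, ht, rfl⟩, htV⟩
      rcases ht.1.eq_or_lt with rfl | ht0
      · rfl
      rcases ht.2.eq_or_lt with rfl | ht1
      · exact h01.symm
      · exact absurd htV (hnV t ⟨ht0, ht1⟩)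
    have := ncard_le_ncard hsub (finite_singleton _)
    rw [ncard_singleton] at this
    omega
  refine ⟨H, ⟨hHc, ?_, hH0 ▸ hv, hH1 ▸ hw, hnV, ?_⟩, hHimg ▸ hxe⟩
  · intro s hs t ht hst
    rcases hs.2.eq_or_lt with rfl | hs1 <;> rcases ht.2.eq_or_lt with rfl | ht1
    · rfl
    · rcases ht.1.eq_or_lt with rfl | ht0
      · exact absurd hst.symm h01
      · exact absurd (hst ▸ hH1 ▸ hw) (hnV t ⟨ht0, ht1⟩)
    · rcases hs.1.eq_or_lt with rfl | hs0
      · exact absurd hst h01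
      · exact absurd (hst.symm ▸ hH1 ▸ hw) (hnV s ⟨hs0, hs1⟩)
    · exact hIco ⟨hs.1, hs1⟩ ⟨ht.1, ht1⟩ hst
  · rintro T hT hTV ⟨z, hzT, hze⟩
    rw [hHimg] at hze ⊢
    rw [he, connectedComponentIn_eq hze]
    exact hT.subset_connectedComponentIn hzT hTV

end Graph

namespace IsEdge

variable {G : Type*} [MetricSpace G] {V : Set G} {H H' : ℝ → G}

theorem mem_iff (hH : IsEdge V H) {t : ℝ} (ht : t ∈ Icc (0 : ℝ) 1) :
    H t ∈ V ↔ t = 0 ∨ t = 1 := by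
  constructor
  · intro h
    by_contra! hne
    exact hH.notMem t ⟨lt_of_le_of_ne ht.1 hne.1.symm, lt_of_le_of_ne ht.2 hne.2⟩ h
  · rintro (rfl | rfl)
    exacts [hH.zero_mem, hH.one_mem]

theorem image_inter_subset (hH : IsEdge V H) : H '' Icc 0 1 ∩ V ⊆ {H 0, H 1} := by
  rintro _ ⟨⟨t, ht, rfl⟩, htV⟩
  rcases (hH.mem_iff ht).1 htV with rfl | rfl <;> simp

theorem image_subset_compl (hH : IsEdge V H) : H '' Ioo 0 1 ⊆ Vᶜ := by
  rintro _ ⟨t, ht, rfl⟩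
  exact hH.notMem t ht

theorem isPreconnected_image (hH : IsEdge V H) : IsPreconnected (H '' Ioo 0 1) :=
  isPreconnected_Ioo.image H (hH.continuousOn.mono Ioo_subset_Icc_self)

theorem image_eq_of_inter_nonempty (hH : IsEdge V H) (hH' : IsEdge V H')
    (h : (H '' Ioo 0 1 ∩ H' '' Ioo 0 1).Nonempty) : H '' Ioo 0 1 = H' '' Ioo 0 1 :=
  Subset.antisymm (hH'.subset_of_isPreconnected _ hH.isPreconnected_image hH.image_subset_compl h)
    (hH.subset_of_isPreconnected _ hH'.isPreconnected_image hH'.image_subset_compl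
      (by rwa [inter_comm]))

theorem isClosed_image (hH : IsEdge V H) : IsClosed (H '' Icc 0 1) :=
  (isCompact_Icc.image_of_continuousOn hH.continuousOn).isClosed

theorem image_eq_of_ends_eq (hG : IsTopGraph V) (hH : IsEdge V H) (hH' : IsEdge V H')
    (h0 : H 0 = H' 0) (h1 : H 1 = H' 1) : H '' Ioo 0 1 = H' '' Ioo 0 1 := by
  by_contra hne
  have hdis : ∀ s ∈ Ioo (0 : ℝ) 1, ∀ t ∈ Ioo (0 : ℝ) 1, H s ≠ H' t := fun s hs t ht he =>
    hne (hH.image_eq_of_inter_nonempty hH' ⟨H s, mem_image_of_mem _ hs, he ▸ mem_image_of_mem _ ht⟩)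
  have hmaps : MapsTo (fun t : ℝ => 1 - t) (Icc 0 1) (Icc 0 1) :=
    fun t ht => ⟨by linarith [ht.2], by linarith [ht.1]⟩
  have hmaps' : ∀ t ∈ Ioo (0 : ℝ) 1, 1 - t ∈ Ioo (0 : ℝ) 1 :=
    fun t ht => ⟨by linarith [ht.2], by linarith [ht.1]⟩
  have hcirc := isCircle_of_two_arcs (γ := H) (δ := fun t => H' (1 - t)) hH.continuousOn
    (hH'.continuousOn.comp (by fun_prop) hmaps) hH.injOn
    (hH'.injOn.comp (fun s _ t _ h => by simpa using h) hmaps) (by simpa using h1)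
    (by simpa using h0.symm) (by
      intro s hs t ht he
      by_cases hsV : H s ∈ V
      · exact hH'.notMem _ (hmaps' t ht) (he ▸ hsV)
      · rw [hH.mem_iff hs] at hsV
        push Not at hsV
        exact hdis s ⟨lt_of_le_of_ne hs.1 hsV.1.symm, lt_of_le_of_ne hs.2 hsV.2⟩ _ (hmaps' t ht) he)
  have h3 := hG.circle_vertices _ hcirc
  have hsub : (H '' Icc 0 1 ∪ (fun t => H' (1 - t)) '' Icc 0 1) ∩ V ⊆ {H 0, H 1} := by
    rintro _ ⟨⟨t, ht, rfl⟩ | ⟨t, ht, rfl⟩, htV⟩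
    · exact hH.image_inter_subset ⟨mem_image_of_mem _ ht, htV⟩
    · rw [h0, h1]
      exact hH'.image_inter_subset ⟨mem_image_of_mem _ (hmaps ht), htV⟩
  have := ncard_le_ncard hsub (by simp)
  have := ncard_insert_le (H 0) {H 1}
  rw [ncard_singleton] at this
  omega

end IsEdge

section Graph

variable {G : Type*} [MetricSpace G] {V : Set G}

theorem IsTopGraph.exists_finite_edges (hG : IsTopGraph V) :
    ∃ E : Set (ℝ → G), E.Finite ∧ (∀ H ∈ E, IsEdge V H) ∧
      ∀ x ∉ V, ∃ H ∈ E, x ∈ H '' Ioo 0 1 := by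
  classical
  let c : G × G → ℝ → G := fun p =>
    if h : ∃ H, IsEdge V H ∧ H 0 = p.1 ∧ H 1 = p.2 then h.choose else fun _ => p.1
  refine ⟨{H | IsEdge V H} ∩ c '' (V ×ˢ V), ?_, fun H hH => hH.1, fun x hx => ?_⟩
  · exact ((hG.finite_vertexSet.prod hG.finite_vertexSet).image c).subset inter_subset_right
  · obtain ⟨H, hH, hxH⟩ := hG.exists_isEdge hx
    have h : ∃ H', IsEdge V H' ∧ H' 0 = H 0 ∧ H' 1 = H 1 := ⟨H, hH, rfl, rfl⟩
    have hc : c (H 0, H 1) = h.choose := dif_pos h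
    obtain ⟨h1, h2, h3⟩ := h.choose_spec
    rw [← hc] at h1 h2 h3
    exact ⟨_, ⟨h1, mem_image_of_mem _ ⟨hH.zero_mem, hH.one_mem⟩⟩,
      IsEdge.image_eq_of_ends_eq hG h1 hH h2 h3 ▸ hxH⟩

theorem IsEdge.freeArc (hG : IsTopGraph V) {H : ℝ → G} (hH : IsEdge V H) : FreeArc H := by
  obtain ⟨E, hE, hEd, hcov⟩ := hG.exists_finite_edges
  refine ⟨hH.continuousOn, hH.injOn, ?_⟩
  have hcl : IsClosed (V ∪ ⋃ H' ∈ {H' ∈ E | Disjoint (H '' Ioo 0 1) (H' '' Ioo 0 1)},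
      H' '' Icc 0 1) :=
    hG.finite_vertexSet.isClosed.union
      ((hE.subset (sep_subset _ _)).isClosed_biUnion fun H' hH' => (hEd H' hH'.1).isClosed_image)
  convert hcl.isOpen_compl using 1
  ext x
  simp only [mem_compl_iff, mem_union, mem_iUnion, not_or, mem_ofPred_eq]
  constructor
  · rintro hx
    refine ⟨hH.image_subset_compl hx, ?_⟩
    rintro ⟨H', ⟨hH', hd⟩, t, ht, rfl⟩
    by_cases htV : H' t ∈ V
    · exact hH.image_subset_compl hx htV
    · rw [(hEd H' hH').mem_iff ht] at htV
      push Not at htV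
      exact disjoint_left.1 hd hx ⟨t, ⟨lt_of_le_of_ne ht.1 htV.1.symm, lt_of_le_of_ne ht.2 htV.2⟩, rfl⟩
  · rintro ⟨hxV, hx⟩
    obtain ⟨H', hH', hxH'⟩ := hcov x hxV
    by_cases hd : Disjoint (H '' Ioo 0 1) (H' '' Ioo 0 1)
    · exact absurd ⟨H', ⟨hH', hd⟩, image_mono Ioo_subset_Icc_self hxH'⟩ hx
    · rw [hH.image_eq_of_inter_nonempty (hEd H' hH') (not_disjoint_iff_nonempty_inter.1 hd)]
      exact hxH'

end Graph

section PathToArc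

variable {G : Type*} [MetricSpace G] {V S : Set G}

theorem IsTopGraph.exists_edge_of_isPreconnected (hG : IsTopGraph V) {T : Set G}
    (hT : IsPreconnected T) (hne : T.Nonempty) (hTV : T ⊆ Vᶜ) :
    ∃ H, IsEdge V H ∧ T ⊆ H '' Ioo 0 1 := by
  obtain ⟨x, hx⟩ := hne
  obtain ⟨H, hH, hxH⟩ := hG.exists_isEdge (hTV hx)
  exact ⟨H, hH, hH.subset_of_isPreconnected T hT hTV ⟨x, hx, hxH⟩⟩

theorem IsTopGraph.arcIn_of_vertex_eq_left (hG : IsTopGraph V) {A : ℝ → G} {p q : ℝ} (hpq : p ≤ q)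
    (hA : ContinuousOn A (Icc p q)) (hS : MapsTo A (Icc p q) S)
    (hV : ∀ t ∈ Icc p q, A t ∈ V → A t = A p) : ArcIn S (A p) (A q) := by
  by_cases hne : (Icc p q ∩ A ⁻¹' V).Nonempty
  · have hcomp : IsCompact (Icc p q ∩ A ⁻¹' V) :=
      isCompact_Icc.of_isClosed_subset
        (hA.preimage_isClosed_of_isClosed isClosed_Icc hG.finite_vertexSet.isClosed)
        inter_subset_left
    obtain ⟨σ, ⟨hσ, hσV⟩, hmax⟩ := hcomp.exists_isGreatest hne
    rw [← hV σ hσ hσV]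
    rcases hσ.2.eq_or_lt with h | h
    · rw [← h]
      exact ArcIn.refl (hS hσ)
    have hsub : Icc σ q ⊆ Icc p q := Icc_subset_Icc_left hσ.1
    have hT : A '' Ioc σ q ⊆ Vᶜ := by
      rintro _ ⟨t, ht, rfl⟩ htV
      exact (hmax ⟨hsub (Ioc_subset_Icc_self ht), htV⟩).not_gt ht.1
    obtain ⟨H, hH, hTH⟩ := hG.exists_edge_of_isPreconnected
      (isPreconnected_Ioc.image A (hA.mono (Ioc_subset_Icc_self.trans hsub)))
      ((nonempty_Ioc.2 h).image A) hT
    refine ArcIn.of_path_in_arc h.le (hA.mono hsub) hH.continuousOn hH.injOn ?_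
      (hS.mono_left hsub)
    have hcl : IsClosed (Icc σ q ∩ A ⁻¹' (H '' Icc 0 1)) :=
      (hA.mono hsub).preimage_isClosed_of_isClosed isClosed_Icc hH.isClosed_image
    have : closure (Ioc σ q) ⊆ Icc σ q ∩ A ⁻¹' (H '' Icc 0 1) :=
      closure_minimal (fun t ht => ⟨Ioc_subset_Icc_self ht,
        image_mono Ioo_subset_Icc_self (hTH (mem_image_of_mem A ht))⟩) hcl
    rw [closure_Ioc h.ne] at this
    exact fun t ht => (this ht).2
  · have hT : A '' Icc p q ⊆ Vᶜ := by
      rintro _ ⟨t, ht, rfl⟩ htV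
      exact hne ⟨t, ht, htV⟩
    obtain ⟨H, hH, hTH⟩ := hG.exists_edge_of_isPreconnected (isPreconnected_Icc.image A hA)
      ((nonempty_Icc.2 hpq).image A) hT
    exact ArcIn.of_path_in_arc hpq hA hH.continuousOn hH.injOn
      (fun t ht => image_mono Ioo_subset_Icc_self (hTH (mem_image_of_mem A ht))) hS

theorem IsTopGraph.arcIn_of_joinedIn (hG : IsTopGraph V) {a b : G} (h : JoinedIn S a b) :
    ArcIn S a b := by
  obtain ⟨γ, hγ⟩ := h
  set A : ℝ → G := fun t => γ.extend t with hA
  have hAc : Continuous A := γ.extend.continuous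
  have hAS : ∀ t, A t ∈ S := fun t => hγ _
  have hloc : ∀ τ₀, ∀ᶠ τ in 𝓝 τ₀, ArcIn S (A τ₀) (A τ) := by
    intro τ₀
    have hU : (V \ {A τ₀})ᶜ ∈ 𝓝 (A τ₀) :=
      (hG.finite_vertexSet.subset sdiff_subset).isClosed.isOpen_compl.mem_nhds (by simp)
    obtain ⟨ε, hε, hball⟩ := Metric.mem_nhds_iff.1 (hAc.continuousAt.preimage_mem_nhds hU)
    have hV : ∀ t ∈ ball τ₀ ε, A t ∈ V → A t = A τ₀ := fun t ht htV => by
      by_contra hne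
      exact hball ht ⟨htV, hne⟩
    have hconv := (convex_ball τ₀ ε).ordConnected
    filter_upwards [ball_mem_nhds τ₀ hε] with τ hτ
    rcases le_total τ₀ τ with hle | hle
    · exact hG.arcIn_of_vertex_eq_left hle hAc.continuousOn (fun t _ => hAS t)
        fun t ht => hV t (hconv.out (mem_ball_self hε) hτ ht)
    · have := hG.arcIn_of_vertex_eq_left (S := S) (A := fun t => A (-t)) (neg_le_neg hle)
        (hAc.comp continuous_neg).continuousOn (fun t _ => hAS _)
        fun t ht htV => by
          simpa using hV (-t) (hconv.out hτ (mem_ball_self hε)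
            ⟨by linarith [ht.2], by linarith [ht.1]⟩) htV
      simpa using this
  have := isPreconnected_univ.iff_of_eventually (p := fun τ => ArcIn S (A 0) (A τ))
    (fun τ₀ _ => ?_) (mem_univ (0 : ℝ)) (mem_univ (1 : ℝ))
  · have h1 := this.1 (ArcIn.refl (hAS 0))
    simpa [hA] using h1
  · filter_upwards [hloc τ₀] with τ hτ
    exact ⟨fun h => h.trans hτ.symm, fun h => h.trans hτ⟩

end PathToArc

section Separation

variable {G : Type*} [MetricSpace G] {V S : Set G}

theorem FreeArc.subset_of_isPreconnected {H : ℝ → G} (hH : FreeArc H) {a b : ℝ} (ha : 0 ≤ a)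
    (hb : b ≤ 1) (hS : IsPreconnected S) (haS : H a ∉ S) (hbS : H b ∉ S)
    (hne : (S ∩ H '' Ioo a b).Nonempty) : S ⊆ H '' Ioo a b := by
  have hcl : IsClosed (H '' Icc a b) := (isCompact_Icc.image_of_continuousOn
    (hH.continuousOn.mono (Icc_subset_Icc ha hb))).isClosed
  refine hS.subset_left_of_subset_union
    (hH.isOpen_image isOpen_Ioo (Ioo_subset_Ioo ha hb)) hcl.isOpen_compl
    (disjoint_compl_right_iff_subset.2 (image_mono Ioo_subset_Icc_self)) (fun x hx => ?_) hne
  by_cases hxc : x ∈ H '' Icc a b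
  · obtain ⟨t, ht, rfl⟩ := hxc
    refine Or.inl ⟨t, ⟨lt_of_le_of_ne ht.1 ?_, lt_of_le_of_ne ht.2 ?_⟩, rfl⟩
    · rintro rfl; exact haS hx
    · rintro rfl; exact hbS hx
  · exact Or.inr hxc

theorem FreeArc.finite_closure_diff {H : ℝ → G} (hH : FreeArc H) (hS : IsPreconnected S) :
    {t ∈ Ioo (0 : ℝ) 1 | H t ∈ closure S \ S}.Finite := by
  by_contra hinf
  obtain ⟨s, hs, hc⟩ := Set.Infinite.exists_subset_card_eq hinf 3
  have hmem : ∀ i, s.orderEmbOfFin hc i ∈ {t ∈ Ioo (0 : ℝ) 1 | H t ∈ closure S \ S} :=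
    fun i => hs (s.orderEmbOfFin_mem hc i)
  have h01 : s.orderEmbOfFin hc 0 < s.orderEmbOfFin hc 1 := by simp
  have h12 : s.orderEmbOfFin hc 1 < s.orderEmbOfFin hc 2 := by
    rw [OrderEmbedding.lt_iff_lt]; decide
  obtain ⟨ha, haS⟩ := hmem 0
  obtain ⟨hb, hbS⟩ := hmem 1
  obtain ⟨hd, hdS⟩ := hmem 2
  generalize s.orderEmbOfFin hc 0 = a at *
  generalize s.orderEmbOfFin hc 1 = b at *
  generalize s.orderEmbOfFin hc 2 = d at *
  have hclos : ∀ u v : ℝ, 0 ≤ u → v ≤ 1 → S ⊆ H '' Ioo u v → closure S ⊆ H '' Icc u v :=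
    fun u v hu hv h => closure_minimal (h.trans (image_mono Ioo_subset_Icc_self))
      (isCompact_Icc.image_of_continuousOn
        (hH.continuousOn.mono (Icc_subset_Icc hu hv))).isClosed
  have hno : ∀ u v w : ℝ, 0 ≤ u → v ≤ 1 → w ∈ Icc (0 : ℝ) 1 → H w ∈ closure S →
      S ⊆ H '' Ioo u v → w ∈ Icc u v := by
    intro u v w hu hv hw hwS h
    obtain ⟨x, hx, hxw⟩ := hclos u v hu hv h hwS
    rwa [← hH.injOn ⟨hu.trans hx.1, hx.2.trans hv⟩ hw hxw]
  obtain ⟨y, ⟨u, hu, rfl⟩, hyS⟩ := mem_closure_iff.1 hbS.1 (H '' Ioo a d)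
    (hH.isOpen_image isOpen_Ioo (Ioo_subset_Ioo ha.1.le hd.2.le)) ⟨b, ⟨h01, h12⟩, rfl⟩
  rcases lt_trichotomy u b with h | h | h
  · have := hH.subset_of_isPreconnected ha.1.le hb.2.le hS haS.2 hbS.2 ⟨H u, hyS, u, ⟨hu.1, h⟩, rfl⟩
    exact (hno _ _ d ha.1.le hb.2.le (Ioo_subset_Icc_self hd) hdS.1 this).2.not_gt h12
  · exact hbS.2 (h ▸ hyS)
  · have := hH.subset_of_isPreconnected hb.1.le hd.2.le hS hbS.2 hdS.2 ⟨H u, hyS, u, ⟨h, hu.2⟩, rfl⟩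
    exact (hno _ _ a hb.1.le hd.2.le (Ioo_subset_Icc_self ha) haS.1 this).1.not_gt h01

theorem IsTopGraph.finite_closure_diff (hG : IsTopGraph V) (hS : IsPreconnected S) :
    (closure S \ S).Finite := by
  obtain ⟨E, hE, hEd, hcov⟩ := hG.exists_finite_edges
  refine (hG.finite_vertexSet.union (hE.biUnion fun H hH =>
    (((hEd H hH).freeArc hG).finite_closure_diff hS).image H)).subset fun x hx => ?_
  by_cases hxV : x ∈ V
  · exact Or.inl hxV
  · obtain ⟨H, hH, t, ht, rfl⟩ := hcov x hxV
    exact Or.inr (mem_biUnion hH ⟨t, ⟨ht, hx⟩, rfl⟩)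

end Separation

section Orbits

variable {G : Type*} {f : G → G} {J : Set G}

theorem image_setOrbit_subset : f '' setOrbit f J ⊆ setOrbit f J := by
  rintro _ ⟨x, hx, rfl⟩
  obtain ⟨i, y, hy, rfl⟩ := mem_iUnion.1 hx
  exact mem_iUnion.2 ⟨i + 1, y, hy, iterate_succ_apply' f i y⟩

theorem subset_setOrbit : J ⊆ setOrbit f J := fun x hx => mem_iUnion.2 ⟨0, x, hx, rfl⟩

/-- The union of the images of `J` under the iterates `r, r + k, r + 2k, …`. -/
def residueOrbit (f : G → G) (J : Set G) (k r : ℕ) : Set G := ⋃ i : ℕ, f^[r + i * k] '' J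

theorem residueOrbit_subset {k r : ℕ} : residueOrbit f J k r ⊆ setOrbit f J :=
  iUnion_subset fun i => subset_iUnion (fun n : ℕ => f^[n] '' J) (r + i * k)

theorem setOrbit_subset_iUnion {k : ℕ} (hk : 0 < k) :
    setOrbit f J ⊆ ⋃ r ∈ Finset.range k, residueOrbit f J k r := by
  refine iUnion_subset fun n x hx => ?_
  refine mem_biUnion (Finset.mem_coe.2 (Finset.mem_range.2 (Nat.mod_lt n hk))) ?_
  refine mem_iUnion.2 ⟨n / k, ?_⟩
  rwa [mul_comm, Nat.mod_add_div]

variable [MetricSpace G] {V : Set G}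

theorem isPreconnected_residueOrbit (hf : Continuous f) (hJ : IsPreconnected J) {k : ℕ}
    (hne : (f^[k] '' J ∩ J).Nonempty) (r : ℕ) : IsPreconnected (residueOrbit f J k r) := by
  refine IsPreconnected.iUnion_of_chain
    (fun i => hJ.image _ (hf.iterate _).continuousOn) fun i => ?_
  obtain ⟨_, ⟨y, hy, rfl⟩, hx⟩ := hne
  refine ⟨f^[r + i * k] (f^[k] y), mem_image_of_mem _ hx, y, hy, ?_⟩
  rw [← iterate_add_apply, Order.succ_eq_add_one,
    show r + (i + 1) * k = r + i * k + k by ring]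

theorem IsTopGraph.finite_closure_setOrbit_diff (hG : IsTopGraph V) (hf : Continuous f)
    (hJ : IsPreconnected J) {k : ℕ} (hk : 0 < k) (hne : (f^[k] '' J ∩ J).Nonempty) :
    (closure (setOrbit f J) \ setOrbit f J).Finite := by
  refine ((Finset.range k).finite_toSet.biUnion fun r _ =>
    hG.finite_closure_diff (isPreconnected_residueOrbit hf hJ hne r)).subset ?_
  rintro x ⟨hx, hxn⟩
  have := closure_mono (setOrbit_subset_iUnion hk) hx
  rw [Finset.closure_biUnion] at this
  obtain ⟨r, hr, hxr⟩ := mem_iUnion₂.1 this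
  exact mem_biUnion (Finset.mem_coe.2 hr) ⟨hxr, fun h => hxn (residueOrbit_subset h)⟩

end Orbits

section Saturation

variable {G : Type*} [MetricSpace G] {V : Set G} {f : G → G} {j : ℝ → G} {t₀ : ℝ}

omit [MetricSpace G] in
theorem PFree.of_notMem_periodicPts (h : ∀ t ∈ Ioo (0 : ℝ) 1, j t ∉ periodicPts f) : PFree j f :=
  fun t ht _ hm he => h t ht (mk_mem_periodicPts hm he)

omit [MetricSpace G] in
theorem PFree.notMem_periodicPts (h : PFree j f) {t : ℝ} (ht : t ∈ Ioo (0 : ℝ) 1) :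
    j t ∉ periodicPts f := by
  rintro ⟨m, hm, he⟩
  exact h t ht m hm he

namespace FreeArc

theorem mem_omegaSet_of_mem_setOrbit (hj : FreeArc j) (hf : Continuous f) (hP : PFree j f)
    (ht₀ : t₀ ∈ Ioo (0 : ℝ) 1) (hr : j t₀ ∈ omegaSet f (j t₀)) {w : G}
    (hw : w ∈ setOrbit f (j '' Ioo 0 1)) : j t₀ ∈ omegaSet f w := by
  obtain ⟨n, _, ⟨s, hs, rfl⟩, rfl⟩ := mem_iUnion.1 hw
  rw [omegaSet_iterate_apply]
  exact hj.mem_omegaSet_of_recurrent hf hP ht₀ hr hs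

theorem notMem_evPeriodicPts_of_mem_setOrbit (hj : FreeArc j) (hf : Continuous f) (hP : PFree j f)
    (ht₀ : t₀ ∈ Ioo (0 : ℝ) 1) (hr : j t₀ ∈ omegaSet f (j t₀)) {w : G}
    (hw : w ∈ setOrbit f (j '' Ioo 0 1)) : w ∉ evPeriodicPts f := fun hwE =>
  hP.notMem_periodicPts ht₀ (periodic_of_recurrent_of_mem_omegaSet_evPeriodic hr hwE
    (hj.mem_omegaSet_of_mem_setOrbit hf hP ht₀ hr hw))

theorem exists_iterate_image_inter (hj : FreeArc j) (ht₀ : t₀ ∈ Ioo (0 : ℝ) 1)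
    (hr : j t₀ ∈ omegaSet f (j t₀)) :
    ∃ k > 0, (f^[k] '' (j '' Ioo 0 1) ∩ j '' Ioo 0 1).Nonempty := by
  obtain ⟨n, hn, y, hy, he⟩ := hj.exists_return ht₀ hr univ_mem 1
  exact ⟨n, hn, j y, ⟨j t₀, mem_image_of_mem _ ht₀, he⟩, mem_image_of_mem _ hy.2⟩

theorem isPreconnected_image (hj : FreeArc j) : IsPreconnected (j '' Ioo 0 1) :=
  isPreconnected_Ioo.image j (hj.continuousOn.mono Ioo_subset_Icc_self)

theorem false_of_recurrent_right {H : ℝ → G} {Y S : Set G} (hH : FreeArc H) (hf : Continuous f)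
    (hY : f '' Y ⊆ Y) (hYP : ∀ w ∈ Y, w ∉ periodicPts f) (hS : IsPreconnected S) (hSY : S ⊆ Y)
    {τ : ℝ} (hτ : 0 ≤ τ) (hτY : H τ ∉ Y)
    (h : ∀ u > τ, ∃ s ∈ Ioo τ u, s < 1 ∧ H s ∈ S ∧ H s ∈ omegaSet f (H s)) : False := by
  obtain ⟨s₀, hs₀, hs₀1, hs₀S, -⟩ := h (τ + 1) (by linarith)
  obtain ⟨s₁, hs₁, -, -, hs₁r⟩ := h s₀ hs₀.1
  have hIoo : ∀ s ∈ Ioo τ s₀, H s ∈ S := by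
    intro s hs
    by_contra hsS
    obtain ⟨s₂, hs₂, -, hs₂S, -⟩ := h s hs.1
    obtain ⟨u, hu, hus⟩ := hH.subset_of_isPreconnected hτ (hs.2.trans hs₀1).le hS
      (fun hh => hτY (hSY hh)) hsS ⟨_, hs₂S, mem_image_of_mem H hs₂⟩ hs₀S
    have := hH.injOn ⟨hτ.trans hu.1.le, (hu.2.trans (hs.2.trans hs₀1)).le⟩
      ⟨hτ.trans hs₀.1.le, hs₀1.le⟩ hus
    exact (hu.2.trans hs.2).ne this
  have hA := hH.affine hτ hs₀.1 hs₀1.le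
  have hdiv : 0 < s₀ - τ := sub_pos.2 hs₀.1
  have himg := FreeArc.image_affine_Ioo H hs₀.1
  have hAS : ∀ t ∈ Ioo (0 : ℝ) 1, H (τ + (s₀ - τ) * t) ∈ S := by
    intro t ht
    obtain ⟨u, hu, he⟩ := himg.subset (mem_image_of_mem _ ht)
    exact he ▸ hIoo u hu
  have hs₁' : τ + (s₀ - τ) * ((s₁ - τ) / (s₀ - τ)) = s₁ := by field_simp; ring
  obtain ⟨m, -, hm⟩ := hA.left_mem_image (t₀ := (s₁ - τ) / (s₀ - τ)) hf
    (PFree.of_notMem_periodicPts fun t ht => hYP _ (hSY (hAS t ht)))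
    ⟨div_pos (sub_pos.2 hs₁.1) hdiv, (div_lt_one hdiv).2 (by linarith [hs₁.2])⟩
    (by simp only [hs₁']; exact hs₁r)
  simp only [mul_zero, add_zero] at hm
  obtain ⟨_, ⟨t, ht, rfl⟩, he⟩ := hm
  exact hτY (he ▸ iterate_mem_of_image_subset hY (hSY (hAS t ht)) m)

theorem notMem_omegaSet_of_periodic (hG : IsTopGraph V) (hj : FreeArc j) (hf : Continuous f)
    (hP : PFree j f) (ht₀ : t₀ ∈ Ioo (0 : ℝ) 1) (hr : j t₀ ∈ omegaSet f (j t₀)) {p : G}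
    (hp : p ∈ periodicPts f) : p ∉ omegaSet f (j t₀) := by
  intro hpω
  set Y := setOrbit f (j '' Ioo 0 1) with hYdef
  have hYE : ∀ w ∈ Y, w ∉ evPeriodicPts f := fun w hw =>
    hj.notMem_evPeriodicPts_of_mem_setOrbit hf hP ht₀ hr hw
  have hYP : ∀ w ∈ Y, w ∉ periodicPts f := fun w hw h => hYE w hw (periodicPts_subset_evPeriodicPts h)
  have hpY : p ∉ Y := fun h => hYP p h hp
  have hyY : j t₀ ∈ Y := subset_setOrbit (mem_image_of_mem j ht₀)
  obtain ⟨k, hk, hne⟩ := hj.exists_iterate_image_inter ht₀ hr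
  obtain ⟨E, hE, hEd, hcov⟩ := hG.exists_finite_edges
  have hinj := iterate_injective_of_recurrent hr (hP.notMem_periodicPts ht₀)
  have hcl : MapClusterPt p atTop fun n => f^[n] (j t₀) := by
    rw [mapClusterPt_iff_frequently]
    intro U hU
    rw [frequently_atTop]
    exact fun N => mem_omegaSet_iff.1 hpω U hU N
  obtain ⟨𝓤, h𝓤, hlim⟩ := mapClusterPt_iff_ultrafilter.1 hcl
  have hV : ∀ᶠ n in (𝓤 : Filter ℕ), f^[n] (j t₀) ∉ V := by
    refine h𝓤 ?_
    rw [← Nat.cofinite_eq_atTop]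
    exact (hG.finite_vertexSet.preimage hinj.injOn).compl_mem_cofinite
  obtain ⟨H, hHE, hH𝓤⟩ := (Ultrafilter.eventually_exists_mem_iff hE).1
    (hV.mono fun n hn => hcov _ hn)
  obtain ⟨r, -, hr𝓤⟩ := (Ultrafilter.eventually_exists_mem_iff
    (f := 𝓤) (P := fun r n => f^[n] (j t₀) ∈ residueOrbit f (j '' Ioo 0 1) k r)
    (Finset.range k).finite_toSet).1 (Eventually.of_forall fun n => by
      obtain ⟨r, hr, h⟩ := mem_iUnion₂.1 (setOrbit_subset_iUnion hk
        (iterate_mem_of_image_subset image_setOrbit_subset hyY n))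
      exact ⟨r, hr, h⟩)
  have hHe := hEd H hHE
  have hHf := hHe.freeArc hG
  have hS := isPreconnected_residueOrbit hf hj.isPreconnected_image hne r
  set S := residueOrbit f (j '' Ioo 0 1) k r with hSdef
  set c : ℕ → ℝ := fun n => invFunOn H (Ioo 0 1) (f^[n] (j t₀)) with hc
  have hcm : ∀ᶠ n in (𝓤 : Filter ℕ), c n ∈ Ioo (0 : ℝ) 1 ∧ H (c n) = f^[n] (j t₀) :=
    hH𝓤.mono fun n hn => ⟨invFunOn_mem hn, invFunOn_eq hn⟩
  have hcI : Tendsto c 𝓤 (𝓟 (Icc 0 1)) :=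
    tendsto_principal.2 (hcm.mono fun n hn => Ioo_subset_Icc_self hn.1)
  obtain ⟨τ, hτ, hcτ⟩ := isCompact_Icc.ultrafilter_le_nhds (𝓤.map c) hcI
  have hcτ' : Tendsto c 𝓤 (𝓝 τ) := hcτ
  have hHτ : H τ = p := by
    refine tendsto_nhds_unique (((hHe.continuousOn τ hτ).tendsto.comp
      (tendsto_inf.2 ⟨hcτ', hcI⟩))) (hlim.congr' (hcm.mono fun n hn => hn.2.symm))
  have hall : ∀ᶠ n in (𝓤 : Filter ℕ), τ < c n ∨ c n < τ := by
    filter_upwards [hcm] with n hn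
    rcases lt_trichotomy τ (c n) with h | h | h
    · exact Or.inl h
    · refine absurd ?_ hpY
      rw [← hHτ, h, hn.2]
      exact iterate_mem_of_image_subset image_setOrbit_subset hyY n
    · exact Or.inr h
  rcases Ultrafilter.eventually_or.1 hall with hlt | hgt
  · refine false_of_recurrent_right hHf hf image_setOrbit_subset hYP hS residueOrbit_subset hτ.1
      (hHτ ▸ hpY) fun u hu => ?_
    obtain ⟨n, h1, h2, h3, h4⟩ := (hlt.and (hcm.and (hr𝓤.and (hcτ' (Iio_mem_nhds hu))))).exists
    refine ⟨c n, ⟨h1, h4⟩, h2.1.2, ?_⟩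
    rw [h2.2]
    exact ⟨h3, recurrent_iterate hf hr n⟩
  · refine false_of_recurrent_right hHf.reverse hf image_setOrbit_subset hYP hS
      residueOrbit_subset (τ := 1 - τ) (sub_nonneg.2 hτ.2) (by simpa [hHτ] using hpY) fun u hu => ?_
    obtain ⟨n, h1, h2, h3, h4⟩ := (hgt.and (hcm.and (hr𝓤.and
      (hcτ' (Ioi_mem_nhds (show 1 - u < τ by linarith)))))).exists
    have h4' : 1 - u < c n := h4
    refine ⟨1 - c n, ⟨by linarith, by linarith⟩, by linarith [h2.1.1], ?_⟩
    rw [sub_sub_cancel, h2.2]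
    exact ⟨h3, recurrent_iterate hf hr n⟩

theorem isMinimalSet_omegaSet (hG : IsTopGraph V) (hj : FreeArc j) (hf : Continuous f)
    (hP : PFree j f) (ht₀ : t₀ ∈ Ioo (0 : ℝ) 1) (hr : j t₀ ∈ omegaSet f (j t₀)) :
    IsMinimalSet f (omegaSet f (j t₀)) := by
  refine ⟨⟨_, hr⟩, isClosed_omegaSet, image_omegaSet_subset hf _, fun N hN hne hNc hNf => ?_⟩
  by_cases hNY : (N ∩ setOrbit f (j '' Ioo 0 1)).Nonempty
  · obtain ⟨z, hzN, hzY⟩ := hNY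
    have hy : j t₀ ∈ N := omegaSet_subset_of_closed hNc hNf hzN
      (hj.mem_omegaSet_of_mem_setOrbit hf hP ht₀ hr hzY)
    exact hN.antisymm (omegaSet_subset_of_closed hNc hNf hy)
  · obtain ⟨k, hk, hk'⟩ := hj.exists_iterate_image_inter ht₀ hr
    have hfin : N.Finite := by
      refine (hG.finite_closure_setOrbit_diff hf hj.isPreconnected_image hk hk').subset
        fun z hz => ⟨?_, fun hzY => hNY ⟨z, hz, hzY⟩⟩
      exact omegaSet_subset_of_closed isClosed_closure
        (closure_image_subset hf image_setOrbit_subset)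
        (subset_closure (subset_setOrbit (mem_image_of_mem j ht₀))) (hN hz)
    obtain ⟨p, hpN, hp⟩ := exists_periodic_of_finite hfin hne hNf
    exact absurd (hN hpN) (hj.notMem_omegaSet_of_periodic hG hf hP ht₀ hr hp)

theorem omegaSet_subset_compl_closure_evPeriodicPts (hG : IsTopGraph V) (hj : FreeArc j)
    (hf : Continuous f) (hP : PFree j f) (ht₀ : t₀ ∈ Ioo (0 : ℝ) 1)
    (hr : j t₀ ∈ omegaSet f (j t₀)) :
    omegaSet f (j t₀) ⊆ (closure (evPeriodicPts f))ᶜ := by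
  rw [subset_compl_iff_disjoint_right, disjoint_iff_inter_eq_empty, ← not_nonempty_iff_eq_empty]
  intro hne
  have hmin := hj.isMinimalSet_omegaSet hG hf hP ht₀ hr
  have := hmin.2.2.2 _ inter_subset_left hne (isClosed_omegaSet.inter isClosed_closure)
    ((image_inter_subset _ _ _).trans (inter_subset_inter (image_omegaSet_subset hf _)
      (closure_image_subset hf image_evPeriodicPts_subset)))
  have hy : j t₀ ∈ closure (evPeriodicPts f) := (this.symm.subset hr).2
  obtain ⟨z, hzJ, hzE⟩ := mem_closure_iff.1 hy _ (hj.isOpen_image isOpen_Ioo subset_rfl) (mem_image_of_mem j ht₀)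
  exact hj.notMem_evPeriodicPts_of_mem_setOrbit hf hP ht₀ hr (subset_setOrbit hzJ) hzE

theorem exists_isCircle_subset_setOrbit (hG : IsTopGraph V) (hj : FreeArc j) (hf : Continuous f)
    (hP : PFree j f) (ht₀ : t₀ ∈ Ioo (0 : ℝ) 1) (hr : j t₀ ∈ omegaSet f (j t₀)) :
    ∃ C, IsCircle C ∧ C ⊆ setOrbit f (j '' Ioo 0 1) := by
  obtain ⟨a, ha0, hat⟩ := exists_between ht₀.1
  obtain ⟨b, htb, hb1⟩ := exists_between ht₀.2
  have hab := hat.trans htb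
  have hdiv : 0 < b - a := sub_pos.2 hab
  have hi := hj.affine ha0.le hab hb1.le
  have hmem : ∀ t ∈ Icc (0 : ℝ) 1, a + (b - a) * t ∈ Ioo (0 : ℝ) 1 := fun t ht =>
    ⟨by nlinarith [ht.1], by nlinarith [ht.2]⟩
  have hPi : PFree (fun t => j (a + (b - a) * t)) f :=
    fun t ht => hP _ (hmem t (Ioo_subset_Icc_self ht))
  have ht' : a + (b - a) * ((t₀ - a) / (b - a)) = t₀ := by field_simp; ring
  have hjoin := hi.joinedIn_saturation (t₀ := (t₀ - a) / (b - a)) hf hPi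
    ⟨div_pos (sub_pos.2 hat) hdiv, (div_lt_one hdiv).2 (by linarith)⟩
    (by simp only [ht']; exact hr)
  set i : ℝ → G := fun t => j (a + (b - a) * t) with hidef
  change JoinedIn _ (i 1) (i 0) at hjoin
  change JoinedIn (_ ∪ {i 0, i 1}) _ _ at hjoin
  have hiJ : i '' Icc 0 1 ⊆ j '' Ioo 0 1 := by
    rintro _ ⟨t, ht, rfl⟩
    exact mem_image_of_mem j (hmem t ht)
  have h01 : i 1 ≠ i 0 := fun h => one_ne_zero (hi.injOn (by simp) (by simp) h)
  obtain ⟨δ, hδc, hδi, hδ0, hδ1, hδS⟩ := (hG.arcIn_of_joinedIn hjoin).unitInterval h01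
  refine ⟨_, isCircle_of_two_arcs hi.continuousOn hδc hi.injOn hδi hδ0.symm hδ1 ?_,
    union_subset (hiJ.trans subset_setOrbit) ?_⟩
  · intro s hs t ht he
    have htI := Ioo_subset_Icc_self ht
    have hs0 : s ≠ 0 := by
      rintro rfl
      rw [← hδ1] at he
      exact ht.2.ne' (hδi (by simp) htI he)
    have hs1 : s ≠ 1 := by
      rintro rfl
      rw [← hδ0] at he
      exact ht.1.ne (hδi (by simp) htI he)
    rcases hδS htI with h | h
    · exact h.2 ⟨s, ⟨lt_of_le_of_ne hs.1 hs0.symm, lt_of_le_of_ne hs.2 hs1⟩, he⟩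
    · rw [← he] at h
      rcases h with h | h
      · exact hs0 (hi.injOn hs (by simp) h)
      · exact hs1 (hi.injOn hs (by simp) h)
  · rintro _ ⟨t, ht, rfl⟩
    rcases hδS ht with h | h
    · obtain ⟨n, hn⟩ := mem_iUnion.1 h.1
      exact mem_iUnion.2 ⟨n, image_mono ((image_mono Ioo_subset_Icc_self).trans hiJ) hn⟩
    · rcases h with h | h <;> rw [h] <;>
        exact subset_setOrbit (hiJ (mem_image_of_mem i (by simp)))

end FreeArc

end Saturation

section Main

variable {G : Type*} [MetricSpace G] {V : Set G} {f : G → G}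

theorem IsTopGraph.exists_saturated_of_recurrent (hG : IsTopGraph V) (hf : Continuous f) {x : G}
    (hx : x ∈ recurrentPts f) (hxP : x ∉ closure (periodicPts f)) :
    IsMinimalSet f (omegaSet f x) ∧ omegaSet f x ⊆ (closure (evPeriodicPts f))ᶜ ∧
      ∃ Y C : Set G, IsCircle C ∧ C ⊆ Y ∧ f '' Y ⊆ Y ∧ (closure Y \ Y).Finite ∧
        ∀ w ∈ Y, omegaSet f x ⊆ omegaSet f w := by
  have hxr : x ∈ omegaSet f x := hx
  have hxp : x ∉ periodicPts f := fun h => hxP (subset_closure h)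
  have hinj := iterate_injective_of_recurrent hxr hxp
  obtain ⟨i, hi⟩ : ∃ i : ℕ, f^[i] x ∉ V := by
    by_contra! h
    exact infinite_range_of_injective hinj (hG.finite_vertexSet.subset (range_subset_iff.2 h))
  rw [← omegaSet_iterate_apply i x]
  have hyr := recurrent_iterate hf hxr i
  have hyP : f^[i] x ∉ closure (periodicPts f) := fun h => hxP <|
    omegaSet_subset_of_closed isClosed_closure (closure_image_subset hf image_periodicPts_subset) h
      (by rwa [omegaSet_iterate_apply])
  obtain ⟨H, hH, t, ht, hty⟩ := hG.exists_isEdge hi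
  rw [← hty] at hyr hyP ⊢
  have hHf := hH.freeArc hG
  have hU : H ⁻¹' (closure (periodicPts f))ᶜ ∩ Ioo 0 1 ∈ 𝓝 t :=
    inter_mem ((hHf.continuousAt ht).preimage_mem_nhds (isClosed_closure.isOpen_compl.mem_nhds hyP))
      (Ioo_mem_nhds ht.1 ht.2)
  obtain ⟨a, b, hab, hsub⟩ := mem_nhds_iff_exists_Ioo_subset.1 hU
  obtain ⟨a', haa', ha't⟩ := exists_between hab.1
  obtain ⟨b', htb', hbb'⟩ := exists_between hab.2
  have ha' := hsub ⟨haa', ha't.trans hab.2⟩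
  have hb' := hsub ⟨hab.1.trans htb', hbb'⟩
  have hab' := ha't.trans htb'
  have hdiv : 0 < b' - a' := sub_pos.2 hab'
  have hj := hHf.affine ha'.2.1.le hab' hb'.2.2.le
  have hP : PFree (fun s => H (a' + (b' - a') * s)) f :=
    PFree.of_notMem_periodicPts fun s hs h => (@hsub (a' + (b' - a') * s)
      ⟨by nlinarith [hs.1], by nlinarith [hs.2]⟩).1 (subset_closure h)
  have ht₀ : (t - a') / (b' - a') ∈ Ioo (0 : ℝ) 1 :=
    ⟨div_pos (sub_pos.2 ha't) hdiv, (div_lt_one hdiv).2 (by linarith)⟩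
  have he : H t = (fun s => H (a' + (b' - a') * s)) ((t - a') / (b' - a')) := by
    congr 1; field_simp; ring
  generalize (fun s => H (a' + (b' - a') * s)) = j at hj hP he
  generalize (t - a') / (b' - a') = t₀ at ht₀ he
  rw [he] at hyr ⊢
  obtain ⟨C, hC, hCY⟩ := hj.exists_isCircle_subset_setOrbit hG hf hP ht₀ hyr
  obtain ⟨k, hk, hne⟩ := hj.exists_iterate_image_inter ht₀ hyr
  exact ⟨hj.isMinimalSet_omegaSet hG hf hP ht₀ hyr,
    hj.omegaSet_subset_compl_closure_evPeriodicPts hG hf hP ht₀ hyr, _, C, hC, hCY,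
    image_setOrbit_subset, hG.finite_closure_setOrbit_diff hf hj.isPreconnected_image hk hne,
    fun w hw => omegaSet_subset_of_mem hf (hj.mem_omegaSet_of_mem_setOrbit hf hP ht₀ hyr hw)⟩

theorem omegaSet_infinite_of_recurrent (hf : Continuous f) {x : G} (hx : x ∈ omegaSet f x)
    (hxp : x ∉ periodicPts f) : (omegaSet f x).Infinite :=
  (infinite_range_of_injective (iterate_injective_of_recurrent hx hxp)).mono
    (range_subset_iff.2 fun n => iterate_mem_omegaSet_self hf hx n)

theorem IsMinimalSet.subset_recurrentPts [CompactSpace G] (hf : Continuous f) {M : Set G}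
    (hM : IsMinimalSet f M) : M ⊆ recurrentPts f := fun z hz => by
  have := hM.2.2.2 (omegaSet f z) (omegaSet_subset_of_closed hM.2.1 hM.2.2.1 hz)
    (omegaSet_nonempty z) isClosed_omegaSet (image_omegaSet_subset hf z)
  change z ∈ omegaSet f z
  rwa [this]

/-- If at most `m` sets with property `p` are pairwise disjoint, then a family whose members can be
assigned pairwise disjoint sets with property `p` has at most `m` elements. -/
theorem Set.finite_ncard_le_of_disjoint {G : Type*} {𝓜 : Set (Set G)} {m : ℕ} {p : Set G → Prop}
    (hm : ∀ (l : ℕ) (C : Fin l → Set G), (∀ i, p (C i)) →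
      (Pairwise fun i j => Disjoint (C i) (C j)) → l ≤ m)
    (h : ∃ C : Set G → Set G, (∀ M ∈ 𝓜, p (C M)) ∧ 𝓜.PairwiseDisjoint C) :
    𝓜.Finite ∧ 𝓜.ncard ≤ m := by
  obtain ⟨C, hC, hd⟩ := h
  have key : ∀ s : Finset (Set G), ↑s ⊆ 𝓜 → s.card ≤ m := fun s hs =>
    hm _ (fun i => C (s.equivFin.symm i)) (fun i => hC _ (hs (s.equivFin.symm i).2)) fun i j hij =>
      hd (hs (s.equivFin.symm i).2) (hs (s.equivFin.symm j).2)
        fun he => hij (s.equivFin.symm.injective (Subtype.ext he))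
  have hfin : 𝓜.Finite := by
    by_contra hinf
    obtain ⟨s, hs, hc⟩ := Set.Infinite.exists_subset_card_eq hinf (m + 1)
    have := key s hs
    omega
  refine ⟨hfin, ?_⟩
  rw [ncard_eq_toFinset_card _ hfin]
  exact key _ (by simp)

end Main

/-- `cl(R(f)) = cl(P(f)) ∪ M₁ ∪ ⋯ ∪ Mₙ` for at most `m` minimal sets in
`G − cl(EP(f))`, where `m` is the greatest number of pairwise disjoint circles in `G`. -/
theorem closure_recurrent_decomposition {G : Type*} [MetricSpace G] (V : Set G)
    (hG : IsTopGraph V) (f : G → G) (hf : Continuous f) (m : ℕ)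
    (hm1 : ∃ C : Fin m → Set G, (∀ i, IsCircle (C i)) ∧
      Pairwise fun i j => Disjoint (C i) (C j))
    (hm2 : ∀ (l : ℕ) (C : Fin l → Set G), (∀ i, IsCircle (C i)) →
      (Pairwise fun i j => Disjoint (C i) (C j)) → l ≤ m) :
    ∃ n : ℕ, n ≤ m ∧ ∃ M : Fin n → Set G,
      (∀ i, IsMinimalSet f (M i) ∧ M i ⊆ (closure (evPeriodicPts f))ᶜ) ∧
      closure (recurrentPts f) = closure (Function.periodicPts f) ∪ ⋃ i, M i := by
  have := hG.compact
  set 𝓜 : Set (Set G) := omegaSet f '' (recurrentPts f \ closure (periodicPts f)) with h𝓜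
  have hmin : ∀ M ∈ 𝓜, IsMinimalSet f M ∧ M ⊆ (closure (evPeriodicPts f))ᶜ ∧ M.Infinite ∧
      ∃ Y C : Set G, IsCircle C ∧ C ⊆ Y ∧ f '' Y ⊆ Y ∧ (closure Y \ Y).Finite ∧
        ∀ w ∈ Y, M ⊆ omegaSet f w := by
    rintro _ ⟨x, hx, rfl⟩
    obtain ⟨h1, h2, h3⟩ := hG.exists_saturated_of_recurrent hf hx.1 hx.2
    exact ⟨h1, h2, omegaSet_infinite_of_recurrent hf hx.1 fun h => hx.2 (subset_closure h), h3⟩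
  choose! h1 h2 h3 Y C hC hCY hYf hYc hYω using hmin
  have hsub : ∀ M ∈ 𝓜, ∀ M' ∈ 𝓜, ∀ w ∈ Y M, w ∈ Y M' → M ⊆ M' := by
    intro M hM M' hM' w hw hw'
    have hcl : M' ⊆ closure (Y M) := (hYω M' hM' w hw').trans
      (omegaSet_subset_of_closed isClosed_closure (closure_image_subset hf (hYf M hM))
        (subset_closure hw))
    obtain ⟨z, hzM', hzn⟩ := ((h3 M' hM').sdiff (hYc M hM)).nonempty
    have hzY : z ∈ Y M := by
      by_contra h
      exact hzn ⟨hcl hzM', h⟩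
    exact (hYω M hM z hzY).trans
      (omegaSet_subset_of_closed (h1 M' hM').2.1 (h1 M' hM').2.2.1 hzM')
  obtain ⟨hfin, hcard⟩ := Set.finite_ncard_le_of_disjoint (𝓜 := 𝓜) hm2 ⟨C, hC, by
    intro M hM M' hM' hne
    refine disjoint_left.2 fun w hw hw' => hne ?_
    exact (hsub M hM M' hM' w (hCY M hM hw) (hCY M' hM' hw')).antisymm
      (hsub M' hM' M hM w (hCY M' hM' hw') (hCY M hM hw))⟩
  have := hfin.to_subtype
  have e : Fin 𝓜.ncard ≃ 𝓜 := (Finite.equivFinOfCardEq rfl).symm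
  refine ⟨𝓜.ncard, hcard, fun i => e i, fun i => ⟨h1 _ (e i).2, h2 _ (e i).2⟩, ?_⟩
  have hU : ⋃ i, (e i : Set G) = ⋃₀ 𝓜 := by
    rw [sUnion_eq_iUnion]
    exact e.surjective.iUnion_comp fun M : 𝓜 => (M : Set G)
  rw [hU]
  apply Subset.antisymm
  · refine closure_minimal (fun x hx => ?_)
      (isClosed_closure.union (sUnion_eq_biUnion ▸ hfin.isClosed_biUnion fun M hM => (h1 M hM).2.1))
    by_cases hxP : x ∈ closure (periodicPts f)
    · exact Or.inl hxP
    · exact Or.inr ⟨_, ⟨x, ⟨hx, hxP⟩, rfl⟩, hx⟩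
  · refine union_subset (closure_mono periodicPts_subset_recurrentPts) (sUnion_subset fun M hM => ?_)
    exact ((h1 M hM).subset_recurrentPts hf).trans subset_closure
end
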